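/- Let p = (p_i)_{i∈ℕ} be a probability distribution on ℕ, X^n a sample of n ≥ 2 i.i.d. observations from p, and p̂ the maximum likelihood estimator. Let δ₁ > 0, δ₂ > 0, and let m be a positive even integer. Then with probability at least 1 − δ₁ − δ₂, sup_{i∈ℕ} |p_i − p̂_i(X^n)| ≤ (1/n) · [ (1/δ₁) · (n/(n−1)) · ( Σ_{i∈ℕ} Σ_{k=1}^{m/2} k^{m−k} n^k (p̂_i(1−p̂_i))^k + ε ) ]^{1/m}, where ε = √((n/2)·log(1/δ₂)) · Σ_{k=1}^{m/2} k^{m−k} n^k ( k/(n·4^{k−1}) + 3k^3/(n^3·2^{2k−5}) ). -/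

import Mathlib

open MeasureTheory Real Filter

noncomputable def sampleMeasure (p : PMF ℕ) (n : ℕ) : Measure (Fin n → ℕ) :=
  MeasureTheory.Measure.pi fun _ => p.toMeasure

noncomputable def mle (n : ℕ) (x : Fin n → ℕ) (i : ℕ) : ℝ :=
  ((Finset.univ.filter fun j => x j = i).card : ℝ) / n


/-- Binomial expectation, defined recursively. -/
noncomputable def bE (q : ℝ) : ℕ → (ℕ → ℝ) → ℝ
  | 0, g => g 0
  | n + 1, g => bE q n (fun k => (1 - q) * g k + q * g (k + 1))

lemma bE_add (q : ℝ) (n : ℕ) : ∀ g h : ℕ → ℝ, bE q n (fun k => g k + h k) = bE q n g + bE q n h := by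
  induction n with
  | zero => intro g h; simp [bE]
  | succ n ih =>
    intro g h
    simp only [bE]
    rw [← ih]
    congr 1; funext k; ring

lemma bE_mul (q c : ℝ) (n : ℕ) : ∀ g : ℕ → ℝ, bE q n (fun k => c * g k) = c * bE q n g := by
  induction n with
  | zero => intro g; simp [bE]
  | succ n ih =>
    intro g
    simp only [bE]
    rw [← ih]
    congr 1; funext k; ring

lemma bE_const (q c : ℝ) (n : ℕ) : bE q n (fun _ => c) = c := by
  induction n with
  | zero => simp [bE]
  | succ n ih =>
    simp only [bE]
    rw [← ih]
    congr 1; funext k; rw [ih]; ring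

lemma bE_mono {q : ℝ} (h0 : 0 ≤ q) (h1 : q ≤ 1) (n : ℕ) :
    ∀ g h : ℕ → ℝ, (∀ k ≤ n, g k ≤ h k) → bE q n g ≤ bE q n h := by
  induction n with
  | zero => intro g h H; simpa [bE] using H 0 le_rfl
  | succ n ih =>
    intro g h H
    simp only [bE]
    apply ih
    intro k hk
    have a := H k (by omega)
    have b := H (k + 1) (by omega)
    have : 0 ≤ 1 - q := by linarith
    gcongr

lemma bE_nonneg {q : ℝ} (h0 : 0 ≤ q) (h1 : q ≤ 1) (n : ℕ) (g : ℕ → ℝ)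
    (H : ∀ k ≤ n, 0 ≤ g k) : 0 ≤ bE q n g := by
  have := bE_mono h0 h1 n (fun _ => 0) g H
  rwa [bE_const] at this

lemma bE_stein (q : ℝ) (n : ℕ) : ∀ f : ℕ → ℝ,
    bE q (n + 1) (fun k => ((k : ℝ) - (n + 1 : ℕ) * q) * f k)
      = (n + 1 : ℕ) * (q * (1 - q)) * bE q n (fun k => f (k + 1) - f k) := by
  induction n with
  | zero => intro f; simp [bE]; ring
  | succ n ih =>
    intro f
    rw [bE]
    have e : (fun k : ℕ => (1 - q) * (((k : ℝ) - (n + 1 + 1 : ℕ) * q) * f k)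
        + q * (((k + 1 : ℕ) : ℝ) - (n + 1 + 1 : ℕ) * q) * f (k + 1))
        = fun k : ℕ => (((k : ℝ) - (n + 1 : ℕ) * q) * ((1 - q) * f k + q * f (k + 1)))
          + (q * (1 - q)) * (f (k + 1) - f k) := by
      funext k; push_cast; ring
    have e' : (fun k : ℕ => (1 - q) * (((k : ℝ) - (n + 1 + 1 : ℕ) * q) * f k)
        + q * ((((k + 1 : ℕ) : ℝ) - (n + 1 + 1 : ℕ) * q) * f (k + 1)))
        = fun k : ℕ => (((k : ℝ) - (n + 1 : ℕ) * q) * ((1 - q) * f k + q * f (k + 1)))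
          + (q * (1 - q)) * (f (k + 1) - f k) := by
      rw [← e]; funext k; ring
    rw [e', bE_add, bE_mul, ih (fun k => (1 - q) * f k + q * f (k + 1))]
    have e2 : bE q n (fun k => ((1 - q) * f (k + 1) + q * f (k + 1 + 1)) - ((1 - q) * f k + q * f (k + 1)))
        = bE q (n + 1) (fun k => f (k + 1) - f k) := by
      rw [bE]; congr 1; funext k; ring
    rw [e2]; push_cast; ring

/-- central moments -/
noncomputable def cM (q : ℝ) (n j : ℕ) : ℝ := bE q n (fun k => ((k : ℝ) - n * q) ^ j)

lemma trapz (x : ℝ) (j : ℕ) :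
    (x + 1) ^ (2 * j + 1) - x ^ (2 * j + 1) ≤ (2 * j + 1) / 2 * (x ^ (2 * j) + (x + 1) ^ (2 * j)) := by
  induction j with
  | zero => simp; norm_num
  | succ j ih =>
    have id1 : (x + 1) ^ (2 * (j + 1) + 1) - x ^ (2 * (j + 1) + 1)
        = ((x + 1) ^ (2 * (j + 1)) + x ^ (2 * (j + 1)))
          + x * (x + 1) * ((x + 1) ^ (2 * j + 1) - x ^ (2 * j + 1)) := by ring
    have hodd : Odd (2 * j + 1) := ⟨j, rfl⟩
    have hmono : x ^ (2 * j + 1) ≤ (x + 1) ^ (2 * j + 1) := hodd.strictMono_pow.monotone (by linarith)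
    have e1 : 0 ≤ x ^ (2 * (j + 1)) := (even_two_mul _).pow_nonneg _
    have e2 : 0 ≤ (x + 1) ^ (2 * (j + 1)) := (even_two_mul _).pow_nonneg _
    rw [id1]
    push_cast
    by_cases h : 0 ≤ x * (x + 1)
    · have h3 := mul_le_mul_of_nonneg_left ih h
      have h4 : x * (x + 1) * (x ^ (2 * j) + (x + 1) ^ (2 * j)) ≤ x ^ (2 * (j + 1)) + (x + 1) ^ (2 * (j + 1)) := by
        have : x ^ (2 * (j + 1)) + (x + 1) ^ (2 * (j + 1)) - x * (x + 1) * (x ^ (2 * j) + (x + 1) ^ (2 * j))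
            = (x + 1) ^ (2 * j + 1) - x ^ (2 * j + 1) := by ring
        linarith
      have h5 : (0:ℝ) ≤ (2 * j + 1) / 2 := by positivity
      have h6 := mul_le_mul_of_nonneg_left h4 h5
      nlinarith
    · have : x * (x + 1) * ((x + 1) ^ (2 * j + 1) - x ^ (2 * j + 1)) ≤ 0 :=
        mul_nonpos_of_nonpos_of_nonneg (by linarith) (by linarith)
      have hj : (0:ℝ) ≤ j := by positivity
      nlinarith

lemma cM_nonneg {q : ℝ} (h0 : 0 ≤ q) (h1 : q ≤ 1) (n j : ℕ) : 0 ≤ cM q n (2 * j) :=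
  bE_nonneg h0 h1 _ _ fun _ _ => (even_two_mul _).pow_nonneg _

lemma cM_zero (q : ℝ) (n : ℕ) : cM q n 0 = 1 := by simp [cM, bE_const]

lemma cM_stein (q : ℝ) (n j : ℕ) : cM q (n + 1) (j + 1) = (n + 1 : ℕ) * (q * (1 - q)) *
    bE q n (fun k => ((k : ℝ) - (n + 1 : ℕ) * q + 1) ^ j - ((k : ℝ) - (n + 1 : ℕ) * q) ^ j) := by
  have := bE_stein q n (fun k => ((k : ℝ) - (n + 1 : ℕ) * q) ^ j)
  rw [cM]
  calc _ = _ := by congr 1; funext k; ring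
    _ = _ := this
    _ = _ := by congr 2; funext k; push_cast; ring

lemma cM_two (q : ℝ) (n : ℕ) : cM q n 2 = n * (q * (1 - q)) := by
  cases n with
  | zero => simp [cM, bE]
  | succ n =>
    rw [cM_stein]
    simp [bE_const]

lemma cM_one (q : ℝ) (n : ℕ) : cM q n 1 = 0 := by
  cases n with
  | zero => simp [cM, bE]
  | succ n =>
    rw [cM_stein]
    simp [bE_const]

lemma cM_three (q : ℝ) (n : ℕ) : cM q n 3 = n * (q * (1 - q)) * (1 - 2 * q) := by
  cases n with
  | zero => simp [cM, bE]
  | succ n =>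
    rw [cM_stein]
    have h1 := cM_one q (n + 1)
    rw [cM, bE] at h1
    have : (fun k : ℕ => ((k : ℝ) - (n + 1 : ℕ) * q + 1) ^ 2 - ((k : ℝ) - (n + 1 : ℕ) * q) ^ 2)
      = fun k : ℕ => 2 * ((1 - q) * ((k : ℝ) - (n + 1 : ℕ) * q) ^ 1 + q * (((k + 1 : ℕ) : ℝ) - (n + 1 : ℕ) * q) ^ 1)
        + (1 - 2 * q) := by
      funext k; push_cast; ring
    rw [this, bE_add, bE_mul, h1, bE_const]; ring

lemma cM_rec {q : ℝ} (h0 : 0 ≤ q) (h1 : q ≤ 1) (n j : ℕ) :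
    cM q n (2 * j + 2) ≤ (2 * j + 1) * (n * (q * (1 - q)) * cM q n (2 * j) + (1 / 2 - q) * cM q n (2 * j + 1)) := by
  cases n with
  | zero => rcases j with _ | j <;> simp [cM, bE]
  | succ n =>
    set z : ℝ := (n + 1 : ℕ) * (q * (1 - q)) with hz
    have hz0 : 0 ≤ z := by have : 0 ≤ 1 - q := by linarith
                           positivity
    have A := cM_stein q n (2 * j + 1)
    have B := cM_stein q n (2 * j)
    have C : cM q (n + 1) (2 * j) = bE q n (fun k => (1 - q) * ((k : ℝ) - (n + 1 : ℕ) * q) ^ (2 * j)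
      + q * ((k : ℝ) - (n + 1 : ℕ) * q + 1) ^ (2 * j)) := by
      rw [cM, bE]; congr 1; funext k; push_cast; ring
    rw [← hz] at A B
    have D : bE q n (fun k => ((k : ℝ) - (n + 1 : ℕ) * q + 1) ^ (2 * j + 1) - ((k : ℝ) - (n + 1 : ℕ) * q) ^ (2 * j + 1))
      ≤ bE q n (fun k => (2 * j + 1) * ((1 - q) * ((k : ℝ) - (n + 1 : ℕ) * q) ^ (2 * j)
      + q * ((k : ℝ) - (n + 1 : ℕ) * q + 1) ^ (2 * j)) + ((2 * j + 1) * (1 / 2 - q)) * (((k : ℝ) - (n + 1 : ℕ) * q + 1) ^ (2 * j) - ((k : ℝ) - (n + 1 : ℕ) * q) ^ (2 * j))) := by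
      apply bE_mono h0 h1
      intro k _
      have := trapz ((k : ℝ) - (n + 1 : ℕ) * q) j
      refine this.trans (le_of_eq ?_)
      ring
    rw [bE_add, bE_mul, bE_mul, ← C] at D
    have := mul_le_mul_of_nonneg_left D hz0
    rw [← A] at this
    rw [show 2 * j + 2 = 2 * j + 1 + 1 from rfl]
    refine this.trans (le_of_eq ?_)
    rw [B]; ring

lemma cM_cs {q : ℝ} (h0 : 0 ≤ q) (h1 : q ≤ 1) (n j : ℕ) (τ : ℝ) (hτ : 0 < τ) :
    |cM q n (2 * j + 1)| ≤ (τ * cM q n (2 * j) + cM q n (2 * j + 2) / τ) / 2 := by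
  have key : ∀ s : ℝ, s ^ 2 = 1 → 0 ≤ τ ^ 2 * cM q n (2 * j) + (2 * s * τ) * cM q n (2 * j + 1) + cM q n (2 * j + 2) := by
    intro s hs
    have : 0 ≤ bE q n (fun k => (τ ^ 2 * ((k : ℝ) - n * q) ^ (2 * j) + (2 * s * τ) * ((k : ℝ) - n * q) ^ (2 * j + 1)) + ((k : ℝ) - n * q) ^ (2 * j + 2)) := by
      apply bE_nonneg h0 h1
      intro k _
      have : (τ ^ 2 * ((k : ℝ) - n * q) ^ (2 * j) + (2 * s * τ) * ((k : ℝ) - n * q) ^ (2 * j + 1)) + ((k : ℝ) - n * q) ^ (2 * j + 2) = ((k : ℝ) - n * q) ^ (2 * j) * ((k : ℝ) - n * q + s * τ) ^ 2 := by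
        have : (s * τ) ^ 2 = τ ^ 2 := by rw [mul_pow, hs, one_mul]
        rw [add_sq, this]; ring
      rw [this]
      have := (even_two_mul j).pow_nonneg ((k : ℝ) - n * q)
      positivity
    rw [bE_add, bE_add, bE_mul, bE_mul] at this
    exact this
  have k1 := key 1 (by norm_num)
  have k2 := key (-1) (by norm_num)
  have e : (τ * cM q n (2 * j) + cM q n (2 * j + 2) / τ) / 2 = (τ ^ 2 * cM q n (2 * j) + cM q n (2 * j + 2)) / (2 * τ) := by
    field_simp
  rw [e, le_div_iff₀ (by positivity)]
  rcases abs_cases (cM q n (2 * j + 1)) with ⟨h, _⟩ | ⟨h, _⟩ <;> rw [h] <;> nlinarith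

/-- general ratio inequality -/
lemma cM_ratio {q : ℝ} (h0 : 0 ≤ q) (h1 : q ≤ 1) (n j : ℕ) (τ : ℝ) (hτ : 0 < τ) :
    cM q n (2 * j + 2) * (1 - (2 * j + 1) * |1 - 2 * q| / (4 * τ)) ≤
      (2 * j + 1) * (n * (q * (1 - q)) + |1 - 2 * q| * τ / 4) * cM q n (2 * j) := by
  have A := cM_rec h0 h1 n j
  have B := cM_cs h0 h1 n j τ hτ
  have C : (1 / 2 - q) * cM q n (2 * j + 1) ≤ |1 - 2 * q| / 2 * ((τ * cM q n (2 * j) + cM q n (2 * j + 2) / τ) / 2) := by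
    calc (1 / 2 - q) * cM q n (2 * j + 1) ≤ |(1 / 2 - q) * cM q n (2 * j + 1)| := le_abs_self _
      _ = |1 - 2 * q| / 2 * |cM q n (2 * j + 1)| := by
        rw [abs_mul, show (1 / 2 - q) = (1 - 2 * q) / 2 by ring, abs_div]; norm_num
      _ ≤ _ := by gcongr
  have h5 : (0:ℝ) ≤ (2 * j + 1) := by positivity
  have D := mul_le_mul_of_nonneg_left C h5
  have e : cM q n (2 * j + 2) * (1 - (2 * j + 1) * |1 - 2 * q| / (4 * τ)) = cM q n (2 * j + 2) - (2 * j + 1) * (|1 - 2 * q| / 2 * ((cM q n (2 * j + 2) / τ) / 2)) := by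
    field_simp; ring
  rw [e]
  nlinarith

/-- bound with τ, dropping `|1-2q| ≤ 1` -/
lemma cM_lin {q : ℝ} (h0 : 0 ≤ q) (h1 : q ≤ 1) (n j : ℕ) (τ : ℝ) (hτ : 0 < τ) :
    cM q n (2 * j + 2) * (1 - (2 * j + 1) / (4 * τ)) ≤
      (2 * j + 1) * (n * (q * (1 - q)) + τ / 4) * cM q n (2 * j) := by
  have A := cM_ratio h0 h1 n j τ hτ
  have hc : |1 - 2 * q| ≤ 1 := by rw [abs_le]; constructor <;> linarith
  have p0 := cM_nonneg h0 h1 n j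
  have p1 : 0 ≤ cM q n (2 * j + 2) := cM_nonneg h0 h1 n (j + 1)
  have h5 : (0:ℝ) ≤ (2 * j + 1) := by positivity
  calc cM q n (2 * j + 2) * (1 - (2 * j + 1) / (4 * τ)) ≤ cM q n (2 * j + 2) * (1 - (2 * j + 1) * |1 - 2 * q| / (4 * τ)) := by
        gcongr; nlinarith
    _ ≤ _ := A
    _ ≤ _ := by gcongr; nlinarith

/-- uniform bound in q -/
lemma cM_unif {q : ℝ} (h0 : 0 ≤ q) (h1 : q ≤ 1) (n j : ℕ) (hn : 0 < n) :
    cM q n (2 * j + 2) * (4 * n - (2 * j + 1)) ≤ (2 * j + 1) * (n : ℝ) ^ 2 * cM q n (2 * j) := by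
  have p0 := cM_nonneg h0 h1 n j
  have p1 : 0 ≤ cM q n (2 * j + 2) := cM_nonneg h0 h1 n (j + 1)
  have hn' : (0:ℝ) < n := by exact_mod_cast hn
  by_cases hc : |1 - 2 * q| = 0
  · have hq : q = 1 / 2 := by rw [abs_eq_zero] at hc; linarith
    have A := cM_ratio h0 h1 n j 1 one_pos
    rw [hc] at A
    subst hq
    have : cM (1 / 2) n (2 * j + 2) ≤ (2 * j + 1) * n / 4 * cM (1 / 2) n (2 * j) := by
      refine le_trans (le_of_eq ?_) (A.trans (le_of_eq ?_)) <;> ring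
    have h5 : (0:ℝ) ≤ (2 * j + 1) := by positivity
    have := mul_le_mul_of_nonneg_left this (by positivity : (0:ℝ) ≤ 4 * n)
    nlinarith
  · have hc' : 0 < |1 - 2 * q| := lt_of_le_of_ne (abs_nonneg _) (Ne.symm hc)
    have A := cM_ratio h0 h1 n j (n * |1 - 2 * q|) (by positivity)
    have e1 : (2 * (j:ℝ) + 1) * |1 - 2 * q| / (4 * (n * |1 - 2 * q|)) = (2 * j + 1) / (4 * n) := by
      field_simp
    have e2 : n * (q * (1 - q)) + |1 - 2 * q| * (n * |1 - 2 * q|) / 4 = (n:ℝ) / 4 := by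
      have : |1 - 2 * q| * |1 - 2 * q| = (1 - 2 * q) ^ 2 := by rw [abs_mul_abs_self]; ring
      linear_combination (n:ℝ) / 4 * this
    rw [e1, e2] at A
    have := mul_le_mul_of_nonneg_left A (by positivity : (0:ℝ) ≤ 4 * n)
    have e3 : 4 * (n:ℝ) * (cM q n (2 * j + 2) * (1 - (2 * j + 1) / (4 * n))) = cM q n (2 * j + 2) * (4 * n - (2 * j + 1)) := by
      field_simp
    rw [e3] at this
    refine this.trans (le_of_eq ?_); ring

lemma cM_triv {q : ℝ} (h0 : 0 ≤ q) (h1 : q ≤ 1) (n j : ℕ) :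
    cM q n (2 * j + 2) ≤ (n : ℝ) ^ 2 * cM q n (2 * j) := by
  unfold cM
  rw [← bE_mul]
  apply bE_mono h0 h1
  intro k hk
  have hk' : (k:ℝ) ≤ n := by exact_mod_cast hk
  have hk0 : (0:ℝ) ≤ k := by positivity
  have hn : (0:ℝ) ≤ n := by positivity
  have : ((k : ℝ) - n * q) ^ 2 ≤ (n:ℝ) ^ 2 := by
    apply sq_le_sq'
    · nlinarith
    · nlinarith
  have e := (even_two_mul j).pow_nonneg ((k : ℝ) - n * q)
  rw [pow_add]
  nlinarith

lemma bE_Y (q : ℝ) (n : ℕ) (hn : 0 < n) : bE q n (fun k => (k : ℝ) * (n - k) / n) = (n - 1) * (q * (1 - q)) := by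
  have hn' : (n:ℝ) ≠ 0 := by positivity
  have : (fun k : ℕ => (k : ℝ) * (n - k) / n) = fun k : ℕ => ((-1 / n : ℝ) * ((k : ℝ) - n * q) ^ 2 + (1 - 2 * q) * ((k : ℝ) - n * q) ^ 1) + n * (q * (1 - q)) := by
    funext k; field_simp; ring
  rw [this, bE_add, bE_add, bE_mul, bE_mul, bE_const]
  have h2 := cM_two q n
  have h1 := cM_one q n
  unfold cM at h1 h2
  rw [h1, h2]; field_simp; ring

lemma bE_Ypow {q : ℝ} (h0 : 0 ≤ q) (h1 : q ≤ 1) (n k : ℕ) (hn : 0 < n) :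
    ((n - 1) * (q * (1 - q))) ^ k ≤ bE q n (fun b => ((b : ℝ) * (n - b) / n) ^ k) := by
  have hn' : (0:ℝ) < n := by positivity
  have hn1 : (1:ℝ) ≤ n := by exact_mod_cast hn
  set x := (n - 1) * (q * (1 - q)) with hx
  have hx0 : 0 ≤ x := by
    have : 0 ≤ 1 - q := by linarith
    have : (0:ℝ) ≤ n - 1 := by linarith
    positivity
  rcases k with _ | k
  · simp [bE_const]
  have : ∀ b ≤ n, (k + 1) * x ^ k * ((b : ℝ) * (n - b) / n) + (- k * x ^ (k + 1)) ≤ ((b : ℝ) * (n - b) / n) ^ (k + 1) := by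
    intro b hb
    have hb' : (b:ℝ) ≤ n := by exact_mod_cast hb
    have hy0 : 0 ≤ (b : ℝ) * (n - b) / n := by
      have : (0:ℝ) ≤ n - b := by linarith
      positivity
    set y := (b : ℝ) * (n - b) / n
    have hconv := (convexOn_pow (k + 1) : ConvexOn ℝ (Set.Ici 0) fun x : ℝ => x ^ (k + 1))
    rcases hx0.eq_or_lt with h | h
    · rw [← h]; rcases k with _ | k
      · simp
      · simp; positivity
    · have := one_add_mul_le_pow (a := y / x - 1) (by have : 0 ≤ y / x := by positivity
                                                      linarith) (k + 1)
      rw [add_sub_cancel, div_pow, le_div_iff₀ (by positivity)] at this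
      refine le_trans (le_of_eq ?_) this
      push_cast; field_simp; ring
  have := bE_mono h0 h1 n _ _ this
  rw [bE_add, bE_mul, bE_const, bE_Y q n hn, ← hx] at this
  refine le_trans (le_of_eq ?_) this
  ring

instance sampleMeasure_prob (p : PMF ℕ) (n : ℕ) : IsProbabilityMeasure (sampleMeasure p n) := by
  unfold sampleMeasure; infer_instance

lemma sm_integrable (p : PMF ℕ) (n : ℕ) (f : (Fin n → ℕ) → ℝ) (C : ℝ) (h : ∀ x, |f x| ≤ C) :
    Integrable f (sampleMeasure p n) :=
  Integrable.of_bound (Measurable.of_discrete).aestronglyMeasurable C (ae_of_all _ h)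

lemma pm_integrable (p : PMF ℕ) (f : ℕ → ℝ) (C : ℝ) (h : ∀ x, |f x| ≤ C) :
    Integrable f p.toMeasure :=
  Integrable.of_bound (Measurable.of_discrete).aestronglyMeasurable C (ae_of_all _ h)

lemma sm_mp (p : PMF ℕ) (n : ℕ) : MeasurePreserving
    (fun z : ℕ × (Fin n → ℕ) => (Fin.cons z.1 z.2 : Fin (n+1) → ℕ))
    (p.toMeasure.prod (sampleMeasure p n)) (sampleMeasure p (n+1)) := by
  unfold sampleMeasure
  have h := (measurePreserving_piFinSuccAbove (fun _ : Fin (n+1) => p.toMeasure) 0).symm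
  convert h using 1
  funext z
  simp [MeasurableEquiv.piFinSuccAbove, Fin.insertNthEquiv]

lemma sm_succ (p : PMF ℕ) (n : ℕ) (f : (Fin (n+1) → ℕ) → ℝ) (C : ℝ) (h : ∀ x, |f x| ≤ C) :
    ∫ x, f x ∂(sampleMeasure p (n+1))
      = ∫ a, ∫ y, f (Fin.cons a y) ∂(sampleMeasure p n) ∂p.toMeasure := by
  rw [← (sm_mp p n).map_eq, integral_map (Measurable.of_discrete).aemeasurable
    (Measurable.of_discrete).aestronglyMeasurable]
  rw [integral_prod]
  exact Integrable.of_bound (Measurable.of_discrete).aestronglyMeasurable C (ae_of_all _ fun _ => h _)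

lemma sm_succ' (p : PMF ℕ) (n : ℕ) (f : (Fin (n+1) → ℕ) → ℝ) (C : ℝ) (h : ∀ x, |f x| ≤ C) :
    ∫ x, f x ∂(sampleMeasure p (n+1))
      = ∫ y, ∫ a, f (Fin.cons a y) ∂p.toMeasure ∂(sampleMeasure p n) := by
  rw [sm_succ p n f C h, integral_integral_swap]
  exact Integrable.of_bound (Measurable.of_discrete).aestronglyMeasurable C (ae_of_all _ fun _ => h _)

/-- number of occurrences -/
def cnt {n : ℕ} (x : Fin n → ℕ) (i : ℕ) : ℕ := (Finset.univ.filter fun j => x j = i).card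

lemma cnt_eq_sum {n : ℕ} (x : Fin n → ℕ) (i : ℕ) : cnt x i = ∑ j, if x j = i then 1 else 0 := by
  simp [cnt]

lemma cnt_cons {n : ℕ} (a : ℕ) (y : Fin n → ℕ) (i : ℕ) :
    cnt (Fin.cons a y : Fin (n+1) → ℕ) i = cnt y i + if a = i then 1 else 0 := by
  rw [cnt_eq_sum, cnt_eq_sum, Fin.sum_univ_succ, add_comm]; rfl

lemma cnt_le {n : ℕ} (x : Fin n → ℕ) (i : ℕ) : cnt x i ≤ n := by
  unfold cnt; exact (Finset.card_filter_le _ _).trans (by simp)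

lemma pm_singleton (p : PMF ℕ) (i : ℕ) : p.toMeasure.real {i} = (p i).toReal := by
  simp [Measure.real, PMF.toMeasure_apply_singleton]

lemma pm_ite (p : PMF ℕ) (i : ℕ) (u v : ℝ) :
    ∫ a, (if a = i then u else v) ∂p.toMeasure = (1 - (p i).toReal) * v + (p i).toReal * u := by
  have : (fun a : ℕ => if a = i then u else v) = fun a => v + Set.indicator {i} (fun _ => u - v) a := by
    funext a; by_cases h : a = i <;> simp [h]
  rw [this, integral_add (by simp), integral_indicator_const, pm_singleton]
  · simp; ring
  · exact MeasurableSet.of_discrete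
  · exact (integrable_const _).indicator MeasurableSet.of_discrete

lemma p_le_one (p : PMF ℕ) (i : ℕ) : (p i).toReal ≤ 1 := by
  have := p.coe_le_one i
  exact ENNReal.toReal_le_of_le_ofReal zero_le_one (by simpa using this)

lemma g_bdd (g : ℕ → ℝ) (n : ℕ) : ∃ C, ∀ x : Fin n → ℕ, ∀ i, |g (cnt x i)| ≤ C := by
  refine ⟨∑ k ∈ Finset.range (n+1), |g k|, fun x i => ?_⟩
  exact Finset.single_le_sum (f := fun k => |g k|) (fun _ _ => abs_nonneg _)
    (Finset.mem_range.2 (Nat.lt_succ_of_le (cnt_le x i)))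

lemma int_cnt (p : PMF ℕ) (i : ℕ) (n : ℕ) : ∀ g : ℕ → ℝ,
    ∫ x, g (cnt x i) ∂(sampleMeasure p n) = bE (p i).toReal n g := by
  induction n with
  | zero => intro g; simp [bE, cnt]
  | succ n ih =>
    intro g
    obtain ⟨C, hC⟩ := g_bdd g (n+1)
    rw [sm_succ' p n _ C (fun x => hC x i), bE, ← ih]
    congr 1; funext y
    rw [← pm_ite]
    congr 1; funext a
    rw [cnt_cons]; split_ifs <;> simp

lemma lint_cnt (p : PMF ℕ) (i : ℕ) (n : ℕ) (g : ℕ → ℝ) (hg : ∀ k ≤ n, 0 ≤ g k) :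
    ∫⁻ x, ENNReal.ofReal (g (cnt x i)) ∂(sampleMeasure p n) = ENNReal.ofReal (bE (p i).toReal n g) := by
  obtain ⟨C, hC⟩ := g_bdd g n
  rw [← int_cnt, ofReal_integral_eq_lintegral_ofReal (sm_integrable p n _ C (fun x => hC x i))]
  exact ae_of_all _ fun x => hg _ (cnt_le x i)

lemma cnt_finite {n : ℕ} (x : Fin n → ℕ) : ∀ i, i ∉ Finset.univ.image x → cnt x i = 0 := by
  intro i hi
  simp only [cnt, Finset.card_eq_zero, Finset.filter_eq_empty_iff]
  intro j _ h
  exact hi (Finset.mem_image.2 ⟨j, Finset.mem_univ _, h⟩)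

lemma p_sum (p : PMF ℕ) : HasSum (fun i => (p i).toReal) 1 := by
  have h := p.tsum_coe
  have h2 : Summable fun i => (p i).toReal := ENNReal.summable_toReal (by rw [h]; simp)
  have := h2.hasSum
  rwa [← ENNReal.tsum_toReal_eq (fun i => p.apply_ne_top i), h] at this

lemma hoeff (p : PMF ℕ) (X : ℕ → ℝ) (C c t : ℝ) (hC : ∀ a, |X a| ≤ C) (hc : ∀ a b, X a - X b ≤ c) :
    ∫ a, exp (t * (X a - ∫ b, X b ∂p.toMeasure)) ∂p.toMeasure ≤ exp ((c / 2) ^ 2 * t ^ 2 / 2) := by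
  have bb : BddBelow (Set.range X) := ⟨-C, by rintro _ ⟨a, rfl⟩; exact (abs_le.1 (hC a)).1⟩
  have h0 : 0 ≤ c := by have := hc 0 0; linarith
  have h := ProbabilityTheory.hasSubgaussianMGF_of_mem_Icc (μ := p.toMeasure) (X := X)
    (a := ⨅ a, X a) (b := (⨅ a, X a) + c) (Measurable.of_discrete).aemeasurable
    (ae_of_all _ fun a => ⟨ciInf_le bb a, by
      have : X a - c ≤ ⨅ b, X b := le_ciInf fun b => by have := hc a b; linarith
      linarith⟩)
  have h2 := h.mgf_le t
  simp only [ProbabilityTheory.mgf, add_sub_cancel_left] at h2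
  refine h2.trans (le_of_eq ?_)
  simp [abs_of_nonneg h0]

lemma mcd_mgf (p : PMF ℕ) (c t : ℝ) (n : ℕ) : ∀ (f : (Fin n → ℕ) → ℝ) (C : ℝ), (∀ x, |f x| ≤ C) →
    (∀ x j a, f (Function.update x j a) - f x ≤ c) →
    ∫ x, exp (t * (f x - ∫ y, f y ∂sampleMeasure p n)) ∂sampleMeasure p n
      ≤ exp (n * ((c / 2) ^ 2 * t ^ 2 / 2)) := by
  induction n with
  | zero =>
    intro f C hC hc
    have : ∀ x : Fin 0 → ℕ, f x = f default := fun x => by rw [Subsingleton.elim x default]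
    simp [this]
  | succ n ih =>
    intro f C hC hc
    set g : (Fin n → ℕ) → ℝ := fun y => ∫ a, f (Fin.cons a y) ∂p.toMeasure with hg
    have hgi : ∫ x, f x ∂sampleMeasure p (n+1) = ∫ y, g y ∂sampleMeasure p n := sm_succ' p n f C hC
    set m := ∫ y, g y ∂sampleMeasure p n with hm
    have hi : ∀ y : Fin n → ℕ, Integrable (fun a => f (Fin.cons a y)) p.toMeasure :=
      fun y => pm_integrable p _ C fun a => hC _
    have hgC : ∀ y, |g y| ≤ C := by
      intro y
      have := norm_integral_le_of_norm_le_const (μ := p.toMeasure) (f := fun a => f (Fin.cons a y))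
        (C := C) (ae_of_all _ fun a => hC _)
      simpa using this
    have hgc : ∀ x j a, g (Function.update x j a) - g x ≤ c := by
      intro x j a
      simp only [hg]
      rw [← integral_sub (hi _) (hi _)]
      have : ∫ b, (f (Fin.cons b (Function.update x j a)) - f (Fin.cons b x)) ∂p.toMeasure
          ≤ ∫ b, c ∂p.toMeasure := by
        refine integral_mono ((hi _).sub (hi _)) (integrable_const _) fun b => ?_
        have := hc (Fin.cons b x) j.succ a
        rwa [← Fin.cons_update] at this
      simpa using this
    have h1 := ih g C hgC hgc
    rw [hgi]
    have hmC : |m| ≤ C := by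
      have := norm_integral_le_of_norm_le_const (μ := sampleMeasure p n) (f := g)
        (C := C) (ae_of_all _ fun a => hgC _)
      simpa using this
    have eb : ∀ u : ℝ, |u| ≤ C → exp (t * (u - m)) ≤ exp (|t| * (2 * C)) := by
      intro u hu
      apply exp_le_exp.2
      refine (le_abs_self _).trans ?_
      rw [abs_mul]
      have : |u - m| ≤ 2 * C := (abs_sub _ _).trans (by linarith)
      gcongr
    rw [sm_succ' p n (fun x => exp (t * (f x - m))) (exp (|t| * (2 * C)))
      (fun x => by rw [abs_of_pos (exp_pos _)]; exact eb _ (hC x))]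
    have key : ∀ y : Fin n → ℕ, ∫ a, exp (t * (f (Fin.cons a y) - m)) ∂p.toMeasure
        ≤ exp ((c / 2) ^ 2 * t ^ 2 / 2) * exp (t * (g y - m)) := by
      intro y
      have e : (fun a => exp (t * (f (Fin.cons a y) - m)))
          = fun a => exp (t * (f (Fin.cons a y) - g y)) * exp (t * (g y - m)) := by
        funext a; rw [← exp_add]; ring_nf
      rw [e, integral_mul_const]
      refine mul_le_mul_of_nonneg_right ?_ (exp_pos _).le
      refine hoeff p (fun a => f (Fin.cons a y)) C c t (fun a => hC _) ?_
      intro a b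
      have := hc (Fin.cons b y) 0 a
      rwa [Fin.update_cons_zero] at this
    calc _ ≤ ∫ y, exp ((c / 2) ^ 2 * t ^ 2 / 2) * exp (t * (g y - m)) ∂sampleMeasure p n := by
          refine integral_mono ?_ ?_ key
          · refine sm_integrable p n _ (exp (|t| * (2 * C))) fun y => ?_
            have := norm_integral_le_of_norm_le_const (μ := p.toMeasure)
              (f := fun a => exp (t * (f (Fin.cons a y) - m)))
              (C := exp (|t| * (2 * C))) (ae_of_all _ fun a => by
                rw [norm_of_nonneg (exp_pos _).le]; exact eb _ (hC _))
            simpa using this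
          · refine (sm_integrable p n _ (exp (|t| * (2 * C))) fun y => ?_).const_mul _
            rw [abs_of_pos (exp_pos _)]; exact eb _ (hgC y)
      _ ≤ exp ((c / 2) ^ 2 * t ^ 2 / 2) * exp (n * ((c / 2) ^ 2 * t ^ 2 / 2)) := by
          rw [integral_const_mul]
          gcongr
      _ = _ := by rw [← exp_add]; push_cast; ring_nf

/-- McDiarmid, lower tail. -/
lemma mcd (p : PMF ℕ) (n : ℕ) (hn : 0 < n) (f : (Fin n → ℕ) → ℝ) (C c : ℝ) (hc0 : 0 < c)
    (hC : ∀ x, |f x| ≤ C)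
    (hc : ∀ x j a, f (Function.update x j a) - f x ≤ c) (L : ℝ) (hL : 0 ≤ L) :
    sampleMeasure p n {x | f x + c * √(n / 2 * L) ≤ ∫ y, f y ∂sampleMeasure p n}
      ≤ ENNReal.ofReal (exp (-L)) := by
  set m := ∫ y, f y ∂sampleMeasure p n with hm
  set r := √(n / 2 * L) with hr
  have hn' : (0:ℝ) < n := by exact_mod_cast hn
  have hr2 : r ^ 2 = n / 2 * L := sq_sqrt (by positivity)
  have hr0 : 0 ≤ r := sqrt_nonneg _
  set t := 4 * r / (n * c) with ht
  have ht0 : 0 ≤ t := by positivity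
  have hmC : |m| ≤ C := by
    have := norm_integral_le_of_norm_le_const (μ := sampleMeasure p n) (f := f)
      (C := C) (ae_of_all _ fun a => hC _)
    simpa using this
  have hint : Integrable (fun x => exp (-t * (f x - m))) (sampleMeasure p n) := by
    refine sm_integrable p n _ (exp (t * (2 * C))) fun x => ?_
    rw [abs_of_pos (exp_pos _), exp_le_exp]
    have a := abs_le.1 (hC x)
    have b := abs_le.1 hmC
    nlinarith
  have h1 := mcd_mgf p c (-t) n f C hC hc
  rw [← hm] at h1
  have h2 := mul_meas_ge_le_integral_of_nonneg (μ := sampleMeasure p n)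
    (f := fun x => exp (-t * (f x - m))) (ae_of_all _ fun x => (exp_pos _).le) hint (exp (t * (c * r)))
  have hset : {x | f x + c * r ≤ m} ⊆ {x | exp (t * (c * r)) ≤ exp (-t * (f x - m))} := by
    intro x hx
    simp only [Set.mem_setOf_eq, exp_le_exp] at hx ⊢
    nlinarith
  have h3 : (sampleMeasure p n).real {x | f x + c * r ≤ m} ≤ exp (-L) := by
    have h4 := measureReal_mono (μ := sampleMeasure p n) hset
    have h5 : exp (t * (c * r)) * (sampleMeasure p n).real {x | f x + c * r ≤ m}
        ≤ exp (n * ((c / 2) ^ 2 * (-t) ^ 2 / 2)) := by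
      refine le_trans ?_ (h2.trans h1)
      gcongr
    have e1 : t * (c * r) = 2 * L := by
      rw [ht]; field_simp; rw [hr2]; ring
    have e2 : n * ((c / 2) ^ 2 * (-t) ^ 2 / 2) = L := by
      have : t ^ 2 = 16 * r ^ 2 / (n * c) ^ 2 := by rw [ht, div_pow]; ring
      rw [neg_sq, this, hr2]; field_simp; ring
    rw [e1, e2] at h5
    have e3 : exp (2 * L) * exp (-L) = exp L := by rw [← exp_add]; ring_nf
    have := exp_pos (2 * L)
    rw [← e3] at h5
    exact le_of_mul_le_mul_left h5 this
  rw [← ENNReal.ofReal_toReal (measure_ne_top (sampleMeasure p n) _)]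
  exact ENNReal.ofReal_le_ofReal h3

lemma exp_aux1 (t : ℝ) (h0 : 0 ≤ t) (h1 : t ≤ 1) : 1 - exp (-t^2) ≤ t * (1 - exp (-1)) := by
  have e1 : exp (-1) = 1 / exp 1 := by rw [exp_neg]; simp
  have he := Real.exp_one_lt_d9
  have he' := Real.exp_one_gt_d9
  have E1 : exp (-1) ≤ 0.3679 := by
    rw [e1, div_le_iff₀ (by positivity)]; linarith
  rcases le_total t 0.6 with h | h
  · have := add_one_le_exp (-t^2)
    nlinarith
  · have hu : 0 ≤ 1 - t^2 := by nlinarith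
    have q := quadratic_le_exp_of_nonneg hu
    have e2 : exp (-t^2) = exp (-1) * exp (1 - t^2) := by rw [← exp_add]; ring_nf
    have key : exp 1 ≤ 2 + t + (1 - t) * (1 + t)^2 / 2 := by
      have : 0 ≤ (1 - t) * (1 + t)^2 := mul_nonneg (by linarith) (sq_nonneg _)
      nlinarith [mul_nonneg (by linarith : 0 ≤ 1 - t) (by linarith : 0 ≤ t - 0.6),
        mul_nonneg (mul_nonneg (by linarith : 0 ≤ 1 - t) (by linarith : 0 ≤ t - 0.6)) h0]
    have k2 : (1 - t) ≤ exp (-1) * ((1 - t) * (2 + t + (1 - t) * (1 + t)^2 / 2)) := by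
      have : 1 ≤ exp (-1) * (2 + t + (1 - t) * (1 + t)^2 / 2) := by
        have h3 : exp (-1) * exp 1 = 1 := by rw [← exp_add]; simp
        exact h3.symm.le.trans (mul_le_mul_of_nonneg_left key (exp_pos _).le)
      nlinarith
    rw [e2]
    have k3 : exp (-1) * (1 + (1 - t^2) + (1 - t^2)^2/2) ≤ exp (-1) * exp (1 - t^2) :=
      mul_le_mul_of_nonneg_left q (exp_pos _).le
    have k4 : (1 - t) * (2 + t + (1 - t) * (1 + t)^2 / 2) = (1 + (1 - t^2) + (1 - t^2)^2/2) - t := by ring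
    rw [k4] at k2
    nlinarith

lemma exp_aux2 (t : ℝ) (h0 : 0 ≤ t) : 1.5 * (1 - exp (-t^2)) ≤ t := by
  have he := Real.exp_one_lt_d9
  rcases le_total t 1 with h | h
  · have := exp_aux1 t h0 h
    have E1 : 0.36 ≤ exp (-1) := by
      rw [exp_neg, ← one_div, le_div_iff₀ (by positivity)]; linarith
    rcases le_total t 0.66 with h' | h'
    · have := add_one_le_exp (-t^2)
      nlinarith
    · have h3 : exp (-1) * exp 1 = 1 := by rw [← exp_add]; simp
      have E2 : 0.3678 ≤ exp (-1) := by
        rw [exp_neg, ← one_div, le_div_iff₀ (by positivity)]; linarith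
      nlinarith
  · rcases le_total t 1.5 with h' | h'
    · have k : 0.2667 ≤ exp (-1.25) := by
        have a : exp (-1.25) = exp (-1) * exp (-0.25) := by rw [← exp_add]; norm_num
        have b := add_one_le_exp (-0.25)
        have E2 : 0.3678 ≤ exp (-1) := by
          rw [exp_neg, ← one_div, le_div_iff₀ (by positivity)]; linarith
        rw [a]; nlinarith
      have e2 : exp (-t^2) = exp (-1.25) * exp (1.25 - t^2) := by rw [← exp_add]; ring_nf
      have q := add_one_le_exp (1.25 - t^2)
      have k2 : 0.2667 * (2.25 - t^2) ≤ exp (-t^2) := by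
        rw [e2]
        have : 0 ≤ 2.25 - t^2 := by nlinarith
        nlinarith [exp_pos (-1.25)]
      nlinarith
    · have := exp_pos (-t^2)
      linarith

noncomputable def yy (n b : ℕ) : ℝ := (b : ℝ) * (n - b) / n
noncomputable def hh (K n b : ℕ) : ℝ := ∑ k ∈ Finset.Icc 1 K, (k : ℝ)^(2 * K - k) * (yy n b)^k
noncomputable def FF (K n : ℕ) (x : Fin n → ℕ) : ℝ := ∑' i, hh K n (cnt x i)
noncomputable def CC (K n : ℕ) : ℝ :=
  ∑ k ∈ Finset.Icc 1 K, (k : ℝ)^(2 * K - k) * (n / 4 : ℝ)^k * (4 * k / n + 96 * k^3 / n^3)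
def bad (p : PMF ℕ) (K n : ℕ) (δ₁ δ₂ : ℝ) : Set (Fin n → ℕ) :=
  {x | ∃ i, (n : ℝ) / (n - 1) / δ₁ * (FF K n x + √(n / 2 * log (1 / δ₂)) * CC K n)
    < ((cnt x i : ℝ) - n * (p i).toReal) ^ (2 * K)}

lemma yy_zero (n : ℕ) : yy n 0 = 0 := by simp [yy]
lemma hh_zero (K n : ℕ) : hh K n 0 = 0 := by
  unfold hh
  refine Finset.sum_eq_zero fun k hk => ?_
  rw [Finset.mem_Icc] at hk
  rw [yy_zero, zero_pow (by omega), mul_zero]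
lemma yy_nonneg {n b : ℕ} (h : b ≤ n) : 0 ≤ yy n b := by
  have : (b : ℝ) ≤ n := by exact_mod_cast h
  unfold yy
  apply div_nonneg (mul_nonneg (by positivity) (by linarith)) (by positivity)
lemma hh_nonneg (K : ℕ) {n b : ℕ} (h : b ≤ n) : 0 ≤ hh K n b :=
  Finset.sum_nonneg fun k _ => mul_nonneg (by positivity) (pow_nonneg (yy_nonneg h) _)
lemma CC_nonneg (K n : ℕ) : 0 ≤ CC K n := Finset.sum_nonneg fun k _ => by positivity

lemma FF_eq (K n : ℕ) (x : Fin n → ℕ) (S : Finset ℕ) (hS : Finset.univ.image x ⊆ S) :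
    FF K n x = ∑ i ∈ S, hh K n (cnt x i) := by
  unfold FF
  refine tsum_eq_sum fun i hi => ?_
  rw [cnt_finite x i (fun h => hi (hS h)), hh_zero]

lemma FF_nonneg (K n : ℕ) (x : Fin n → ℕ) : 0 ≤ FF K n x :=
  tsum_nonneg fun i => hh_nonneg K (cnt_le x i)

lemma FF_bdd (K n : ℕ) : ∃ C, ∀ x : Fin n → ℕ, |FF K n x| ≤ C := by
  obtain ⟨C, hC⟩ := g_bdd (hh K n) n
  have hC0 : 0 ≤ C := (abs_nonneg _).trans (hC (fun _ => 0) 0)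
  refine ⟨n * C, fun x => ?_⟩
  rw [FF_eq K n x _ subset_rfl]
  refine (Finset.abs_sum_le_sum_abs _ _).trans ?_
  refine (Finset.sum_le_card_nsmul _ _ C fun i _ => hC x i).trans ?_
  rw [nsmul_eq_mul]
  have : (Finset.univ.image x).card ≤ n := Finset.card_image_le.trans (by simp)
  gcongr

lemma FF_diff (K n : ℕ) (c : ℝ) (hc : ∀ b < n, |hh K n (b+1) - hh K n b| ≤ c / 2)
    (x : Fin n → ℕ) (j : Fin n) (a : ℕ) : FF K n (Function.update x j a) - FF K n x ≤ c := by
  have c0 : 0 ≤ c := by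
    have := (abs_nonneg _).trans (hc 0 (by have := j.2; omega)); linarith
  by_cases h : a = x j
  · subst h; simpa using c0
  set S := insert a (Finset.univ.image x) with hS
  have h1 : Finset.univ.image x ⊆ S := Finset.subset_insert _ _
  have h2 : Finset.univ.image (Function.update x j a) ⊆ S := by
    intro i hi
    obtain ⟨l, -, rfl⟩ := Finset.mem_image.1 hi
    by_cases hl : l = j
    · subst hl; simp [hS]
    · simp [hS, Function.update_of_ne hl]
  rw [FF_eq K n _ S h1, FF_eq K n _ S h2, ← Finset.sum_sub_distrib]
  have key : ∀ i, cnt (Function.update x j a) i + (if x j = i then 1 else 0)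
      = cnt x i + (if a = i then 1 else 0) := by
    intro i
    rw [cnt_eq_sum, cnt_eq_sum, ← Finset.sum_erase_add _ _ (Finset.mem_univ j),
      ← Finset.sum_erase_add Finset.univ (fun l => if x l = i then 1 else 0) (Finset.mem_univ j)]
    have : ∑ l ∈ Finset.univ.erase j, (if Function.update x j a l = i then 1 else 0)
        = ∑ l ∈ Finset.univ.erase j, (if x l = i then 1 else 0) := by
      refine Finset.sum_congr rfl fun l hl => ?_
      rw [Function.update_of_ne (Finset.ne_of_mem_erase hl)]
    rw [this]; simp; ring
  have ha : a ∈ S := by simp [hS]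
  have hx : x j ∈ S.erase a := Finset.mem_erase.2 ⟨fun e => h e.symm, h1 (Finset.mem_image_of_mem _ (Finset.mem_univ _))⟩
  rw [← Finset.add_sum_erase _ _ ha, ← Finset.add_sum_erase _ _ hx, Finset.sum_eq_zero]
  · have k1 := key a
    have k2 := key (x j)
    rw [if_neg (fun e => h e.symm), if_pos rfl, add_zero] at k1
    rw [if_pos rfl, if_neg h, add_zero] at k2
    have l1 := cnt_le (Function.update x j a) a
    have l2 := cnt_le x (x j)
    have m1 := abs_le.1 (hc (cnt x a) (by omega))
    have m2 := abs_le.1 (hc (cnt (Function.update x j a) (x j)) (by omega))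
    rw [← k1] at m1; rw [k2] at m2
    linarith [m1.2, m2.1]
  · intro i hi
    have e1 : i ≠ x j := Finset.ne_of_mem_erase hi
    have e2 : i ≠ a := Finset.ne_of_mem_erase (Finset.mem_of_mem_erase hi)
    have k := key i
    rw [if_neg e1.symm, if_neg e2.symm] at k
    simp at k
    rw [k]; ring

lemma markov (p : PMF ℕ) (K n : ℕ) (S R : ℝ) (hR : 0 < R)
    (hS : ∑' i, ENNReal.ofReal (cM (p i).toReal n (2*K)) ≤ ENNReal.ofReal S) :
    sampleMeasure p n {x | ∃ i, R < ((cnt x i : ℝ) - n * (p i).toReal) ^ (2 * K)}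
      ≤ ENNReal.ofReal (S / R) := by
  set W : (Fin n → ℕ) → ENNReal :=
    fun x => ∑' i, ENNReal.ofReal (((cnt x i : ℝ) - n * (p i).toReal) ^ (2 * K)) with hW
  have h1 : ∫⁻ x, W x ∂sampleMeasure p n ≤ ENNReal.ofReal S := by
    rw [hW, lintegral_tsum (fun i => (Measurable.of_discrete).aemeasurable)]
    refine le_trans (le_of_eq ?_) hS
    congr 1; funext i
    exact lint_cnt p i n (fun k => ((k : ℝ) - n * (p i).toReal) ^ (2 * K))
      (fun k _ => by rw [pow_mul]; positivity)
  have h2 : {x | ∃ i, R < ((cnt x i : ℝ) - n * (p i).toReal) ^ (2 * K)} ⊆ {x | ENNReal.ofReal R ≤ W x} := by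
    rintro x ⟨i, hi⟩
    exact (ENNReal.ofReal_le_ofReal hi.le).trans
      (ENNReal.le_tsum (f := fun i => ENNReal.ofReal (((cnt x i : ℝ) - n * (p i).toReal) ^ (2 * K))) i)
  have hR' : ENNReal.ofReal R ≠ 0 := by simpa using hR
  refine (measure_mono h2).trans ((meas_ge_le_lintegral_div (Measurable.of_discrete).aemeasurable
    hR' ENNReal.ofReal_ne_top).trans ?_)
  rw [ENNReal.ofReal_div_of_pos hR]
  gcongr

lemma sum_z (p : PMF ℕ) (n : ℕ) (c : ℝ) (hc : 0 ≤ c) :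
    ∑' i, ENNReal.ofReal (c * (n * ((p i).toReal * (1 - (p i).toReal)))) ≤ ENNReal.ofReal (c * n) := by
  calc _ ≤ ∑' i, ENNReal.ofReal (c * n) * p i := by
        refine ENNReal.tsum_le_tsum fun i => ?_
        have h1 := p_le_one p i
        have h0 : 0 ≤ (p i).toReal := ENNReal.toReal_nonneg
        rw [← ENNReal.ofReal_toReal (p.apply_ne_top i), ← ENNReal.ofReal_mul (by positivity)]
        apply ENNReal.ofReal_le_ofReal
        rw [ENNReal.toReal_ofReal h0]
        rw [mul_assoc]
        gcongr
        nlinarith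
    _ = _ := by rw [ENNReal.tsum_mul_left, p.tsum_coe, mul_one]

lemma sum_M (p : PMF ℕ) (K n : ℕ) (c T : ℝ) (hc : 0 ≤ c) (hT : 0 ≤ T)
    (h : ∀ q : ℝ, 0 ≤ q → q ≤ 1 → cM q n (2*K) ≤ T * bE q n (hh K n) + c * (n * (q * (1 - q)))) :
    ∑' i, ENNReal.ofReal (cM (p i).toReal n (2*K))
      ≤ ENNReal.ofReal (T * (∫ x, FF K n x ∂sampleMeasure p n) + c * n) := by
  have e1 : ∫⁻ x, ENNReal.ofReal (FF K n x) ∂sampleMeasure p n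
      = ∑' i, ENNReal.ofReal (bE (p i).toReal n (hh K n)) := by
    have : ∀ x : Fin n → ℕ, ENNReal.ofReal (FF K n x) = ∑' i, ENNReal.ofReal (hh K n (cnt x i)) := by
      intro x
      rw [FF, ENNReal.ofReal_tsum_of_nonneg (fun i => hh_nonneg K (cnt_le x i))]
      refine summable_of_ne_finset_zero (s := Finset.univ.image x) fun i hi => ?_
      rw [cnt_finite x i hi, hh_zero]
    simp_rw [this]
    rw [lintegral_tsum (fun i => (Measurable.of_discrete).aemeasurable)]
    congr 1; funext i
    exact lint_cnt p i n _ fun k hk => hh_nonneg K hk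
  obtain ⟨C, hC⟩ := FF_bdd K n
  have e2 : ENNReal.ofReal (∫ x, FF K n x ∂sampleMeasure p n)
      = ∑' i, ENNReal.ofReal (bE (p i).toReal n (hh K n)) := by
    rw [← e1, ofReal_integral_eq_lintegral_ofReal (sm_integrable p n _ C hC)
      (ae_of_all _ fun x => FF_nonneg K n x)]
  have hF0 : 0 ≤ ∫ x, FF K n x ∂sampleMeasure p n := integral_nonneg fun x => FF_nonneg K n x
  rw [ENNReal.ofReal_add (by positivity) (by positivity), ENNReal.ofReal_mul hT, e2,
    ← ENNReal.tsum_mul_left]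
  refine le_trans ?_ (add_le_add_right (sum_z p n c hc) _)
  rw [← ENNReal.tsum_add]
  refine ENNReal.tsum_le_tsum fun i => ?_
  have h0 : 0 ≤ (p i).toReal := ENNReal.toReal_nonneg
  have h1 := p_le_one p i
  have hb := bE_nonneg h0 h1 n (hh K n) fun k hk => hh_nonneg K hk
  have h1' : 0 ≤ 1 - (p i).toReal := by linarith
  rw [← ENNReal.ofReal_mul hT, ← ENNReal.ofReal_add (by positivity) (by positivity)]
  exact ENNReal.ofReal_le_ofReal (h _ h0 h1)

lemma CC_pos (K n : ℕ) (hK : 1 ≤ K) (hn : 0 < n) : 0 < CC K n := by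
  unfold CC
  have hn' : (0:ℝ) < n := by exact_mod_cast hn
  refine Finset.sum_pos (fun k hk => ?_) ⟨1, by simp [hK]⟩
  have : (0:ℝ) < k := by have := (Finset.mem_Icc.1 hk).1; exact_mod_cast this
  positivity

/-- sigma trick -/
lemma eps_ge (δ₁ δ₂ : ℝ) (h1 : 0 < δ₁) (h2 : 0 < δ₂) (hs : δ₁ + δ₂ < 1) :
    1.5 / (δ₁ + δ₂) ≤ √(log (1 / δ₂)) / δ₁ := by
  have hL : 0 ≤ log (1 / δ₂) := log_nonneg (by rw [le_div_iff₀ h2]; linarith)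
  have h := exp_aux2 (√(log (1 / δ₂))) (sqrt_nonneg _)
  rw [sq_sqrt hL, one_div, log_inv, neg_neg, exp_log h2, ← log_inv, ← one_div] at h
  rw [div_le_div_iff₀ (by linarith) h1]
  nlinarith [mul_pos h2 (by linarith : 0 < 1 - δ₁ - δ₂)]

lemma E_core (p : PMF ℕ) (K n : ℕ) (hK : 1 ≤ K) (hn : 2 ≤ n) (δ₁ δ₂ : ℝ) (h1 : 0 < δ₁) (h2 : 0 < δ₂)
    (hs : δ₁ + δ₂ < 1) (c : ℝ) (hc0 : 0 ≤ c)
    (hM : ∀ q : ℝ, 0 ≤ q → q ≤ 1 → cM q n (2*K) ≤ c * (n * (q * (1 - q))))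
    (hc : c * n ≤ n / (n - 1) * (1.5 * (√(n / 2) * CC K n))) :
    sampleMeasure p n (bad p K n δ₁ δ₂) ≤ ENNReal.ofReal (δ₁ + δ₂) := by
  have hn' : (2:ℝ) ≤ n := by exact_mod_cast hn
  have hCC := CC_pos K n hK (by omega)
  have hT : 0 < (n:ℝ) / (n - 1) := div_pos (by linarith) (by linarith)
  set R := (n:ℝ) / (n - 1) * (1.5 * (√(n / 2) * CC K n)) / (δ₁ + δ₂) with hR
  have hR0 : 0 < R := by positivity
  have hS : ∑' i, ENNReal.ofReal (cM (p i).toReal n (2*K)) ≤ ENNReal.ofReal (c * n) := by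
    refine le_trans (ENNReal.tsum_le_tsum fun i => ?_) (sum_z p n c hc0)
    exact ENNReal.ofReal_le_ofReal (hM _ ENNReal.toReal_nonneg (p_le_one p i))
  refine (measure_mono ?_).trans ((markov p K n _ R hR0 hS).trans (ENNReal.ofReal_le_ofReal ?_))
  · rintro x ⟨i, hi⟩
    refine ⟨i, lt_of_le_of_lt ?_ hi⟩
    have e := eps_ge δ₁ δ₂ h1 h2 hs
    have e1 : √(n / 2 * log (1 / δ₂)) = √(n / 2) * √(log (1 / δ₂)) := sqrt_mul (by positivity) _
    rw [e1, hR]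
    have hF := FF_nonneg K n x
    calc (n:ℝ) / (n - 1) * (1.5 * (√(n / 2) * CC K n)) / (δ₁ + δ₂)
        = (n:ℝ) / (n - 1) * ((√(n / 2) * CC K n)) * (1.5 / (δ₁ + δ₂)) := by ring
      _ ≤ (n:ℝ) / (n - 1) * ((√(n / 2) * CC K n)) * (√(log (1 / δ₂)) / δ₁) := by gcongr
      _ = (n:ℝ) / (n - 1) / δ₁ * (√(n / 2) * √(log (1 / δ₂)) * CC K n) := by ring
      _ ≤ _ := by gcongr; linarith
  · rw [div_le_iff₀ hR0, hR]
    have : (δ₁ + δ₂) * ((n:ℝ) / (n - 1) * (1.5 * (√(n / 2) * CC K n)) / (δ₁ + δ₂))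
        = (n:ℝ) / (n - 1) * (1.5 * (√(n / 2) * CC K n)) := by field_simp
    rw [this]; exact hc

lemma P_core1 (p : PMF ℕ) (K n : ℕ) (hK : 1 ≤ K) (hn : 2 ≤ n) (δ₁ δ₂ : ℝ) (h1 : 0 < δ₁) (h2 : 0 < δ₂)
    (hs : δ₂ ≤ exp (-1)) (c η cF : ℝ) (hc0 : 0 ≤ c) (hη : 0 < η) (hη1 : η < 1)
    (hM : ∀ q : ℝ, 0 ≤ q → q ≤ 1 →
      cM q n (2*K) ≤ n / (n - 1) * bE q n (hh K n) + c * (n * (q * (1 - q))))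
    (hc : c * n ≤ n / (n - 1) * (η * (√(n / 2) * CC K n)))
    (hF : ∀ b < n, |hh K n (b+1) - hh K n b| ≤ cF / 2) (hcF : cF ≤ (1 - η) * CC K n) :
    sampleMeasure p n (bad p K n δ₁ δ₂) ≤ ENNReal.ofReal (δ₁ + δ₂) := by
  have hn' : (2:ℝ) ≤ n := by exact_mod_cast hn
  have hCC := CC_pos K n hK (by omega)
  have hT : 0 < (n:ℝ) / (n - 1) := div_pos (by linarith) (by linarith)
  obtain ⟨C, hC⟩ := FF_bdd K n
  set EF := ∫ x, FF K n x ∂sampleMeasure p n with hEF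
  have hEF0 : 0 ≤ EF := integral_nonneg fun x => FF_nonneg K n x
  have hL1 : 1 ≤ log (1 / δ₂) := by
    rw [one_div, log_inv]
    have := log_le_log h2 hs
    rw [log_exp] at this; linarith
  set L := log (1 / δ₂) with hL
  have hLe : exp (-L) = δ₂ := by rw [hL, one_div, log_inv, neg_neg, exp_log h2]
  set r := √(n / 2 * L) with hr
  have hr0 : 0 < r := sqrt_pos.2 (by positivity)
  have hrr : √(n / 2) ≤ r := sqrt_le_sqrt (by nlinarith)
  have hpos : 0 < (1 - η) * CC K n := mul_pos (by linarith) hCC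
  have m1 := mcd p n (by omega) (FF K n) C ((1 - η) * CC K n) hpos hC
    (fun x j a => (FF_diff K n cF hF x j a).trans hcF) L (by linarith)
  rw [hLe, ← hr, ← hEF] at m1
  set R := (n:ℝ) / (n - 1) * (EF + η * (r * CC K n)) / δ₁ with hR
  have hR0 : 0 < R := by positivity
  have m2 := markov p K n _ R hR0 (sum_M p K n c _ hc0 hT.le hM)
  have m3 : ((n:ℝ) / (n - 1) * EF + c * n) / R ≤ δ₁ := by
    rw [div_le_iff₀ hR0, hR]
    have : δ₁ * ((n:ℝ) / (n - 1) * (EF + η * (r * CC K n)) / δ₁)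
        = (n:ℝ) / (n - 1) * EF + (n:ℝ) / (n - 1) * (η * (r * CC K n)) := by field_simp
    rw [this]
    have : (n:ℝ) / (n - 1) * (η * (√(n / 2) * CC K n)) ≤ (n:ℝ) / (n - 1) * (η * (r * CC K n)) := by
      gcongr
    linarith
  rw [ENNReal.ofReal_add h1.le h2.le, add_comm]
  refine le_trans (measure_mono ?_) ((measure_union_le _ _).trans
    (add_le_add m1 (m2.trans (ENNReal.ofReal_le_ofReal m3))))
  rintro x ⟨i, hi⟩
  by_cases hx : FF K n x + (1 - η) * CC K n * r ≤ EF
  · exact Or.inl hx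
  · right
    refine ⟨i, lt_of_le_of_lt ?_ hi⟩
    push Not at hx
    rw [hR, mul_div_right_comm]
    refine mul_le_mul_of_nonneg_left ?_ (by positivity)
    linarith

lemma P_core (p : PMF ℕ) (K n : ℕ) (hK : 1 ≤ K) (hn : 2 ≤ n) (δ₁ δ₂ : ℝ) (h1 : 0 < δ₁) (h2 : 0 < δ₂)
    (hs : δ₁ + δ₂ < 1) (c η cF : ℝ) (hc0 : 0 ≤ c) (hη : 0 < η) (hη1 : η < 1)
    (hM : ∀ q : ℝ, 0 ≤ q → q ≤ 1 →
      cM q n (2*K) ≤ n / (n - 1) * bE q n (hh K n) + c * (n * (q * (1 - q))))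
    (hc : c * n ≤ n / (n - 1) * (η * (√(n / 2) * CC K n)))
    (hF : ∀ b < n, |hh K n (b+1) - hh K n b| ≤ cF / 2) (hcF : cF ≤ (1 - η) * CC K n) :
    sampleMeasure p n (bad p K n δ₁ δ₂) ≤ ENNReal.ofReal (δ₁ + δ₂) := by
  rcases le_total δ₂ (exp (-1)) with h | h
  · exact P_core1 p K n hK hn δ₁ δ₂ h1 h2 h c η cF hc0 hη hη1 hM hc hF hcF
  have h1' : 0 < δ₁ + δ₂ - exp (-1) := by linarith
  have := P_core1 p K n hK hn (δ₁ + δ₂ - exp (-1)) (exp (-1)) h1' (exp_pos _) le_rfl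
    c η cF hc0 hη hη1 hM hc hF hcF
  rw [sub_add_cancel] at this
  refine le_trans (measure_mono ?_) this
  rintro x ⟨i, hi⟩
  refine ⟨i, lt_of_le_of_lt ?_ hi⟩
  have hn' : (2:ℝ) ≤ n := by exact_mod_cast hn
  have hT : 0 < (n:ℝ) / (n - 1) := div_pos (by linarith) (by linarith)
  have hCC := CC_pos K n hK (by omega)
  have hFF := FF_nonneg K n x
  have e0 : log (1 / exp (-1)) = 1 := by rw [one_div, log_inv, log_exp, neg_neg]
  rw [e0, mul_one]
  have hL0 : 0 ≤ log (1 / δ₂) := log_nonneg (by rw [le_div_iff₀ h2]; linarith)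
  have hLe : exp (-log (1 / δ₂)) = δ₂ := by rw [one_div, log_inv, neg_neg, exp_log h2]
  have hL1 : log (1 / δ₂) ≤ 1 := by
    rw [one_div, log_inv]
    have := log_le_log (exp_pos _) h
    rw [log_exp] at this; linarith
  have hs1 : √(log (1 / δ₂)) ≤ 1 := sqrt_le_one.2 hL1
  have k := exp_aux1 (√(log (1 / δ₂))) (sqrt_nonneg _) hs1
  rw [sq_sqrt hL0, hLe] at k
  rw [sqrt_mul (by positivity) (log (1 / δ₂))]
  set t := √(log (1 / δ₂))
  set E := √((n:ℝ) / 2) * CC K n with hE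
  have hE0 : 0 ≤ E := by positivity
  have e1 : √((n:ℝ) / 2) * t * CC K n = t * E := by rw [hE]; ring
  rw [e1]
  have kk : δ₁ ≤ t * (δ₁ + δ₂ - exp (-1)) := by
    nlinarith [mul_nonneg (by linarith : 0 ≤ 1 - t) (by linarith : 0 ≤ 1 - δ₂ - δ₁)]
  have : (FF K n x + E) / (δ₁ + δ₂ - exp (-1)) ≤ (FF K n x + t * E) / δ₁ := by
    rw [div_le_div_iff₀ h1' h1]
    nlinarith
  calc _ = (n:ℝ) / (n - 1) * ((FF K n x + E) / (δ₁ + δ₂ - exp (-1))) := by ring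
    _ ≤ (n:ℝ) / (n - 1) * ((FF K n x + t * E) / δ₁) := mul_le_mul_of_nonneg_left this hT.le
    _ = _ := by ring

lemma final (p : PMF ℕ) (n : ℕ) (hn : 2 ≤ n) (δ₁ δ₂ : ℝ) (hδ₁ : 0 < δ₁) (hδ₂ : 0 < δ₂)
    (K : ℕ) (hK : 1 ≤ K) (hσ : δ₁ + δ₂ < 1)
    (H : sampleMeasure p n (bad p K n δ₁ δ₂) ≤ ENNReal.ofReal (δ₁ + δ₂)) :
    ENNReal.ofReal (1 - δ₁ - δ₂) ≤
      sampleMeasure p n {x |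
        (⨆ i : ℕ, |(p i).toReal - mle n x i|) ≤
          (1 / n) *
            ((1 / δ₁) * ((n : ℝ) / ((n : ℝ) - 1)) *
              ((∑' i : ℕ, ∑ k ∈ Finset.Icc 1 K,
                  (k : ℝ) ^ (2 * K - k) * (n : ℝ) ^ k *
                    (mle n x i * (1 - mle n x i)) ^ k) +
                Real.sqrt ((n / 2) * Real.log (1 / δ₂)) *
                  ∑ k ∈ Finset.Icc 1 K,
                    (k : ℝ) ^ (2 * K - k) * (n : ℝ) ^ k *
                      ((k : ℝ) / (n * (4 : ℝ) ^ ((k : ℤ) - 1)) +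
                        3 * (k : ℝ) ^ 3 / ((n : ℝ) ^ 3 * (2 : ℝ) ^ (2 * (k : ℤ) - 5))))) ^
              ((1 : ℝ) / (2 * K : ℕ))} := by
  have hn' : (2:ℝ) ≤ n := by exact_mod_cast hn
  have hT : 0 < (n:ℝ) / (n - 1) := div_pos (by linarith) (by linarith)
  have eC : ∑ k ∈ Finset.Icc 1 K,
                    (k : ℝ) ^ (2 * K - k) * (n : ℝ) ^ k *
                      ((k : ℝ) / (n * (4 : ℝ) ^ ((k : ℤ) - 1)) +
                        3 * (k : ℝ) ^ 3 / ((n : ℝ) ^ 3 * (2 : ℝ) ^ (2 * (k : ℤ) - 5))) = CC K n := by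
    unfold CC
    refine Finset.sum_congr rfl fun k _ => ?_
    have z1 : (4:ℝ) ^ ((k : ℤ) - 1) = 4 ^ k / 4 := by
      rw [zpow_sub₀ (by norm_num), zpow_natCast, zpow_one]
    have z2 : (2:ℝ) ^ (2 * (k : ℤ) - 5) = 4 ^ k / 32 := by
      rw [zpow_sub₀ (by norm_num), zpow_mul]; norm_num
    rw [z1, z2, div_pow]
    field_simp
    ring
  have eF : ∀ x : Fin n → ℕ, (∑' i : ℕ, ∑ k ∈ Finset.Icc 1 K,
                  (k : ℝ) ^ (2 * K - k) * (n : ℝ) ^ k *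
                    (mle n x i * (1 - mle n x i)) ^ k) = FF K n x := by
    intro x
    unfold FF hh
    congr 1; funext i
    refine Finset.sum_congr rfl fun k _ => ?_
    rw [mul_assoc, ← mul_pow]
    congr 2
    change (n:ℝ) * ((cnt x i : ℝ) / n * (1 - (cnt x i : ℝ) / n)) = yy n (cnt x i)
    unfold yy; field_simp
  rw [eC]
  simp_rw [eF]
  have hsub : (bad p K n δ₁ δ₂)ᶜ ⊆ {x |
        (⨆ i : ℕ, |(p i).toReal - mle n x i|) ≤
          (1 / n) *
            ((1 / δ₁) * ((n : ℝ) / ((n : ℝ) - 1)) *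
              (FF K n x + Real.sqrt ((n / 2) * Real.log (1 / δ₂)) * CC K n)) ^
              ((1 : ℝ) / (2 * K : ℕ))} := by
    intro x hx
    have hx' : ∀ i, ((cnt x i : ℝ) - n * (p i).toReal) ^ (2 * K) ≤
      (n : ℝ) / (n - 1) / δ₁ * (FF K n x + √(n / 2 * log (1 / δ₂)) * CC K n) := by
      intro i
      by_contra h
      exact hx ⟨i, not_le.1 h⟩
    change (⨆ i : ℕ, |(p i).toReal - mle n x i|) ≤ _
    apply ciSup_le
    intro i
    have h := hx' i
    set A := (n : ℝ) / (n - 1) / δ₁ * (FF K n x + √(n / 2 * log (1 / δ₂)) * CC K n) with hA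
    have eA : (1 / δ₁) * ((n : ℝ) / ((n : ℝ) - 1)) *
              (FF K n x + Real.sqrt ((n / 2) * Real.log (1 / δ₂)) * CC K n) = A := by
      rw [hA]; ring
    rw [eA]
    have e1 : |(p i).toReal - mle n x i| = (1 / n) * |(cnt x i : ℝ) - n * (p i).toReal| := by
      change |(p i).toReal - (cnt x i : ℝ) / n| = _
      have : (p i).toReal - (cnt x i : ℝ) / n = - ((1 / n) * ((cnt x i : ℝ) - n * (p i).toReal)) := by
        field_simp; ring
      rw [this, abs_neg, abs_mul, abs_of_nonneg (by positivity : (0:ℝ) ≤ 1 / n)]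
    rw [e1]
    gcongr
    have e2 : |(cnt x i : ℝ) - n * (p i).toReal| ^ (2 * K) ≤ A := by
      rw [pow_mul, sq_abs, ← pow_mul]; exact h
    have hne : 2 * K ≠ 0 := by omega
    calc |(cnt x i : ℝ) - n * (p i).toReal|
        = (|(cnt x i : ℝ) - n * (p i).toReal| ^ (2 * K)) ^ ((1:ℝ) / (2 * K : ℕ)) := by
          rw [one_div, pow_rpow_inv_natCast (abs_nonneg _) hne]
      _ ≤ _ := by
          apply rpow_le_rpow (by positivity) e2 (by positivity)
  refine le_trans ?_ (measure_mono hsub)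
  rw [prob_compl_eq_one_sub MeasurableSet.of_discrete]
  have : ENNReal.ofReal (1 - δ₁ - δ₂) = 1 - ENNReal.ofReal (δ₁ + δ₂) := by
    rw [← ENNReal.ofReal_one, ← ENNReal.ofReal_sub _ (by linarith)]
    congr 1; ring
  rw [this]
  exact tsub_le_tsub_left H 1

noncomputable def Dn (n : ℕ) : ℕ → ℝ
  | 0 => 1
  | j + 1 => Dn n j * ((2 * j + 3) * n^2 / (4 * n - (2 * j + 3)))

noncomputable def dd : ℕ → ℝ
  | 0 => 1
  | j + 1 => dd j * (2 * j + 1)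

lemma dd_pos (j : ℕ) : 0 < dd j := by
  induction j with
  | zero => simp [dd]
  | succ j ih => rw [dd]; positivity

lemma Dn_pos (n : ℕ) (hn : 0 < n) (j : ℕ) (hj : j < 2 * n) : 0 < Dn n j := by
  induction j with
  | zero => simp [Dn]
  | succ j ih =>
    rw [Dn]
    have h1 : ((j:ℝ) + 2) ≤ 2 * n := by exact_mod_cast hj
    have hn' : (0:ℝ) < n := by exact_mod_cast hn
    have := ih (by omega)
    have : 0 < 4 * (n:ℝ) - (2 * j + 3) := by linarith
    positivity

lemma Dn_bound (n : ℕ) (hn : 0 < n) (j : ℕ) (hj : j < n) {q : ℝ} (h0 : 0 ≤ q) (h1 : q ≤ 1) :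
    cM q n (2 * (j + 1)) ≤ Dn n j * (n * (q * (1 - q))) := by
  induction j with
  | zero => simp [Dn, cM_two]
  | succ j ih =>
    have a := cM_unif h0 h1 n (j+1) hn
    have b := ih (by omega)
    have hj' : ((j:ℝ) + 2) ≤ n := by exact_mod_cast hj
    have hn' : (0:ℝ) < n := by exact_mod_cast hn
    have hd : 0 < 4 * (n:ℝ) - (2 * j + 3) := by linarith
    rw [show 2 * (j + 1 + 1) = 2 * (j+1) + 2 by ring, Dn]
    push_cast at a
    rw [show Dn n j * ((2 * (j:ℝ) + 3) * n^2 / (4 * n - (2 * j + 3))) * (n * (q * (1 - q)))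
      = ((2 * (j:ℝ) + 3) * n^2 * (Dn n j * (n * (q * (1 - q))))) / (4 * n - (2 * j + 3)) by ring, le_div_iff₀ hd]
    have e1 : 4 * (n:ℝ) - (2 * (j + 1) + 1) = 4 * n - (2 * j + 3) := by ring
    rw [e1] at a
    refine a.trans ?_
    have e2 : (2 * ((j:ℝ) + 1) + 1) = 2 * j + 3 := by ring
    rw [e2]
    gcongr

lemma Dn_bound' (n : ℕ) (hn : 0 < n) (l : ℕ) {q : ℝ} (h0 : 0 ≤ q) (h1 : q ≤ 1) :
    cM q n (2 * (n + l)) ≤ (n:ℝ)^(2*l) * Dn n (n-1) * (n * (q * (1 - q))) := by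
  induction l with
  | zero =>
    have := Dn_bound n hn (n-1) (by omega) h0 h1
    rw [Nat.sub_add_cancel hn] at this
    simpa using this
  | succ l ih =>
    have a := cM_triv h0 h1 n (n + l)
    rw [show 2 * (n + (l + 1)) = 2 * (n + l) + 2 by ring]
    refine a.trans ?_
    calc (n:ℝ)^2 * cM q n (2 * (n + l)) ≤ n^2 * ((n:ℝ)^(2*l) * Dn n (n-1) * (n * (q * (1 - q)))) := by gcongr
      _ = _ := by rw [show 2 * (l + 1) = 2 * l + 2 by ring, pow_add]; ring

lemma Dn_dd (n : ℕ) (hn : 0 < n) (j : ℕ) (hj : j < 2 * n) :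
    Dn n j * dd (2*n-1) = (n:ℝ)^(2*j) * dd (j+1) * dd (2*n-1-j) := by
  induction j with
  | zero => simp [Dn, dd]
  | succ j ih =>
    have h := ih (by omega)
    obtain ⟨r, hr⟩ : ∃ r, 2 * n = j + 2 + r := ⟨2*n - (j+2), by omega⟩
    have e1 : 2 * n - 1 - j = r + 1 := by omega
    have e2 : 2 * n - 1 - (j + 1) = r := by omega
    rw [e1, show dd (r+1) = dd r * (2 * r + 1) from rfl] at h
    rw [e2, Dn, show dd (j+1+1) = dd (j+1) * (2 * (j+1:ℕ) + 1) from rfl]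
    have hr' : (4:ℝ) * n - (2 * j + 3) = 2 * r + 1 := by
      have : (2:ℝ) * n = j + 2 + r := by exact_mod_cast hr
      linarith
    rw [hr']
    have hp : (0:ℝ) < 2 * r + 1 := by positivity
    field_simp
    rw [show 2 * (j + 1) = 2 * j + 2 by ring, pow_add]
    push_cast
    linear_combination (2 * (j:ℝ) + 3) * n^2 * h

lemma dd_ratio (n : ℕ) : (4:ℝ)^n * dd n ^ 2 ≤ (2 - 1 / (n + 1)) * dd (2 * n) := by
  induction n with
  | zero => norm_num [dd]
  | succ n ih =>
    rw [show 2 * (n + 1) = 2 * n + 1 + 1 by ring]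
    simp only [dd]
    push_cast
    have hp := dd_pos (2*n)
    have h2 : (4:ℝ)^(n+1) * (dd n * (2 * n + 1))^2 = (4 * (2*n+1)^2) * ((4:ℝ)^n * dd n ^ 2) := by ring
    rw [h2]
    calc (4 * (2*(n:ℝ)+1)^2) * ((4:ℝ)^n * dd n ^ 2) ≤ (4 * (2*(n:ℝ)+1)^2) * ((2 - 1 / (n + 1)) * dd (2 * n)) := by gcongr
      _ = (4 * (2*(n:ℝ)+1)^2) * (2 - 1 / (n + 1)) * dd (2 * n) := by ring
      _ ≤ ((2 - 1 / ((n:ℝ) + 1 + 1)) * ((2 * (2 * n) + 1) * (2 * (2 * n + 1) + 1))) * dd (2 * n) := by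
        refine mul_le_mul_of_nonneg_right ?_ hp.le
        refine sub_nonneg.1 ?_
        have : (2 - 1 / ((n:ℝ) + 1 + 1)) * ((2 * (2 * n) + 1) * (2 * (2 * n + 1) + 1)) - (4 * (2*(n:ℝ)+1)^2) * (2 - 1 / (n + 1))
          = (14 * (n:ℝ)^2 + 11 * n + 1) / ((n + 1) * (n + 2)) := by field_simp; ring
        rw [this]; positivity
      _ = _ := by ring

lemma Dn_top (n : ℕ) (hn : 0 < n) : Dn n (n-1) * 4^n ≤ 8 * n * (n:ℝ)^(2*(n-1)) := by
  have h := Dn_dd n hn (n-1) (by omega)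
  rw [Nat.sub_add_cancel hn, show 2 * n - 1 - (n-1) = n by omega] at h
  have r := dd_ratio n
  have hp := dd_pos (2*n-1)
  have e : dd (2*n) = dd (2*n-1) * (4 * n - 1) := by
    obtain ⟨k, rfl⟩ : ∃ k, n = k + 1 := ⟨n-1, by omega⟩
    rw [show 2 * (k+1) = 2*k+1+1 by ring, dd]; simp; ring_nf; simp
  have hn' : (1:ℝ) ≤ n := by exact_mod_cast hn
  have r2 : (4:ℝ)^n * dd n ^ 2 ≤ 2 * (dd (2*n-1) * (4 * n)) := by
    rw [e] at r
    refine r.trans ?_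
    have : (0:ℝ) < 1 / (n+1) := by positivity
    have h3 : dd (2*n-1) * (4 * n - 1) ≤ dd (2*n-1) * (4 * n) := by gcongr; linarith
    have h4 : 0 ≤ dd (2*n-1) * (4 * (n:ℝ) - 1) := mul_nonneg hp.le (by linarith)
    nlinarith
  refine le_of_mul_le_mul_right ?_ hp
  calc Dn n (n-1) * 4^n * dd (2*n-1) = (n:ℝ)^(2*(n-1)) * (4^n * dd n ^2) := by
        rw [mul_right_comm, h]; ring
    _ ≤ (n:ℝ)^(2*(n-1)) * (2 * (dd (2*n-1) * (4 * n))) := by gcongr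
    _ = _ := by ring

lemma CC_ge (K n k : ℕ) (h1 : 1 ≤ k) (h2 : k ≤ K) :
    (k : ℝ)^(2 * K - k) * (n / 4 : ℝ)^k * (4 * k / n + 96 * k^3 / n^3) ≤ CC K n :=
  Finset.single_le_sum (f := fun k : ℕ => (k : ℝ)^(2 * K - k) * (n / 4 : ℝ)^k * (4 * k / n + 96 * k^3 / n^3))
    (fun _ _ => by positivity) (Finset.mem_Icc.2 ⟨h1, h2⟩)

/-- case `K ≥ n` -/
lemma E_big (p : PMF ℕ) (K n : ℕ) (hn : 2 ≤ n) (hK : n ≤ K) (δ₁ δ₂ : ℝ) (h1 : 0 < δ₁) (h2 : 0 < δ₂)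
    (hs : δ₁ + δ₂ < 1) :
    sampleMeasure p n (bad p K n δ₁ δ₂) ≤ ENNReal.ofReal (δ₁ + δ₂) := by
  obtain ⟨l, rfl⟩ := Nat.exists_eq_add_of_le hK
  have hDp := Dn_pos n (by omega) (n-1) (by omega)
  have hn' : (2:ℝ) ≤ n := by exact_mod_cast hn
  refine E_core p (n+l) n (by omega) hn δ₁ δ₂ h1 h2 hs ((n:ℝ)^(2*l) * Dn n (n-1)) (by positivity)
    (fun q a b => Dn_bound' n (by omega) l a b) ?_
  have hT : 1 ≤ (n:ℝ) / (n - 1) := by rw [le_div_iff₀ (by linarith)]; linarith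
  have hs : 1 ≤ √((n:ℝ) / 2) := by rw [one_le_sqrt]; linarith
  have hC := CC_ge (n+l) n n (by omega) (by omega)
  have e1 : 4 * (n:ℝ) / n + 96 * n^3 / n^3 = 100 := by field_simp; norm_num
  rw [e1] at hC
  have hD := Dn_top n (by omega)
  have e3 : (n:ℝ)^(2 * (n + l) - n) * (n / 4)^n * 100 = 100 * (n:ℝ)^(2*l) * ((n:ℝ)^(2*(n-1)) * n^2) / 4^n := by
    rw [← pow_add, show 2 * (n-1) + 2 = 2 * n by omega, div_pow,
      show 2 * (n + l) - n = n + 2 * l by omega, pow_add, two_mul n, pow_add]; ring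
  calc (n:ℝ)^(2*l) * Dn n (n-1) * n = (n:ℝ)^(2*l) * (Dn n (n-1) * 4^n) * n / 4^n := by field_simp
    _ ≤ (n:ℝ)^(2*l) * (8 * n * (n:ℝ)^(2*(n-1))) * n / 4^n := by gcongr
    _ = 8 * (n:ℝ)^(2*l) * ((n:ℝ)^(2*(n-1)) * n^2) / 4^n := by ring
    _ ≤ 100 * (n:ℝ)^(2*l) * ((n:ℝ)^(2*(n-1)) * n^2) / 4^n := by gcongr; norm_num
    _ ≤ CC (n+l) n := by rw [← e3]; exact hC
    _ ≤ 1 * (1.5 * (1 * CC (n+l) n)) := by have := CC_nonneg (n+l) n; linarith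
    _ ≤ _ := by have := CC_nonneg (n+l) n; gcongr

noncomputable def rho (n K : ℕ) : ℝ :=
  (2 * K + 1) / (K + 1) * (4 * n / (4 * n - (2 * K + 1))) * ((K:ℝ) / (K + 1))^(K+1)

noncomputable def Gs (n : ℕ) : ℕ → ℝ
  | 0 => 1
  | j + 1 => Gs n j * rho n (j + 1)

lemma Gs_Dn (n : ℕ) (hn : 0 < n) (j : ℕ) :
    Dn n j = Gs n j * ((j + 1 : ℕ):ℝ)^(j+2) * (n / 4 : ℝ)^j := by
  have hn' : (0:ℝ) < n := by exact_mod_cast hn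
  induction j with
  | zero => simp [Dn, Gs]
  | succ j ih =>
    rw [Dn, Gs, ih, rho]
    push_cast
    simp only [div_pow]
    have : (4 * (n:ℝ) - (2 * (j + 1) + 1)) = 4 * n - (2 * j + 3) := by ring
    rw [this, show j + 1 + 1 = j + 2 by ring, show j + 1 + 2 = j + 2 + 1 by ring, pow_succ _ (j+2), pow_succ _ j,
      pow_succ _ j]
    rw [show (j:ℝ) + 1 + 1 = j + 2 by ring]
    generalize 4 * (n:ℝ) - (2 * j + 3) = d
    rw [show 2 * ((j:ℝ) + 1) + 1 = 2 * j + 3 by ring]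
    have h2 : ((j:ℝ) + 2)^(j+2) ≠ 0 := by positivity
    generalize ((j:ℝ) + 2)^(j+2) = A at *
    generalize ((j:ℝ) + 1)^(j+2) = B at *
    field_simp

lemma rho_pos (n K : ℕ) (hK : 1 ≤ K) (h : K < 2 * n) : 0 < rho n K := by
  have : (K:ℝ) + 1 ≤ 2 * n := by exact_mod_cast h
  have hK' : (1:ℝ) ≤ K := by exact_mod_cast hK
  unfold rho
  have : 0 < 4 * (n:ℝ) - (2 * K + 1) := by linarith
  have : 0 < (n:ℝ) := by linarith
  positivity

lemma kpow_mono (K : ℕ) : ((K:ℝ) / (K + 1))^(K+1) ≤ (((K:ℝ) + 1) / (K + 2))^(K+2) := by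
  rcases Nat.eq_zero_or_pos K with rfl | hK
  · simp
  have hK' : (1:ℝ) ≤ K := by exact_mod_cast hK
  have b := one_add_mul_le_pow (a := 1 / ((K:ℝ) * (K + 2))) (by
    have : (0:ℝ) ≤ 1 / ((K:ℝ) * (K + 2)) := by positivity
    linarith) (K+1)
  have e1 : ((K:ℝ) + 1) / (K + 2) = (K / (K + 1)) * (1 + 1 / ((K:ℝ) * (K + 2))) := by
    field_simp; ring
  rw [pow_succ _ (K+1), show (((K:ℝ) + 1) / (K + 2))^(K+1)
    = (K / (K + 1))^(K+1) * (1 + 1 / ((K:ℝ) * (K + 2)))^(K+1) by rw [← mul_pow, ← e1]]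
  have h2 : 1 ≤ (1 + ((K + 1 : ℕ):ℝ) * (1 / ((K:ℝ) * (K + 2)))) * (((K:ℝ) + 1) / (K + 2)) := by
    rw [← sub_nonneg]
    have : (1 + ((K + 1 : ℕ):ℝ) * (1 / ((K:ℝ) * (K + 2)))) * (((K:ℝ) + 1) / (K + 2)) - 1 = 1 / (K * (K+2)^2) := by
      push_cast; field_simp; ring
    rw [this]; positivity
  calc ((K:ℝ) / (K + 1))^(K+1) = ((K:ℝ) / (K + 1))^(K+1) * 1 := by ring
    _ ≤ ((K:ℝ) / (K + 1))^(K+1) * ((1 + ((K + 1 : ℕ):ℝ) * (1 / ((K:ℝ) * (K + 2)))) * (((K:ℝ) + 1) / (K + 2))) := by gcongr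
    _ ≤ ((K:ℝ) / (K + 1))^(K+1) * ((1 + 1 / ((K:ℝ) * (K + 2)))^(K+1) * (((K:ℝ) + 1) / (K + 2))) := by gcongr
    _ = _ := by ring

lemma rho_mono (n K : ℕ) (h : K + 1 < 2 * n) : rho n K ≤ rho n (K+1) := by
  unfold rho
  have h' : (K:ℝ) + 2 ≤ 2 * n := by exact_mod_cast h
  have hd : 0 < 4 * (n:ℝ) - (2 * ((K + 1 : ℕ):ℝ) + 1) := by push_cast; linarith
  have k := kpow_mono K
  have k2 : (((K + 1 : ℕ):ℝ) / ((K + 1 : ℕ) + 1))^(K+1+1) = (((K:ℝ) + 1) / (K + 2))^(K+2) := by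
    push_cast; ring_nf
  rw [k2]
  have k3 : (2 * (K:ℝ) + 1) / (K + 1) ≤ (2 * ((K + 1 : ℕ):ℝ) + 1) / ((K + 1 : ℕ) + 1) := by
    push_cast
    rw [div_le_div_iff₀ (by positivity) (by positivity)]; nlinarith
  have k4 : (4 * (n:ℝ) / (4 * n - (2 * K + 1))) ≤ 4 * n / (4 * n - (2 * ((K + 1 : ℕ):ℝ) + 1)) := by
    gcongr; simp
  have hd2 : 0 < 4 * (n:ℝ) - (2 * (K:ℝ) + 1) := by linarith
  gcongr

lemma Gs_pos (n : ℕ) (j : ℕ) (h : j < 2 * n) : 0 < Gs n j := by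
  induction j with
  | zero => simp [Gs]
  | succ j ih => rw [Gs]; exact mul_pos (ih (by omega)) (rho_pos n (j+1) (by omega) h)

lemma rho_mono' (n a b : ℕ) (h : a ≤ b) (hb : b < 2 * n) : rho n a ≤ rho n b := by
  induction b, h using Nat.le_induction with
  | base => exact le_rfl
  | succ b hab ih => exact (ih (by omega)).trans (rho_mono n b hb)

lemma Gs_up (n a b : ℕ) (h : a ≤ b) (hb : b < 2 * n) (hr : 1 ≤ rho n (a+1)) : Gs n a ≤ Gs n b := by
  induction b, h using Nat.le_induction with
  | base => exact le_rfl
  | succ b hab ih =>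
    have := ih (by omega)
    refine this.trans ?_
    rw [Gs]
    have h1 := Gs_pos n b (by omega)
    have h2 := rho_mono' n (a+1) (b+1) (by omega) hb
    nlinarith

lemma Gs_down (n a b : ℕ) (h : a ≤ b) (hb : b < 2 * n) (hr : rho n (b+1) ≤ 1) (hb' : b + 1 < 2 * n) :
    Gs n b ≤ Gs n a := by
  induction b, h using Nat.le_induction with
  | base => exact le_rfl
  | succ b hab ih =>
    have hr' : rho n (b+1) ≤ 1 := (rho_mono n (b+1) (by omega)).trans hr
    have := ih (by omega) hr' (by omega)
    refine le_trans ?_ this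
    rw [Gs]
    have h1 := Gs_pos n b (by omega)
    nlinarith

lemma Gs_max (n a b K : ℕ) (h : a ≤ K) (hK : K ≤ b) (hb : b + 1 < 2 * n) :
    Gs n K ≤ max (Gs n a) (Gs n b) := by
  rcases le_total (rho n (K+1)) 1 with hr | hr
  · exact le_max_of_le_left (Gs_down n a K h (by omega) hr (by omega))
  · exact le_max_of_le_right (Gs_up n K b hK (by omega) hr)

lemma Gs_top (n : ℕ) (hn : 0 < n) : Gs n (n-1) ≤ 2 / n := by
  have h := Dn_top n hn
  have hn' : (0:ℝ) < n := by exact_mod_cast hn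
  rw [Gs_Dn n hn, Nat.sub_add_cancel hn] at h
  rw [le_div_iff₀ hn']
  have e : Gs n (n-1) * (n:ℝ)^(n-1+2) * (n/4:ℝ)^(n-1) * 4^n = (Gs n (n-1) * n) * (4 * n * (n:ℝ)^(2*(n-1))) := by
    obtain ⟨k, rfl⟩ : ∃ k, n = k + 1 := ⟨n-1, by omega⟩
    rw [show k + 1 - 1 = k by omega, div_pow]
    field_simp
    ring
  rw [e] at h
  have hp : 0 < 4 * n * (n:ℝ)^(2*(n-1)) := by positivity
  refine le_of_mul_le_mul_right ?_ hp
  linarith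

/-- reduction of the E-case to `Gs` -/
lemma E_mid (p : PMF ℕ) (j n : ℕ) (hn : 2 ≤ n) (hK : j < n) (δ₁ δ₂ : ℝ) (h1 : 0 < δ₁) (h2 : 0 < δ₂)
    (hs : δ₁ + δ₂ < 1)
    (hG : 2 * n * Gs n j ^ 2 ≤ (1.5 * (n / (n - 1)) * (1 + 24 * ((j:ℝ)+1)^2 / n^2))^2) :
    sampleMeasure p n (bad p (j+1) n δ₁ δ₂) ≤ ENNReal.ofReal (δ₁ + δ₂) := by
  have hDp := Dn_pos n (by omega) j (by omega)
  have hn' : (2:ℝ) ≤ n := by exact_mod_cast hn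
  refine E_core p (j+1) n (by omega) hn δ₁ δ₂ h1 h2 hs (Dn n j) hDp.le
    (fun q a b => Dn_bound n (by omega) j hK a b) ?_
  have hT : 0 < (n:ℝ) / (n - 1) := div_pos (by linarith) (by linarith)
  have hGp := Gs_pos n j (by omega)
  set t := √((n:ℝ) / 2) with ht
  have ht0 : 0 < t := sqrt_pos.2 (by linarith)
  have ht2 : t ^ 2 = n / 2 := sq_sqrt (by linarith)
  have h3 : 2 * t * Gs n j ≤ 1.5 * (n / (n - 1)) * (1 + 24 * ((j:ℝ)+1)^2 / n^2) := by
    refine le_of_sq_le_sq ?_ (by positivity)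
    rw [mul_pow, mul_pow, ht2]
    refine le_trans (le_of_eq ?_) hG
    ring
  have hC := CC_ge (j+1) n (j+1) (by omega) le_rfl
  have e1 : (((j+1:ℕ):ℝ))^(2 * (j+1) - (j+1)) * (n / 4 : ℝ)^(j+1) * (4 * (j+1:ℕ) / n + 96 * (j+1:ℕ)^3 / n^3)
      = ((j + 1 : ℕ):ℝ)^(j+2) * (n / 4 : ℝ)^j * (1 + 24 * ((j:ℝ)+1)^2 / n^2) := by
    rw [show 2 * (j+1) - (j+1) = j + 1 by omega]
    push_cast
    field_simp
    ring
  rw [e1] at hC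
  calc Dn n j * n = (((j + 1 : ℕ):ℝ)^(j+2) * (n / 4 : ℝ)^j) * t * (2 * t * Gs n j) := by
        rw [Gs_Dn n (by omega)]
        have : (n:ℝ) = 2 * t^2 := by rw [ht2]; ring
        linear_combination (Gs n j * (((j + 1 : ℕ):ℝ)^(j+2) * (n / 4 : ℝ)^j)) * this
    _ ≤ (((j + 1 : ℕ):ℝ)^(j+2) * (n / 4 : ℝ)^j) * t * (1.5 * (n / (n - 1)) * (1 + 24 * ((j:ℝ)+1)^2 / n^2)) := by gcongr
    _ = n / (n - 1) * (1.5 * (t * (((j + 1 : ℕ):ℝ)^(j+2) * (n / 4 : ℝ)^j * (1 + 24 * ((j:ℝ)+1)^2 / n^2)))) := by ring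
    _ ≤ _ := by gcongr

lemma Gs_anti (n₀ n : ℕ) (h : n₀ ≤ n) (j : ℕ) (hj : j < 2 * n₀) : Gs n j ≤ Gs n₀ j := by
  induction j with
  | zero => simp [Gs]
  | succ j ih =>
    rw [Gs, Gs]
    have h1 := Gs_pos n₀ j (by omega)
    have h2 := rho_pos n (j+1) (by omega) (by omega)
    refine mul_le_mul (ih (by omega)) ?_ h2.le h1.le
    unfold rho
    have hj' : (j:ℝ) + 2 ≤ 2 * n₀ := by exact_mod_cast hj
    have hn : (n₀:ℝ) ≤ n := by exact_mod_cast h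
    have d1 : 0 < 4 * (n₀:ℝ) - (2 * ((j + 1 : ℕ):ℝ) + 1) := by push_cast; linarith
    have d2 : 0 < 4 * (n:ℝ) - (2 * ((j + 1 : ℕ):ℝ) + 1) := by linarith
    have : 4 * (n:ℝ) / (4 * n - (2 * ((j + 1 : ℕ):ℝ) + 1)) ≤ 4 * n₀ / (4 * n₀ - (2 * ((j + 1 : ℕ):ℝ) + 1)) := by
      rw [div_le_div_iff₀ d2 d1]
      have : (0:ℝ) ≤ ((j+1:ℕ):ℝ) := by positivity
      nlinarith
    gcongr

lemma hG_of (n j : ℕ) (hn : 2 ≤ n) (h : 2 * (n:ℝ) * Gs n j ^ 2 ≤ 2.25 * (n / (n-1))^2) :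
    2 * n * Gs n j ^ 2 ≤ (1.5 * (n / (n - 1)) * (1 + 24 * ((j:ℝ)+1)^2 / n^2))^2 := by
  have hn' : (2:ℝ) ≤ n := by exact_mod_cast hn
  have hT : 0 < (n:ℝ) / (n - 1) := div_pos (by linarith) (by linarith)
  refine h.trans ?_
  rw [show 2.25 * ((n:ℝ) / (n-1))^2 = (1.5 * (n / (n-1)) * 1)^2 by ring]
  gcongr
  have : 0 ≤ 24 * ((j:ℝ)+1)^2 / n^2 := by positivity
  linarith

lemma T_ge (n : ℕ) (hn : 2 ≤ n) : 1 ≤ ((n:ℝ) / (n-1))^2 := by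
  have hn' : (2:ℝ) ≤ n := by exact_mod_cast hn
  apply one_le_pow₀
  rw [le_div_iff₀ (by linarith)]; linarith

lemma hG_of' (n j : ℕ) (hn : 2 ≤ n) (h : 2 * (n:ℝ) * Gs n j ^ 2 ≤ 2.25) :
    2 * n * Gs n j ^ 2 ≤ (1.5 * (n / (n - 1)) * (1 + 24 * ((j:ℝ)+1)^2 / n^2))^2 := by
  apply hG_of n j hn
  have := T_ge n hn
  linarith

lemma hG_range (n₀ n₁ n j : ℕ) (h0 : n₀ ≤ n) (h1 : n ≤ n₁) (hj : j < 2 * n₀) (g : ℝ) (hg : Gs n₀ j ≤ g)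
    (h : 2 * (n₁:ℝ) * g ^ 2 ≤ 2.25) : 2 * (n:ℝ) * Gs n j ^ 2 ≤ 2.25 := by
  have a := (Gs_anti n₀ n h0 j hj).trans hg
  have b := Gs_pos n j (by omega)
  have c : (n:ℝ) ≤ n₁ := by exact_mod_cast h1
  refine le_trans ?_ h
  gcongr

lemma hG_top (n : ℕ) (hn : 2 ≤ n) : 2 * (n:ℝ) * Gs n (n-1) ^ 2 ≤ 2.25 * (n / (n-1))^2 := by
  have hn' : (2:ℝ) ≤ n := by exact_mod_cast hn
  have a := Gs_top n (by omega)
  have b := Gs_pos n (n-1) (by omega)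
  calc 2 * (n:ℝ) * Gs n (n-1) ^ 2 ≤ 2 * (n:ℝ) * (2 / n)^2 := by gcongr
    _ = 8 / (n:ℝ) := by field_simp; norm_num
    _ ≤ _ := by
      rcases Nat.lt_or_ge n 4 with h | h
      · clear a b
        interval_cases n <;> norm_num
      · have h4 : (4:ℝ) ≤ n := by exact_mod_cast h
        have := T_ge n hn
        have : 8 / (n:ℝ) ≤ 2 := by rw [div_le_iff₀ (by linarith)]; linarith
        linarith

lemma hG_conv (n a j : ℕ) (hn : 2 ≤ n) (haj : a ≤ j) (hj : j < n) (h : 2 * (n:ℝ) * Gs n a ^ 2 ≤ 2.25) :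
    2 * n * Gs n j ^ 2 ≤ (1.5 * (n / (n - 1)) * (1 + 24 * ((j:ℝ)+1)^2 / n^2))^2 := by
  apply hG_of n j hn
  have b := Gs_pos n j (by omega)
  have t := T_ge n hn
  rcases le_max_iff.1 (Gs_max n a (n-1) j haj (by omega) (by omega)) with m | m
  · calc 2 * (n:ℝ) * Gs n j ^ 2 ≤ 2 * (n:ℝ) * Gs n a ^ 2 := by gcongr
      _ ≤ _ := by linarith
  · calc 2 * (n:ℝ) * Gs n j ^ 2 ≤ 2 * (n:ℝ) * Gs n (n-1) ^ 2 := by gcongr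
      _ ≤ _ := hG_top n hn

lemma G2 (n : ℕ) (h2 : 2 < n) (h : n < 4) :
    2 * n * Gs n 1 ^ 2 ≤ (1.5 * (n / (n - 1)) * (1 + 24 * (((1:ℕ):ℝ)+1)^2 / n^2))^2 := by
  interval_cases n; norm_num [Gs, rho]

lemma G3 (n : ℕ) (h2 : 3 < n) (h : n < 31) :
    2 * n * Gs n 2 ^ 2 ≤ (1.5 * (n / (n - 1)) * (1 + 24 * (((2:ℕ):ℝ)+1)^2 / n^2))^2 := by
  interval_cases n <;> norm_num [Gs, rho]

lemma G4 (n : ℕ) (h2 : 4 < n) (h : n < 60) :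
    2 * n * Gs n 3 ^ 2 ≤ (1.5 * (n / (n - 1)) * (1 + 24 * (((3:ℕ):ℝ)+1)^2 / n^2))^2 := by
  rcases Nat.lt_or_ge n 15 with h' | h'
  · interval_cases n <;> norm_num [Gs, rho]
  · apply hG_of' n 3 (by omega)
    rcases Nat.lt_or_ge n 30 with h'' | h''
    · exact hG_range 15 30 n 3 h' h''.le (by norm_num) _ le_rfl (by norm_num [Gs, rho])
    · exact hG_range 30 60 n 3 h'' h.le (by norm_num) _ le_rfl (by norm_num [Gs, rho])

lemma G5 (n : ℕ) (h2 : 12 ≤ n) (h : n ≤ 275) : 2 * (n:ℝ) * Gs n 4 ^ 2 ≤ 2.25 := by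
  rcases Nat.lt_or_ge n 25 with h' | h'
  · exact hG_range 12 25 n 4 h2 h'.le (by norm_num) _ le_rfl (by norm_num [Gs, rho])
  rcases Nat.lt_or_ge n 150 with h'' | h''
  · exact hG_range 25 150 n 4 h' h''.le (by norm_num) _ le_rfl (by norm_num [Gs, rho])
  · exact hG_range 150 275 n 4 h'' h (by norm_num) _ le_rfl (by norm_num [Gs, rho])

lemma G5s (n j : ℕ) (hj : 4 ≤ j) (hjn : j < n) (h : n < 12) :
    2 * n * Gs n j ^ 2 ≤ (1.5 * (n / (n - 1)) * (1 + 24 * ((j:ℝ)+1)^2 / n^2))^2 := by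
  have hn : 2 ≤ n := by omega
  have hn' : (2:ℝ) ≤ n := by exact_mod_cast hn
  have b := Gs_pos n j (by omega)
  rcases le_max_iff.1 (Gs_max n 4 (n-1) j hj (by omega) (by omega)) with m | m
  · calc 2 * (n:ℝ) * Gs n j ^ 2 ≤ 2 * (n:ℝ) * Gs n 4 ^ 2 := by gcongr
      _ ≤ (1.5 * (n / (n - 1)) * (1 + 24 * ((4:ℝ)+1)^2 / n^2))^2 := by
        have : 5 ≤ n := by omega
        clear b m
        interval_cases n <;> norm_num [Gs, rho]
      _ ≤ _ := by
        have : (4:ℝ) ≤ j := by exact_mod_cast hj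
        have hT : 0 < (n:ℝ) / (n - 1) := div_pos (by linarith) (by linarith)
        gcongr
  · apply hG_of n j hn
    calc 2 * (n:ℝ) * Gs n j ^ 2 ≤ 2 * (n:ℝ) * Gs n (n-1) ^ 2 := by gcongr
      _ ≤ _ := hG_top n hn

lemma rho_small (n K : ℕ) (hK : 5 ≤ K) (h : 55 * K ≤ n) : ((K:ℝ) + 1) * rho n K ^ 2 ≤ K := by
  have hK' : (5:ℝ) ≤ K := by exact_mod_cast hK
  have h' : 55 * (K:ℝ) ≤ n := by exact_mod_cast h
  have e1 : ((K:ℝ) / (K + 1))^(K+1) ≤ 0.37 := by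
    have a : (K:ℝ) / (K + 1) ≤ exp (-(1 / (K + 1))) := by
      have := add_one_le_exp (-(1 / ((K:ℝ) + 1)))
      refine le_trans (le_of_eq ?_) this
      field_simp; ring
    calc ((K:ℝ) / (K + 1))^(K+1) ≤ (exp (-(1 / ((K:ℝ) + 1))))^(K+1) := by gcongr
      _ = exp (-1) := by
        rw [← exp_nat_mul]; congr 1; push_cast; field_simp
      _ ≤ 0.37 := by
        have he := Real.exp_one_gt_d9
        rw [exp_neg, ← one_div, div_le_iff₀ (by positivity)]; linarith
  have e2 : 4 * (n:ℝ) / (4 * n - (2 * K + 1)) ≤ 1.02 := by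
    rw [div_le_iff₀ (by linarith)]; linarith
  have e0 : 0 ≤ 4 * (n:ℝ) / (4 * n - (2 * K + 1)) := div_nonneg (by linarith) (by linarith)
  have e3 : (2 * (K:ℝ) + 1) / (K + 1) ≤ 2 := by
    rw [div_le_iff₀ (by linarith)]; linarith
  have hr : rho n K ≤ 0.76 := by
    unfold rho
    calc _ ≤ 2 * 1.02 * (0.37:ℝ) := by gcongr
      _ ≤ _ := by norm_num
  have hr0 := rho_pos n K (by omega) (by omega)
  have hr2 : rho n K ^ 2 ≤ 0.76 ^ 2 := by gcongr
  nlinarith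

lemma Gs_dec (n b : ℕ) (hb : 4 ≤ b) (h : 55 * b ≤ n) : ((b:ℝ) + 1) * Gs n b ^ 2 ≤ 5 * Gs n 4 ^ 2 := by
  induction b, hb using Nat.le_induction with
  | base => norm_num
  | succ b hb ih =>
    have i := ih (by omega)
    refine le_trans ?_ i
    rw [Gs, mul_pow]
    have r := rho_small n (b+1) (by omega) h
    push_cast at r ⊢
    have : 0 ≤ Gs n b ^ 2 := sq_nonneg _
    nlinarith

lemma G5all (n j : ℕ) (hj : 4 ≤ j) (hjn : j < n) (h : n < 55 * (j + 1)) :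
    2 * n * Gs n j ^ 2 ≤ (1.5 * (n / (n - 1)) * (1 + 24 * ((j:ℝ)+1)^2 / n^2))^2 := by
  rcases Nat.lt_or_ge n 12 with h1 | h1
  · exact G5s n j hj hjn h1
  rcases Nat.lt_or_ge 275 n with h2 | h2
  swap
  · exact hG_conv n 4 j (by omega) hj hjn (G5 n h1 h2)
  · have hb : 4 ≤ n / 55 := by omega
    refine hG_conv n (n/55) j (by omega) (by omega) hjn ?_
    have a := Gs_dec n (n/55) hb (by omega)
    have b : (n:ℝ) ≤ 55 * (((n/55 : ℕ):ℝ) + 1) := by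
      have : n ≤ 55 * (n/55 + 1) := by omega
      exact_mod_cast this
    have c := Gs_anti 275 n h2.le 4 (by norm_num)
    have d := Gs_pos n 4 (by omega)
    have e : Gs n 4 ^ 2 ≤ Gs 275 4 ^ 2 := by gcongr
    have f : Gs 275 4 ^ 2 ≤ 0.004 := by norm_num [Gs, rho]
    have : 0 ≤ Gs n (n/55) ^ 2 := sq_nonneg _
    nlinarith

/-- E-case summary -/
lemma E_all (p : PMF ℕ) (K n : ℕ) (hn : 2 ≤ n) (δ₁ δ₂ : ℝ) (h1 : 0 < δ₁) (h2 : 0 < δ₂)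
    (hs : δ₁ + δ₂ < 1)
    (h : n ≤ K ∨ (K = 2 ∧ n < 4) ∨ (K = 3 ∧ n < 31) ∨ (K = 4 ∧ n < 60) ∨ (5 ≤ K ∧ n < 55 * K)) :
    sampleMeasure p n (bad p K n δ₁ δ₂) ≤ ENNReal.ofReal (δ₁ + δ₂) := by
  by_cases hK : n ≤ K
  · exact E_big p K n hn hK δ₁ δ₂ h1 h2 hs
  rcases h with h | ⟨rfl, h⟩ | ⟨rfl, h⟩ | ⟨rfl, h⟩ | ⟨h5, h⟩
  · exact absurd h hK
  · exact E_mid p 1 n hn (by omega) δ₁ δ₂ h1 h2 hs (G2 n (by omega) h)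
  · exact E_mid p 2 n hn (by omega) δ₁ δ₂ h1 h2 hs (G3 n (by omega) h)
  · exact E_mid p 3 n hn (by omega) δ₁ δ₂ h1 h2 hs (G4 n (by omega) h)
  · obtain ⟨j, rfl⟩ : ∃ j, K = j + 1 := ⟨K-1, by omega⟩
    exact E_mid p j n hn (by omega) δ₁ δ₂ h1 h2 hs (G5all n j (by omega) (by omega) h)

lemma tcub (t : ℝ) (h : 0 ≤ t) : t * (1 - t^2) ≤ 0.385 := by
  nlinarith [mul_nonneg (sq_nonneg (t - 0.577)) (by linarith : 0 ≤ t + 1.154)]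

lemma vbound (v e : ℝ) (he : 0 ≤ e) (hv : |v| ≤ 1) : (|v| + e) * (1 - v^2) ≤ 0.385 + e := by
  have h := tcub |v| (abs_nonneg v)
  rw [sq_abs] at h
  nlinarith [sq_nonneg v]

lemma yy_le (n b : ℕ) (hn : 0 < n) : yy n b ≤ n / 4 := by
  have hn' : (0:ℝ) < n := by exact_mod_cast hn
  unfold yy
  rw [div_le_iff₀ hn']
  nlinarith [sq_nonneg ((n:ℝ) - 2 * b)]

lemma yy_sub (n b : ℕ) (hn : 0 < n) : yy n (b+1) - yy n b = 1 - 2 * b / n - 1 / n := by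
  have hn' : (0:ℝ) < n := by exact_mod_cast hn
  unfold yy
  push_cast
  field_simp; ring

lemma yy_v (n b : ℕ) (hn : 0 < n) : yy n b = n / 4 * (1 - (1 - 2 * b / n)^2) := by
  have hn' : (0:ℝ) < n := by exact_mod_cast hn
  unfold yy
  field_simp; ring

lemma v_le (n b : ℕ) (hn : 0 < n) (hb : b ≤ n) : |1 - 2 * (b:ℝ) / n| ≤ 1 := by
  have hn' : (0:ℝ) < n := by exact_mod_cast hn
  have hb' : (b:ℝ) ≤ n := by exact_mod_cast hb
  have h1 : 2 * (b:ℝ) / n ≤ 2 := by rw [div_le_iff₀ hn']; linarith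
  have h2 : 0 ≤ 2 * (b:ℝ) / n := by positivity
  rw [abs_le]; constructor <;> linarith

lemma yy_max (n b : ℕ) (hb : b < n) :
    |yy n (b+1) - yy n b| * max (yy n (b+1)) (yy n b) ≤ n / 4 * (0.385 + 1 / n) := by
  have hn : 0 < n := by omega
  have hn' : (0:ℝ) < n := by exact_mod_cast hn
  rw [yy_sub n b hn]
  have e0 : (0:ℝ) ≤ 1 / n := by positivity
  rcases max_choice (yy n (b+1)) (yy n b) with h | h <;> rw [h]
  · rw [yy_v n (b+1) hn]
    have hv := v_le n (b+1) hn hb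
    have k := vbound _ _ e0 hv
    have a : |1 - 2 * (b:ℝ) / n - 1 / n| ≤ |1 - 2 * ((b+1:ℕ):ℝ) / n| + 1 / n := by
      have : 1 - 2 * (b:ℝ) / n - 1 / n = (1 - 2 * ((b+1:ℕ):ℝ) / n) + 1 / n := by
        push_cast; field_simp; ring
      rw [this]; refine (abs_add_le _ _).trans ?_; rw [abs_of_nonneg e0]
    have c : 0 ≤ 1 - (1 - 2 * ((b+1:ℕ):ℝ) / n)^2 := by
      have := (sq_le_one_iff_abs_le_one _).2 hv; linarith
    calc _ = n / 4 * (|1 - 2 * (b:ℝ) / n - 1 / n| * (1 - (1 - 2 * ((b+1:ℕ):ℝ) / n)^2)) := by ring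
      _ ≤ n / 4 * ((|1 - 2 * ((b+1:ℕ):ℝ) / n| + 1 / n) * (1 - (1 - 2 * ((b+1:ℕ):ℝ) / n)^2)) := by gcongr
      _ ≤ _ := by gcongr
  · rw [yy_v n b hn]
    have hv := v_le n b hn hb.le
    have k := vbound _ _ e0 hv
    have a : |1 - 2 * (b:ℝ) / n - 1 / n| ≤ |1 - 2 * (b:ℝ) / n| + 1 / n := by
      refine (abs_sub _ _).trans ?_; rw [abs_of_nonneg e0]
    have c : 0 ≤ 1 - (1 - 2 * (b:ℝ) / n)^2 := by
      have := (sq_le_one_iff_abs_le_one _).2 hv; linarith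
    calc _ = n / 4 * (|1 - 2 * (b:ℝ) / n - 1 / n| * (1 - (1 - 2 * (b:ℝ) / n)^2)) := by ring
      _ ≤ n / 4 * ((|1 - 2 * (b:ℝ) / n| + 1 / n) * (1 - (1 - 2 * (b:ℝ) / n)^2)) := by gcongr
      _ ≤ _ := by gcongr

lemma yy_pow_diff (n b k : ℕ) (hb : b < n) (hk : 2 ≤ k) :
    |yy n (b+1)^k - yy n b^k| ≤ k * (n / 4 : ℝ)^(k-1) * (0.385 + 1 / n) := by
  have hn : 0 < n := by omega
  have a := abs_pow_sub_pow_le (yy n (b+1)) (yy n b) k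
  have y1 := yy_nonneg (n := n) (b := b+1) hb
  have y0 := yy_nonneg (n := n) (b := b) hb.le
  rw [abs_of_nonneg y1, abs_of_nonneg y0] at a
  have m := yy_max n b hb
  set M := max (yy n (b+1)) (yy n b) with hM
  have hM0 : 0 ≤ M := le_max_of_le_left y1
  have hM1 : M ≤ n / 4 := max_le (yy_le n _ hn) (yy_le n _ hn)
  refine a.trans ?_
  obtain ⟨l, rfl⟩ : ∃ l, k = l + 2 := ⟨k-2, by omega⟩
  rw [show l + 2 - 1 = l + 1 by omega, pow_succ, pow_succ]
  calc _ = ((l+2:ℕ):ℝ) * M^l * (|yy n (b+1) - yy n b| * M) := by ring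
    _ ≤ ((l+2:ℕ):ℝ) * (n/4:ℝ)^l * (n / 4 * (0.385 + 1 / n)) := by gcongr
    _ = _ := by ring

lemma yy_diff_one (n b : ℕ) (hb : b < n) : |yy n (b+1) - yy n b| ≤ 1 := by
  have hn : 0 < n := by omega
  have hn' : (0:ℝ) < n := by exact_mod_cast hn
  have hb' : (b:ℝ) + 1 ≤ n := by exact_mod_cast hb
  rw [yy_sub n b hn]
  have : 1 - 2 * (b:ℝ) / n - 1 / n = (n - 2 * b - 1) / n := by field_simp
  rw [this, abs_div, abs_of_pos hn', div_le_one hn', abs_le]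
  have : (0:ℝ) ≤ b := by positivity
  constructor <;> linarith

noncomputable def SS (K n : ℕ) : ℝ := ∑ k ∈ Finset.Ioc 1 K, (k:ℝ)^(2 * K - k) * (k * (n / 4 : ℝ)^(k-1))

lemma hh_diff (K n b : ℕ) (hK : 1 ≤ K) (hb : b < n) :
    |hh K n (b+1) - hh K n b| ≤ (2 * (1 + (0.385 + 1 / n) * SS K n)) / 2 := by
  unfold hh SS
  rw [← Finset.add_sum_Ioc_eq_sum_Icc hK, ← Finset.add_sum_Ioc_eq_sum_Icc hK]
  have e : ∀ A B C D : ℝ, |(A + B) - (C + D)| ≤ |A - C| + |B - D| := by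
    intro A B C D
    have := abs_add_le (A - C) (B - D)
    rwa [show A - C + (B - D) = A + B - (C + D) by ring] at this
  refine (e _ _ _ _).trans ?_
  have h1 := yy_diff_one n b hb
  rw [← Finset.sum_sub_distrib]
  have h2 : |∑ k ∈ Finset.Ioc 1 K, ((k:ℝ)^(2*K-k) * yy n (b+1)^k - (k:ℝ)^(2*K-k) * yy n b^k)|
      ≤ (0.385 + 1 / n) * ∑ k ∈ Finset.Ioc 1 K, (k:ℝ)^(2 * K - k) * (k * (n / 4 : ℝ)^(k-1)) := by
    refine (Finset.abs_sum_le_sum_abs _ _).trans ?_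
    rw [Finset.mul_sum]
    refine Finset.sum_le_sum fun k hk => ?_
    rw [← mul_sub, abs_mul, abs_of_nonneg (by positivity)]
    have := yy_pow_diff n b k hb (Finset.mem_Ioc.1 hk).1
    calc _ ≤ (k:ℝ)^(2*K-k) * (k * (n / 4 : ℝ)^(k-1) * (0.385 + 1 / n)) := by gcongr
      _ = _ := by ring
  simp only [Nat.cast_one, one_pow, one_mul, pow_one]
  linarith

lemma CC_SS (K n : ℕ) (hK : 1 ≤ K) (hn : 0 < n) : SS K n ≤ CC K n := by
  unfold CC SS
  have hn' : (0:ℝ) < n := by exact_mod_cast hn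
  rw [← Finset.add_sum_Ioc_eq_sum_Icc hK]
  refine le_add_of_nonneg_of_le (by positivity) ?_
  refine Finset.sum_le_sum fun k hk => ?_
  obtain ⟨l, rfl⟩ : ∃ l, k = l + 1 := ⟨k-1, by have := (Finset.mem_Ioc.1 hk).1; omega⟩
  rw [mul_assoc, show l + 1 - 1 = l by omega]
  refine mul_le_mul_of_nonneg_left ?_ (by positivity)
  have : ((l+1:ℕ):ℝ) * (n/4:ℝ)^l = (n/4:ℝ)^(l+1) * (4 * (l+1:ℕ) / n) := by
    rw [pow_succ]; field_simp
  rw [this]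
  refine mul_le_mul_of_nonneg_left ?_ (by positivity)
  have : 0 ≤ 96 * ((l+1:ℕ):ℝ)^3 / n^3 := by positivity
  linarith

lemma SS_ge (K n : ℕ) (hK : 3 ≤ K) : 8 * (n:ℝ) ≤ SS K n := by
  unfold SS
  refine le_trans ?_ (Finset.single_le_sum (f := fun k : ℕ => (k:ℝ)^(2 * K - k) * (k * (n / 4 : ℝ)^(k-1)))
    (fun _ _ => by positivity) (Finset.mem_Ioc.2 ⟨by omega, by omega⟩ : 2 ∈ Finset.Ioc 1 K))
  have : (2:ℝ)^4 ≤ 2^(2*K-2) := pow_le_pow_right₀ (by norm_num) (by omega)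
  simp only [Nat.cast_ofNat]
  norm_num at this ⊢
  have hn : (0:ℝ) ≤ n := by positivity
  nlinarith

lemma cF_ok (K n : ℕ) (η : ℝ) (hK : 3 ≤ K) (hn : 0 < n)
    (hA : 2 ≤ (1 - η - 2 * (0.385 + 1 / n)) * (8 * n)) (hη : η < 1) :
    2 * (1 + (0.385 + 1 / n) * SS K n) ≤ (1 - η) * CC K n := by
  have a := CC_SS K n (by omega) hn
  have b := SS_ge K n hK
  have hn' : (0:ℝ) < n := by exact_mod_cast hn
  have c : 0 < 1 - η - 2 * (0.385 + 1 / (n:ℝ)) := by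
    by_contra h
    push Not at h
    nlinarith
  nlinarith

lemma bE_sum (q : ℝ) (n : ℕ) (s : Finset ℕ) (f : ℕ → ℕ → ℝ) :
    bE q n (fun b => ∑ k ∈ s, f k b) = ∑ k ∈ s, bE q n (f k) := by
  induction s using Finset.induction_on with
  | empty => simp [bE_const]
  | insert a s ha ih =>
    simp only [Finset.sum_insert ha]
    rw [bE_add, ih]

lemma bE_hh_ge {q : ℝ} (h0 : 0 ≤ q) (h1 : q ≤ 1) (K n : ℕ) (hn : 2 ≤ n) :
    ∑ k ∈ Finset.Icc 1 K, (k:ℝ)^(2*K-k) * (((n:ℝ) - 1) / n)^(k-1) * (n * (q * (1 - q)))^k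
      ≤ n / (n - 1) * bE q n (hh K n) := by
  have hn' : (2:ℝ) ≤ n := by exact_mod_cast hn
  have hT : 0 < (n:ℝ) / (n - 1) := div_pos (by linarith) (by linarith)
  have e : hh K n = fun b => ∑ k ∈ Finset.Icc 1 K, (k:ℝ)^(2*K-k) * yy n b^k := rfl
  rw [e, bE_sum, Finset.mul_sum]
  refine Finset.sum_le_sum fun k hk => ?_
  rw [bE_mul]
  have := bE_Ypow h0 h1 n k (by omega)
  obtain ⟨l, rfl⟩ : ∃ l, k = l + 1 := ⟨k-1, by have := (Finset.mem_Icc.1 hk).1; omega⟩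
  calc _ = (n:ℝ) / (n - 1) * (((l+1:ℕ):ℝ)^(2*K-(l+1)) * (((n:ℝ) - 1) * (q * (1-q)))^(l+1)) := by
        rw [show l + 1 - 1 = l by omega, div_pow, mul_pow, mul_pow]
        have : (n:ℝ) - 1 ≠ 0 := by linarith
        field_simp
        simp only [mul_pow]; ring
    _ ≤ _ := by gcongr; exact this

lemma T_ge_one (n : ℕ) (hn : 2 ≤ n) : (1:ℝ) ≤ n / (n - 1) := by
  have hn' : (2:ℝ) ≤ n := by exact_mod_cast hn
  rw [le_div_iff₀ (by linarith)]; linarith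

lemma hc_of (K n : ℕ) (hn : 2 ≤ n) (c η s : ℝ) (hη : 0 ≤ η) (hs : 0 ≤ s) (hsn : s^2 ≤ n / 2)
    (h : c * n ≤ η * (s * CC K n)) :
    c * n ≤ n / (n - 1) * (η * (√(n / 2) * CC K n)) := by
  have h1 := T_ge_one n hn
  have h2 : s ≤ √(n / 2) := Real.le_sqrt_of_sq_le hsn
  have h3 : 0 ≤ CC K n := CC_nonneg ..
  have h4 : η * (s * CC K n) ≤ η * (√(n / 2) * CC K n) := by gcongr
  have h5 : 0 ≤ η * (√(n / 2) * CC K n) := by positivity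
  nlinarith

lemma M4 {q : ℝ} (h0 : 0 ≤ q) (h1 : q ≤ 1) (n : ℕ) :
    cM q n 4 ≤ 3 * (n * (q * (1 - q)))^2 + 1.5 * (n * (q * (1 - q))) := by
  have a := cM_rec h0 h1 n 1
  norm_num [cM_two, cM_three] at a
  have : 0 ≤ 1 - q := by linarith
  have hz : 0 ≤ (n:ℝ) * (q * (1 - q)) := by positivity
  have e : (1 - 2 * q)^2 ≤ 1 := by nlinarith
  have e2 : (1/2 - q) * (n * (q * (1 - q)) * (1 - 2 * q)) = n * (q * (1 - q)) * (1 - 2*q)^2 / 2 := by ring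
  rw [e2] at a
  nlinarith

lemma P2case (p : PMF ℕ) (n : ℕ) (hn : 4 ≤ n) (δ₁ δ₂ : ℝ) (h1 : 0 < δ₁) (h2 : 0 < δ₂)
    (hs : δ₁ + δ₂ < 1) : sampleMeasure p n (bad p 2 n δ₁ δ₂) ≤ ENNReal.ofReal (δ₁ + δ₂) := by
  have hn' : (4:ℝ) ≤ n := by exact_mod_cast hn
  have eC : CC 2 n = 1 + 24 / n^2 + 2 * n + 192 / n := by
    unfold CC
    rw [Finset.sum_Icc_succ_top (by norm_num), Finset.Icc_self, Finset.sum_singleton]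
    norm_num
    field_simp
    ring
  have eS : SS 2 n = 2 * n := by
    unfold SS
    rw [show Finset.Ioc 1 2 = {2} by rfl, Finset.sum_singleton]
    norm_num
    ring
  refine P_core p 2 n (by norm_num) (by omega) δ₁ δ₂ h1 h2 hs 0.5 0.2 (2 * (1 + (0.385 + 1 / n) * SS 2 n))
    (by norm_num) (by norm_num) (by norm_num) ?_ ?_ (fun b hb => hh_diff 2 n b (by norm_num) hb) ?_
  · intro q q0 q1
    refine le_trans (M4 q0 q1 n) ?_
    have := bE_hh_ge q0 q1 2 n (by omega)
    rw [Finset.sum_Icc_succ_top (by norm_num), Finset.Icc_self, Finset.sum_singleton] at this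
    norm_num at this
    have : 0 ≤ 1 - q := by linarith
    have hz : 0 ≤ (n:ℝ) * (q * (1 - q)) := by positivity
    have hl : 3 ≤ 4 * (((n:ℝ) - 1) / n) := by
      rw [← mul_div_assoc, le_div_iff₀ (by linarith)]; linarith
    nlinarith [sq_nonneg ((n:ℝ) * (q * (1 - q)))]
  · refine hc_of 2 n (by omega) _ _ 1.4 (by norm_num) (by norm_num) (by norm_num; linarith) ?_
    rw [eC]
    have : 0 ≤ 24 / (n:ℝ)^2 := by positivity
    have : 0 ≤ 192 / (n:ℝ) := by positivity
    linarith
  · rw [eS, eC]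
    have a : 0 ≤ 24 / (n:ℝ)^2 := by positivity
    have b : (1 / (n:ℝ)) * n = 1 := by field_simp
    have c : 192 / (n:ℝ) * n = 192 := by field_simp
    have : 0 ≤ (0.06 * n - 5.2 + 153.6 / (n:ℝ)) := by
      have : (0.06 * n - 5.2 + 153.6 / (n:ℝ)) = (0.06 * n^2 - 5.2 * n + 153.6) / n := by field_simp
      rw [this]
      apply div_nonneg _ (by linarith)
      nlinarith [sq_nonneg ((n:ℝ) - 43)]
    have : 192 / (n:ℝ) * 0.8 = 153.6 / n := by ring
    nlinarith

lemma M6 {q : ℝ} (h0 : 0 ≤ q) (h1 : q ≤ 1) (n : ℕ) :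
    cM q n 6 ≤ (n * (q * (1 - q))) * (20 * (n * (q * (1 - q)))^2 + 35 * (n * (q * (1 - q))) + 12.5) := by
  have a := cM_lin h0 h1 n 2 5 (by norm_num)
  norm_num at a
  have b := M4 h0 h1 n
  have : 0 ≤ 1 - q := by linarith
  have hz : 0 ≤ (n:ℝ) * (q * (1 - q)) := by positivity
  set z := (n:ℝ) * (q * (1 - q))
  nlinarith [mul_le_mul_of_nonneg_left b (by linarith : 0 ≤ z + 5/4)]

lemma M8 {q : ℝ} (h0 : 0 ≤ q) (h1 : q ≤ 1) (n : ℕ) :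
    cM q n 8 ≤ (n * (q * (1 - q))) * (197.8 * (n * (q * (1 - q)))^3 + 643 * (n * (q * (1 - q)))^2
      + 643 * (n * (q * (1 - q))) + 186) := by
  have a := cM_lin h0 h1 n 3 6 (by norm_num)
  norm_num at a
  have b := M6 h0 h1 n
  have : 0 ≤ 1 - q := by linarith
  have hz : 0 ≤ (n:ℝ) * (q * (1 - q)) := by positivity
  set z := (n:ℝ) * (q * (1 - q))
  have c := mul_le_mul_of_nonneg_left b (by linarith : 0 ≤ z + 3/2)
  have z2 : 0 ≤ z^2 := by positivity
  have z3 : 0 ≤ z^3 := by positivity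
  have z4 : 0 ≤ z^4 := by positivity
  nlinarith

lemma P3case (p : PMF ℕ) (n : ℕ) (hn : 31 ≤ n) (δ₁ δ₂ : ℝ) (h1 : 0 < δ₁) (h2 : 0 < δ₂)
    (hs : δ₁ + δ₂ < 1) : sampleMeasure p n (bad p 3 n δ₁ δ₂) ≤ ENNReal.ofReal (δ₁ + δ₂) := by
  have hn' : (31:ℝ) ≤ n := by exact_mod_cast hn
  refine P_core p 3 n (by norm_num) (by omega) δ₁ δ₂ h1 h2 hs 30 0.15 (2 * (1 + (0.385 + 1 / n) * SS 3 n))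
    (by norm_num) (by norm_num) (by norm_num) ?_ ?_ (fun b hb => hh_diff 3 n b (by norm_num) hb) ?_
  · intro q q0 q1
    refine le_trans (M6 q0 q1 n) ?_
    have := bE_hh_ge q0 q1 3 n (by omega)
    rw [Finset.sum_Icc_succ_top (by norm_num), Finset.sum_Icc_succ_top (by norm_num), Finset.Icc_self, Finset.sum_singleton] at this
    norm_num at this
    have h3 : 0 ≤ 1 - q := by linarith
    have hz : 0 ≤ (n:ℝ) * (q * (1 - q)) := by positivity
    have hl : 0.9677 ≤ (((n:ℝ) - 1) / n) := by
      rw [le_div_iff₀ (by linarith)]; linarith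
    set z := (n:ℝ) * (q * (1 - q))
    set l := (((n:ℝ) - 1) / n)
    have hl2 : 0.936 ≤ l^2 := by nlinarith
    have k1 : 0.9677 * z^2 ≤ l * z^2 := by gcongr
    have k2 : 0.936 * z^3 ≤ l^2 * z^3 := by gcongr
    nlinarith [mul_nonneg hz (sq_nonneg (z - 1.85))]
  · refine hc_of 3 n (by omega) _ _ 3 (by norm_num) (by norm_num) (by norm_num; linarith) ?_
    have c := CC_ge 3 n 3 (by norm_num) (by norm_num)
    have : 5 * (n:ℝ)^2 ≤ CC 3 n := by
      refine le_trans ?_ c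
      norm_num
      have : 0 ≤ 27 * ((n:ℝ)/4)^3 * (2592 / n^3) := by positivity
      have e : 27 * ((n:ℝ)/4)^3 * (12 / n) = 81/16 * n^2 := by field_simp; norm_num
      rw [mul_add, e]; nlinarith
    nlinarith
  · apply cF_ok 3 n _ (by norm_num) (by omega) _ (by norm_num)
    have b : (1 / (n:ℝ)) * n = 1 := by field_simp
    nlinarith

lemma P4case (p : PMF ℕ) (n : ℕ) (hn : 60 ≤ n) (δ₁ δ₂ : ℝ) (h1 : 0 < δ₁) (h2 : 0 < δ₂)
    (hs : δ₁ + δ₂ < 1) : sampleMeasure p n (bad p 4 n δ₁ δ₂) ≤ ENNReal.ofReal (δ₁ + δ₂) := by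
  have hn' : (60:ℝ) ≤ n := by exact_mod_cast hn
  refine P_core p 4 n (by norm_num) (by omega) δ₁ δ₂ h1 h2 hs 9000 0.15 (2 * (1 + (0.385 + 1 / n) * SS 4 n))
    (by norm_num) (by norm_num) (by norm_num) ?_ ?_ (fun b hb => hh_diff 4 n b (by norm_num) hb) ?_
  · intro q q0 q1
    refine le_trans (M8 q0 q1 n) ?_
    have := bE_hh_ge q0 q1 4 n (by omega)
    rw [Finset.sum_Icc_succ_top (by norm_num), Finset.sum_Icc_succ_top (by norm_num), Finset.sum_Icc_succ_top (by norm_num), Finset.Icc_self, Finset.sum_singleton] at this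
    norm_num at this
    have h3 : 0 ≤ 1 - q := by linarith
    have hz : 0 ≤ (n:ℝ) * (q * (1 - q)) := by positivity
    have hl : 0.9833 ≤ (((n:ℝ) - 1) / n) := by
      rw [le_div_iff₀ (by linarith)]; linarith
    set z := (n:ℝ) * (q * (1 - q))
    set l := (((n:ℝ) - 1) / n)
    have hl2 : 0.9667 ≤ l^2 := by nlinarith
    have hl3 : 0.9505 ≤ l^3 := by nlinarith
    have k1 : 0.9833 * z^2 ≤ l * z^2 := by gcongr
    have k2 : 0.9667 * z^3 ≤ l^2 * z^3 := by gcongr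
    have k3 : 0.9505 * z^4 ≤ l^3 * z^4 := by gcongr
    have key : 0 ≤ 45.5 * z^3 - 409 * z^2 - 581 * z + 8814 := by
      nlinarith [mul_nonneg hz (sq_nonneg (z - 6.607)), sq_nonneg (z - 6.607)]
    have := mul_nonneg hz key
    have z3 : 0 ≤ z^3 := by positivity
    have z4 : 0 ≤ z^4 := by positivity
    have z2 : 0 ≤ z^2 := by positivity
    nlinarith
  · refine hc_of 4 n (by omega) _ _ 5 (by norm_num) (by norm_num) (by norm_num; linarith) ?_
    have c := CC_ge 4 n 4 (by norm_num) (by norm_num)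
    have : 16 * (n:ℝ)^3 ≤ CC 4 n := by
      refine le_trans ?_ c
      norm_num
      have : 0 ≤ 256 * ((n:ℝ)/4)^4 * (6144 / n^3) := by positivity
      have e : 256 * ((n:ℝ)/4)^4 * (16 / n) = 16 * n^3 := by field_simp; norm_num
      rw [mul_add, e]; nlinarith
    have : 3600 * (n:ℝ) ≤ n^3 := by nlinarith [mul_nonneg (by linarith : (0:ℝ) ≤ n) (by nlinarith : (0:ℝ) ≤ n^2 - 3600)]
    nlinarith
  · apply cF_ok 4 n _ (by norm_num) (by omega) _ (by norm_num)
    have b : (1 / (n:ℝ)) * n = 1 := by field_simp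
    nlinarith

lemma growth (k : ℕ) (hk : 2 ≤ k) : 1.33 * (2 * (k:ℝ) + 1) * (k:ℝ)^k ≤ ((k:ℝ) + 1)^(k+1) := by
  have hk' : (2:ℝ) ≤ k := by exact_mod_cast hk
  have k0 : (0:ℝ) < k := by linarith
  have e : (7.38:ℝ) ≤ exp 2 := by
    have := Real.exp_one_gt_d9
    rw [show (2:ℝ) = 1 + 1 by norm_num, Real.exp_add]
    nlinarith
  have l := Real.le_log_one_add_of_nonneg (x := 1 / (k:ℝ)) (by positivity)
  have l2 : 2 * (1 / (k:ℝ)) / (1 / k + 2) = 2 / (2 * k + 1) := by field_simp; ring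
  rw [l2] at l
  have l3 : exp 2 ≤ (1 + 1 / (k:ℝ))^(2 * k + 1) := by
    rw [← Real.exp_log (show (0:ℝ) < (1 + 1 / (k:ℝ))^(2 * k + 1) by positivity), Real.exp_le_exp, Real.log_pow]
    push_cast
    rw [div_le_iff₀ (by positivity)] at l
    linarith
  have l4 : 7.38 * (k:ℝ)^(2*k+1) ≤ ((k:ℝ)+1)^(2*k+1) := by
    have : ((k:ℝ)+1) = k * (1 + 1 / (k:ℝ)) := by field_simp
    rw [this, mul_pow, mul_comm]
    exact mul_le_mul_of_nonneg_left (e.trans l3) (by positivity)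
  refine le_of_sq_le_sq ?_ (by positivity)
  have p0 : 0 ≤ (k:ℝ)^(2*k) := by positivity
  calc (1.33 * (2 * (k:ℝ) + 1) * (k:ℝ)^k)^2 = (1.33^2 * (2 * (k:ℝ) + 1)^2) * (k:ℝ)^(2*k) := by
        rw [mul_pow, mul_pow, ← pow_mul, mul_comm k 2]
    _ ≤ (7.38 * k * (k + 1)) * (k:ℝ)^(2*k) := by
        refine mul_le_mul_of_nonneg_right ?_ p0
        nlinarith
    _ = (7.38 * (k:ℝ)^(2*k+1)) * (k + 1) := by ring
    _ ≤ ((k:ℝ)+1)^(2*k+1) * (k+1) := by gcongr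
    _ = _ := by ring

lemma M_ind {q : ℝ} (h0 : 0 ≤ q) (h1 : q ≤ 1) (n K : ℕ) (hK : 5 ≤ K) (Z : ℝ)
    (hZ : n * (q * (1 - q)) ≤ Z) (hZK : 6.11 * K ≤ Z) (k : ℕ) (hk : 2 ≤ k) (hkK : k ≤ K) :
    cM q n (2 * k) ≤ 0.8 * (k:ℝ)^k * (n * (q * (1 - q))) * Z^(k-1) := by
  have hK' : (5:ℝ) ≤ K := by exact_mod_cast hK
  have : 0 ≤ 1 - q := by linarith
  have hz : 0 ≤ (n:ℝ) * (q * (1 - q)) := by positivity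
  induction k, hk using Nat.le_induction with
  | base =>
    have := M4 h0 h1 n
    norm_num at this ⊢
    nlinarith
  | succ k hk ih =>
    have ih := ih (by omega)
    have g := growth k hk
    have a := cM_lin h0 h1 n k (2 * (2 * k + 1)) (by positivity)
    have e : 1 - (2 * (k:ℝ) + 1) / (4 * (2 * (2 * k + 1))) = 7/8 := by field_simp; norm_num
    rw [e] at a
    have kK : (k:ℝ) + 1 ≤ K := by exact_mod_cast hkK
    set z := (n:ℝ) * (q * (1 - q))
    have hZ0 : 0 ≤ Z := by linarith
    have r : z + 2 * (2 * (k:ℝ) + 1) / 4 ≤ 7/8 * (1.33 * Z) := by linarith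
    have pos := cM_nonneg h0 h1 n k
    have b : cM q n (2 * (k+1)) ≤ (2 * k + 1) * (1.33 * Z) * cM q n (2 * k) := by
      have : (2 * (k:ℝ) + 1) * (z + 2 * (2 * (k:ℝ) + 1) / 4) * cM q n (2 * k) ≤
        (2 * (k:ℝ) + 1) * (7/8 * (1.33 * Z)) * cM q n (2 * k) := by gcongr
      rw [show 2 * (k+1) = 2 * k + 2 by ring]
      linarith
    calc _ ≤ _ := b
      _ ≤ (2 * k + 1) * (1.33 * Z) * (0.8 * (k:ℝ)^k * z * Z^(k-1)) := by gcongr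
      _ = 0.8 * (1.33 * (2 * (k:ℝ) + 1) * (k:ℝ)^k) * z * (Z^(k-1) * Z) := by ring
      _ ≤ 0.8 * (((k:ℝ) + 1)^(k+1)) * z * (Z^(k-1) * Z) := by gcongr
      _ = _ := by
        rw [← pow_succ, show k - 1 + 1 = k by omega, show k + 1 - 1 = k by omega]; push_cast; ring

lemma P5case (p : PMF ℕ) (K n : ℕ) (hK : 5 ≤ K) (hn : 55 * K ≤ n) (δ₁ δ₂ : ℝ) (h1 : 0 < δ₁) (h2 : 0 < δ₂)
    (hs : δ₁ + δ₂ < 1) : sampleMeasure p n (bad p K n δ₁ δ₂) ≤ ENNReal.ofReal (δ₁ + δ₂) := by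
  have hK' : (5:ℝ) ≤ K := by exact_mod_cast hK
  have hn' : (55:ℝ) * K ≤ n := by exact_mod_cast hn
  have n0 : (0:ℝ) < n := by linarith
  refine P_core p K n (by omega) (by omega) δ₁ δ₂ h1 h2 hs (0.8 * (K:ℝ)^K * (6.11 * K)^(K-1)) 0.2 (2 * (1 + (0.385 + 1 / n) * SS K n))
    (by positivity) (by norm_num) (by norm_num) ?_ ?_ (fun b hb => hh_diff K n b (by omega) hb) ?_
  · intro q q0 q1
    have h3 : 0 ≤ 1 - q := by linarith
    have hz : 0 ≤ (n:ℝ) * (q * (1 - q)) := by positivity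
    have b := bE_hh_ge q0 q1 K n (by omega)
    have s := Finset.single_le_sum (f := fun k : ℕ => (k:ℝ)^(2*K-k) * (((n:ℝ) - 1) / n)^(k-1) * (n * (q * (1 - q)))^k)
      (fun i _ => by
        have : 0 ≤ ((n:ℝ) - 1) / n := div_nonneg (by linarith) n0.le
        positivity) (Finset.mem_Icc.2 ⟨by omega, le_rfl⟩ : K ∈ Finset.Icc 1 K)
    have m := M_ind q0 q1 n K hK (max (n * (q * (1 - q))) (6.11 * K)) (le_max_left _ _) (le_max_right _ _) K (by omega) le_rfl
    rw [show 2 * K - K = K by omega] at s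
    set z := (n:ℝ) * (q * (1 - q))
    have l : 0.8 ≤ (((n:ℝ) - 1) / n)^(K-1) := by
      have := one_add_mul_le_pow (a := -1 / (n:ℝ)) (by
        have : 1 / (n:ℝ) ≤ 1 := by rw [div_le_one n0]; linarith
        have : -1 / (n:ℝ) = - (1 / n) := by ring
        linarith) (K-1)
      have e : 1 + -1 / (n:ℝ) = (n - 1) / n := by field_simp; ring
      rw [e] at this
      refine le_trans ?_ this
      have : ((K-1:ℕ):ℝ) * (1 / n) ≤ 0.2 := by
        rw [mul_one_div, div_le_iff₀ n0, Nat.cast_sub (by omega)]; push_cast; linarith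
      have e : ((K-1:ℕ):ℝ) * (-1 / n) = - (((K-1:ℕ):ℝ) * (1 / n)) := by ring
      rw [e]; linarith
    have mx : max z (6.11 * K)^(K-1) ≤ z^(K-1) + (6.11 * K)^(K-1) := by
      rcases max_choice z (6.11 * K) with h | h <;> rw [h]
      · have : (0:ℝ) ≤ (6.11 * K)^(K-1) := by positivity
        linarith
      · have : (0:ℝ) ≤ z^(K-1) := by positivity
        linarith
    calc _ ≤ _ := m
      _ ≤ 0.8 * (K:ℝ)^K * z * (z^(K-1) + (6.11 * K)^(K-1)) := by gcongr
      _ = (K:ℝ)^K * 0.8 * z^K + 0.8 * (K:ℝ)^K * (6.11 * K)^(K-1) * z := by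
        have : z^K = z^(K-1) * z := by rw [← pow_succ, show K - 1 + 1 = K by omega]
        rw [this]; ring
      _ ≤ (K:ℝ)^K * (((n:ℝ) - 1) / n)^(K-1) * z^K + 0.8 * (K:ℝ)^K * (6.11 * K)^(K-1) * z := by gcongr
      _ ≤ _ := by linarith
  · refine hc_of K n (by omega) _ _ (√(n/2)) (by norm_num) (by positivity) (by rw [Real.sq_sqrt (by positivity)]) ?_
    have c := CC_ge K n K (by omega) le_rfl
    obtain ⟨l, rfl⟩ : ∃ l, K = l + 1 := ⟨K-1, by omega⟩
    rw [show 2 * (l+1) - (l+1) = l + 1 by omega] at c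
    rw [show l + 1 - 1 = l by omega]
    set κ : ℝ := ((l+1:ℕ):ℝ) with hκ
    have κ0 : 0 < κ := by linarith
    have c2 : κ^(l+1) * κ * (n/4:ℝ)^l ≤ CC (l+1) n := by
      refine le_trans ?_ c
      have : 0 ≤ κ^(l+1) * (n/4:ℝ)^(l+1) * (96 * κ^3 / n^3) := by positivity
      have e : κ^(l+1) * (n/4:ℝ)^(l+1) * (4 * κ / n) = κ^(l+1) * κ * (n/4:ℝ)^l := by
        rw [pow_succ (n/4:ℝ)]; field_simp
      rw [mul_add, e]; linarith
    set w : ℝ := n / (24.44 * κ) with hw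
    have w0 : 2.25 ≤ w := by rw [hw, le_div_iff₀ (by positivity)]; linarith
    have wp : (0:ℝ) < w := by linarith
    have en : (n/4:ℝ)^l = w^l * (6.11 * κ)^l := by
      rw [← mul_pow, hw]; congr 1; field_simp; norm_num
    have es : (n:ℝ) = 2 * (√(n/2) * √(n/2)) := by rw [Real.mul_self_sqrt (by positivity)]; ring
    have key : 8 * √(n/2) ≤ κ * w^l := by
      refine le_of_sq_le_sq ?_ (by positivity)
      rw [mul_pow, Real.sq_sqrt (by positivity)]
      have nn : (n:ℝ) = 24.44 * κ * w := by rw [hw]; field_simp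
      have w7 : (2.25:ℝ)^7 ≤ w^(2 * l - 1) := by
        calc (2.25:ℝ)^7 ≤ w^7 := by gcongr
          _ ≤ _ := pow_le_pow_right₀ (by linarith) (by omega)
      have e2 : (κ * w^l)^2 = κ * w * (κ * w^(2*l-1)) := by
        have : w^(2 * l) = w^(2*l-1) * w := by rw [← pow_succ]; congr 1; omega
        rw [mul_pow, ← pow_mul, mul_comm l 2, this]; ring
      rw [e2]
      have : 782.08 ≤ κ * w^(2*l-1) := by
        norm_num at w7
        nlinarith
      calc (8:ℝ)^2 * (n/2) = κ * w * 782.08 := by rw [nn]; ring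
        _ ≤ _ := by gcongr
    calc 0.8 * κ^(l+1) * (6.11 * κ)^l * n = 0.2 * √(n/2) * κ^(l+1) * (6.11 * κ)^l * (8 * √(n/2)) := by
          conv_lhs => rw [es]
          ring
      _ ≤ 0.2 * √(n/2) * κ^(l+1) * (6.11 * κ)^l * (κ * w^l) := by gcongr
      _ = 0.2 * (√(n/2) * (κ^(l+1) * κ * (n/4:ℝ)^l)) := by rw [en]; ring
      _ ≤ _ := by gcongr
  · apply cF_ok K n _ (by omega) (by omega) _ (by norm_num)
    have b : (1 / (n:ℝ)) * n = 1 := by field_simp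
    nlinarith

lemma K_ge_two (p : PMF ℕ) (K n : ℕ) (hn : 2 ≤ n) (hK : 2 ≤ K) (δ₁ δ₂ : ℝ) (h1 : 0 < δ₁) (h2 : 0 < δ₂)
    (hs : δ₁ + δ₂ < 1) : sampleMeasure p n (bad p K n δ₁ δ₂) ≤ ENNReal.ofReal (δ₁ + δ₂) := by
  by_cases h : n ≤ K ∨ (K = 2 ∧ n < 4) ∨ (K = 3 ∧ n < 31) ∨ (K = 4 ∧ n < 60) ∨ (5 ≤ K ∧ n < 55 * K)
  · exact E_all p K n hn δ₁ δ₂ h1 h2 hs h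
  by_cases k2 : K = 2
  · subst k2; exact P2case p n (by omega) δ₁ δ₂ h1 h2 hs
  by_cases k3 : K = 3
  · subst k3; exact P3case p n (by omega) δ₁ δ₂ h1 h2 hs
  by_cases k4 : K = 4
  · subst k4; exact P4case p n (by omega) δ₁ δ₂ h1 h2 hs
  exact P5case p K n (by omega) (by omega) δ₁ δ₂ h1 h2 hs

noncomputable def ch {N : ℕ} (x : Fin N → ℕ) (s t : Fin N) : ℝ := if x s = x t then 0 else 1
noncomputable def DD {N : ℕ} (x : Fin N → ℕ) (s : Fin N) : ℝ := ∑ t, ch x s t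
noncomputable def AA {N : ℕ} (x : Fin N → ℕ) (k : ℕ) : ℝ := ∑ s, DD x s ^ k
noncomputable def vv {N : ℕ} (x : Fin N → ℕ) (s t : Fin N) : ℝ := 4 + (DD x s + DD x t) - N * ch x s t
noncomputable def bb {N : ℕ} (x : Fin N → ℕ) (s t : Fin N) : ℝ := 2 * (DD x s + DD x t) - 2 * ch x s t

section det
variable {N : ℕ} (x : Fin N → ℕ)

lemma ch01 (s t : Fin N) : ch x s t = 0 ∨ ch x s t = 1 := by unfold ch; split_ifs <;> simp
lemma ch_nonneg (s t : Fin N) : 0 ≤ ch x s t := by rcases ch01 x s t with h | h <;> rw [h]; norm_num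
lemma ch_le (s t : Fin N) : ch x s t ≤ 1 := by rcases ch01 x s t with h | h <;> rw [h]; norm_num
lemma ch_self (s : Fin N) : ch x s s = 0 := by simp [ch]
lemma ch_symm (s t : Fin N) : ch x s t = ch x t s := by simp [ch, eq_comm]
lemma ch_tri (s t k : Fin N) : ch x s t ≤ ch x s k + ch x t k := by
  unfold ch; split_ifs <;> first | (exfalso; simp_all; done) | norm_num
lemma DD_nonneg (s : Fin N) : 0 ≤ DD x s := Finset.sum_nonneg fun _ _ => ch_nonneg x _ _
lemma DD_le (s : Fin N) : DD x s ≤ N := by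
  have := Finset.sum_le_sum (fun t (_ : t ∈ (Finset.univ : Finset (Fin N))) => ch_le x s t)
  simpa [DD] using this
lemma DD_eq (s t : Fin N) (h : ch x s t = 0) : DD x s = DD x t := by
  have : x s = x t := by
    by_contra hh; simp [ch, hh] at h
  simp [DD, ch, this]
lemma DD_ge (s t : Fin N) : N * ch x s t ≤ DD x s + DD x t := by
  unfold DD
  rw [← Finset.sum_add_distrib]
  have := Finset.sum_le_sum (fun k (_ : k ∈ (Finset.univ : Finset (Fin N))) => ch_tri x s t k)
  simpa using this
lemma vv_nonneg (s t : Fin N) : 0 ≤ vv x s t := by have := DD_ge x s t; unfold vv; linarith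

lemma AA_zero : AA x 0 = N := by simp [AA]
lemma AA_nonneg (k : ℕ) : 0 ≤ AA x k := Finset.sum_nonneg fun s _ => pow_nonneg (DD_nonneg x s) k

lemma s_pp (i j : ℕ) : ∑ s, ∑ t, DD x s ^ i * DD x t ^ j = AA x i * AA x j := by
  unfold AA; rw [Finset.sum_mul_sum]
lemma s_cl (i : ℕ) : ∑ s, ∑ t, ch x s t * DD x s ^ i = AA x (i+1) := by
  unfold AA; refine Finset.sum_congr rfl fun s _ => ?_
  rw [← Finset.sum_mul, pow_succ, mul_comm]; rfl
lemma s_cr (i : ℕ) : ∑ s, ∑ t, ch x s t * DD x t ^ i = AA x (i+1) := by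
  rw [Finset.sum_comm, ← s_cl]
  refine Finset.sum_congr rfl fun s _ => Finset.sum_congr rfl fun t _ => ?_
  rw [ch_symm]
lemma s_q : ∑ s, ∑ t, ch x s t * (DD x s * DD x t) = AA x 1 ^ 2 - N * AA x 2 + AA x 3 := by
  have h : ∀ s t, ch x s t * (DD x s * DD x t) = DD x s ^ 1 * DD x t ^ 1 - DD x s ^ 2 * DD x t ^ 0 + ch x s t * DD x s ^ 2 := by
    intro s t
    rcases ch01 x s t with h | h
    · rw [h, DD_eq x s t h]; ring
    · rw [h]; ring
  simp only [h, Finset.sum_add_distrib, Finset.sum_sub_distrib]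
  rw [s_pp, s_pp, s_cl, AA_zero]; ring

lemma offsum (f : Fin N → Fin N → ℝ) : ∑ st ∈ (Finset.univ : Finset (Fin N)).offDiag, f st.1 st.2 = ∑ s, ∑ t, f s t - ∑ s, f s s := by
  rw [← Finset.sum_product', ← Finset.diag_union_offDiag, Finset.sum_union (Finset.disjoint_diag_offDiag _), Finset.sum_diag]
  ring

lemma sum_vv : ∑ st ∈ (Finset.univ : Finset (Fin N)).offDiag, vv x st.1 st.2 = 4 * N * (N - 1) + (N - 2) * AA x 1 := by
  rw [offsum (f := vv x)]
  have h1 : ∑ s, ∑ t, vv x s t = 4 * (∑ s, ∑ t, DD x s ^ 0 * DD x t ^ 0) + ∑ s, ∑ t, DD x s ^ 1 * DD x t ^ 0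
     + ∑ s, ∑ t, DD x s ^ 0 * DD x t ^ 1 - N * ∑ s, ∑ t, ch x s t * DD x s ^ 0 := by
    simp only [Finset.mul_sum, ← Finset.sum_add_distrib, ← Finset.sum_sub_distrib]
    refine Finset.sum_congr rfl fun s _ => Finset.sum_congr rfl fun t _ => ?_
    unfold vv; ring
  have h2 : ∑ s, vv x s s = 4 * AA x 0 + 2 * AA x 1 := by
    simp only [AA, Finset.mul_sum, ← Finset.sum_add_distrib]
    refine Finset.sum_congr rfl fun s _ => ?_
    unfold vv; rw [ch_self]; ring
  rw [h1, h2, s_pp, s_pp, s_pp, s_cl, AA_zero]; ring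

lemma sum_vb : ∑ st ∈ (Finset.univ : Finset (Fin N)).offDiag, vv x st.1 st.2 * bb x st.1 st.2
    = 2 * ((9 * N - 12) * AA x 1 + 2 * AA x 1 ^ 2 - 6 * AA x 2) := by
  rw [offsum (f := fun s t => vv x s t * bb x s t)]
  have h1 : ∑ s, ∑ t, vv x s t * bb x s t = 8 * (∑ s, ∑ t, DD x s ^ 1 * DD x t ^ 0) + 8 * (∑ s, ∑ t, DD x s ^ 0 * DD x t ^ 1)
     + 2 * (∑ s, ∑ t, DD x s ^ 2 * DD x t ^ 0) + 2 * (∑ s, ∑ t, DD x s ^ 0 * DD x t ^ 2) + 4 * (∑ s, ∑ t, DD x s ^ 1 * DD x t ^ 1)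
     + (2 * N - 8) * (∑ s, ∑ t, ch x s t * DD x s ^ 0)
     - (2 * N + 2) * (∑ s, ∑ t, ch x s t * DD x s ^ 1) - (2 * N + 2) * (∑ s, ∑ t, ch x s t * DD x t ^ 1) := by
    simp only [Finset.mul_sum, ← Finset.sum_add_distrib, ← Finset.sum_sub_distrib]
    refine Finset.sum_congr rfl fun s _ => Finset.sum_congr rfl fun t _ => ?_
    unfold vv bb; rcases ch01 x s t with h | h <;> rw [h] <;> ring
  have h2 : ∑ s, vv x s s * bb x s s = 16 * AA x 1 + 8 * AA x 2 := by
    simp only [AA, Finset.mul_sum, ← Finset.sum_add_distrib]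
    refine Finset.sum_congr rfl fun s _ => ?_
    unfold vv bb; rw [ch_self]; ring
  rw [h1, h2, s_pp, s_pp, s_pp, s_pp, s_pp, s_cl, s_cl, s_cr, AA_zero]; ring

lemma sum_vbb : ∑ st ∈ (Finset.univ : Finset (Fin N)).offDiag, vv x st.1 st.2 * bb x st.1 st.2 ^ 2
    = 4 * (-(2 * N + 16) * AA x 3 + (4 - 2 * N) * AA x 1 ^ 2 + AA x 2 * (2 * N^2 + 16 * N - 30) + 6 * AA x 1 * AA x 2 + (4 - N) * AA x 1) := by
  rw [offsum (f := fun s t => vv x s t * bb x s t ^ 2)]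
  have h1 : ∑ s, ∑ t, vv x s t * bb x s t ^ 2 = 16 * (∑ s, ∑ t, DD x s ^ 2 * DD x t ^ 0) + 16 * (∑ s, ∑ t, DD x s ^ 0 * DD x t ^ 2)
     + 32 * (∑ s, ∑ t, DD x s ^ 1 * DD x t ^ 1)
     + 4 * (∑ s, ∑ t, DD x s ^ 3 * DD x t ^ 0) + 4 * (∑ s, ∑ t, DD x s ^ 0 * DD x t ^ 3)
     + 12 * (∑ s, ∑ t, DD x s ^ 2 * DD x t ^ 1) + 12 * (∑ s, ∑ t, DD x s ^ 1 * DD x t ^ 2)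
     + 4 * (4 - N) * (∑ s, ∑ t, ch x s t * DD x s ^ 0)
     + 4 * (2 * N - 7) * (∑ s, ∑ t, ch x s t * DD x s ^ 1) + 4 * (2 * N - 7) * (∑ s, ∑ t, ch x s t * DD x t ^ 1)
     - 4 * (N + 2) * (∑ s, ∑ t, ch x s t * DD x s ^ 2) - 4 * (N + 2) * (∑ s, ∑ t, ch x s t * DD x t ^ 2)
     - 8 * (N + 2) * (∑ s, ∑ t, ch x s t * (DD x s * DD x t)) := by
    simp only [Finset.mul_sum, ← Finset.sum_add_distrib, ← Finset.sum_sub_distrib]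
    refine Finset.sum_congr rfl fun s _ => Finset.sum_congr rfl fun t _ => ?_
    unfold vv bb; rcases ch01 x s t with h | h <;> rw [h] <;> ring
  have h2 : ∑ s, vv x s s * bb x s s ^ 2 = 64 * AA x 2 + 32 * AA x 3 := by
    simp only [AA, Finset.mul_sum, ← Finset.sum_add_distrib]
    refine Finset.sum_congr rfl fun s _ => ?_
    unfold vv bb; rw [ch_self]; ring
  rw [h1, h2, s_pp, s_pp, s_pp, s_pp, s_pp, s_pp, s_pp, s_cl, s_cl, s_cl, s_cr, s_cr, s_q, AA_zero]; ring

/-- `d D ≤ A₁ / 2` -/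
lemma dD_le (s : Fin N) : (N - DD x s) * DD x s ≤ AA x 1 / 2 := by
  have : ∑ t, ((1 - ch x s t) * DD x s + ch x s t * (N - DD x s)) ≤ AA x 1 := by
    unfold AA
    refine Finset.sum_le_sum fun t _ => ?_
    rcases ch01 x s t with h | h
    · rw [h, DD_eq x s t h]; linarith
    · have := DD_ge x s t
      rw [h] at this ⊢; linarith
  rw [Finset.sum_add_distrib, ← Finset.sum_mul, ← Finset.sum_mul, Finset.sum_sub_distrib] at this
  have e : ∑ t, ch x s t = DD x s := rfl
  rw [e] at this
  simp at this
  linarith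

lemma PP_le : N * AA x 2 - AA x 3 ≤ AA x 1 ^ 2 / 2 := by
  have : N * AA x 2 - AA x 3 = ∑ s, ((N - DD x s) * DD x s) * DD x s := by
    simp only [AA, Finset.mul_sum, ← Finset.sum_sub_distrib]
    refine Finset.sum_congr rfl fun s _ => by ring
  rw [this]
  calc _ ≤ ∑ s, AA x 1 / 2 * DD x s := Finset.sum_le_sum fun s _ => mul_le_mul_of_nonneg_right (dD_le x s) (DD_nonneg x s)
    _ = _ := by
      rw [← Finset.mul_sum]
      have : ∑ s, DD x s = AA x 1 := by simp [AA]
      rw [this]; ring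

lemma A2_le : N * (2 * AA x 2 - N * AA x 1) ≤ AA x 1 ^ 2 := by
  have e : N * (2 * AA x 2 - N * AA x 1) = ∑ s, ∑ t, (N * (ch x s t * DD x s ^ 1) + N * (ch x s t * DD x t ^ 1) - (N * N) * (ch x s t * DD x s ^ 0)) := by
    simp only [Finset.sum_add_distrib, Finset.sum_sub_distrib, ← Finset.mul_sum]
    rw [s_cl, s_cl, s_cr]; ring
  rw [e, pow_two, ← s_pp]
  refine Finset.sum_le_sum fun s _ => Finset.sum_le_sum fun t _ => ?_
  have a := DD_nonneg x s
  have b := DD_nonneg x t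
  have c := DD_le x s
  have d := DD_le x t
  rcases ch01 x s t with h | h <;> rw [h]
  · simp; positivity
  · nlinarith [mul_nonneg (sub_nonneg.2 c) (sub_nonneg.2 d)]

lemma bb_le_A (s t : Fin N) (hst : s ≠ t) : bb x s t ≤ AA x 1 := by
  have : 0 ≤ ∑ j, ∑ k, ch x j k * ((1 - (if j = s then 1 else 0) - (if j = t then 1 else 0)) * (1 - (if k = s then 1 else 0) - (if k = t then 1 else 0))) := by
    refine Finset.sum_nonneg fun j _ => Finset.sum_nonneg fun k _ => mul_nonneg (ch_nonneg x j k) ?_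
    apply mul_nonneg
    · split_ifs with h1 h2 <;> first | (exfalso; exact hst (h1.symm.trans h2)) | norm_num
    · split_ifs with h1 h2 <;> first | (exfalso; exact hst (h1.symm.trans h2)) | norm_num
  have e : ∑ j, ∑ k, ch x j k * ((1 - (if j = s then (1:ℝ) else 0) - (if j = t then 1 else 0)) * (1 - (if k = s then 1 else 0) - (if k = t then 1 else 0)))
      = ∑ j, (1 - (if j = s then (1:ℝ) else 0) - (if j = t then 1 else 0)) * (DD x j - ch x j s - ch x j t) := by
    refine Finset.sum_congr rfl fun j _ => ?_
    have : DD x j - ch x j s - ch x j t = ∑ k, ch x j k * (1 - (if k = s then 1 else 0) - (if k = t then 1 else 0)) := by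
      simp [mul_sub, Finset.sum_sub_distrib, DD]
    rw [this, Finset.mul_sum]
    refine Finset.sum_congr rfl fun k _ => by ring
  rw [e] at this
  have e2 : ∑ j, (1 - (if j = s then (1:ℝ) else 0) - (if j = t then 1 else 0)) * (DD x j - ch x j s - ch x j t)
     = (∑ j, DD x j - ∑ j, ch x j s - ∑ j, ch x j t) - (DD x s - ch x s s - ch x s t) - (DD x t - ch x t s - ch x t t) := by
    simp [sub_mul, Finset.sum_sub_distrib]
  rw [e2] at this
  have c1 : ∑ j, ch x j s = DD x s := Finset.sum_congr rfl fun j _ => ch_symm x _ _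
  have c2 : ∑ j, ch x j t = DD x t := Finset.sum_congr rfl fun j _ => ch_symm x _ _
  have c3 : ∑ j, DD x j = AA x 1 := by simp [AA]
  rw [c1, c2, c3, ch_self, ch_self, ch_symm x t s] at this
  unfold bb; linarith

lemma bb_le_N (s t : Fin N) (hst : s ≠ t) : bb x s t ≤ 4 * N - 6 := by
  have h : ∀ s t : Fin N, s ≠ t → DD x s ≤ N - 2 + ch x s t := by
    intro s t hst
    have : ∑ k, ch x s k ≤ ∑ k, (1 - (if k = s then (1:ℝ) else 0) - (if k = t then 1 - ch x s t else 0)) := by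
      refine Finset.sum_le_sum fun k _ => ?_
      have := ch_le x s k
      split_ifs with h1 h2 h2
      · exact absurd (h1.symm.trans h2) hst
      · rw [h1, ch_self]; norm_num
      · rw [h2]; linarith
      · linarith
    simp [Finset.sum_sub_distrib] at this
    unfold DD; linarith
  have a := h s t hst
  have b := h t s hst.symm
  rw [ch_symm x t s] at b
  have := ch_le x s t
  unfold bb; linarith

lemma det_ineq (n a A P L g : ℝ) (hn : 4 ≤ n) (ha : 0 ≤ a) (hA : 0 ≤ A)
    (hA2 : n * (2 * A - n * a) ≤ a^2)
    (hL : L ≤ 24 * a * A - 120 * A + (48 - 4 * n) * a^2 + (16 - 4 * n) * a)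
    (hP : P = 16 * n * (n - 1) * (n - 2) + a * (2 * n^2 + 18 * n - 24) + 6 * a^2 + 12 * (n - 3) * A)
    (hg : g = if a < 8 then 4 * (n - 2) else a - 2) :
    (n - 3) * L ≤ g * P := by
  have h3 : 0 ≤ n - 3 := by linarith
  have h4 : 0 ≤ n - 4 := by linarith
  refine (mul_le_mul_of_nonneg_left hL h3).trans ?_
  subst hP
  split_ifs at hg with h
  · subst hg
    have e1 : (n - 3) * (24 * a * A - 120 * A) ≤ 4 * (n - 2) * (12 * (n - 3) * A) := by
      have : 0 ≤ (n - 3) * A := by positivity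
      nlinarith [mul_nonneg this (by linarith : 0 ≤ 8 - a)]
    have e2 : (n - 3) * ((48 - 4 * n) * a^2) ≤ 4 * (n - 2) * (16 * n * (n - 1) * (n - 2)) := by
      have a2 : a^2 ≤ 64 := by nlinarith
      have q : (n - 3) * (48 - 4 * n) ≤ 81 := by nlinarith [sq_nonneg (n - 7.5)]
      have : (n - 3) * (48 - 4 * n) * a^2 ≤ 81 * 64 := by nlinarith [sq_nonneg a]
      have c1 : 6 ≤ (n - 1) * (n - 2) := by nlinarith
      have c2 : 8 ≤ n * (n - 2) := by nlinarith
      by_cases h12 : n ≤ 5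
      · have q : (n - 3) * (48 - 4 * n) ≤ 56 := by nlinarith
        have : (n - 3) * (48 - 4 * n) * a^2 ≤ 56 * 64 := by nlinarith [sq_nonneg a]
        nlinarith [mul_le_mul c1 c2 (by norm_num) (by nlinarith)]
      · push Not at h12
        have c1 : 12 ≤ (n - 1) * (n - 2) := by nlinarith
        have c2 : 15 ≤ n * (n - 2) := by nlinarith
        nlinarith [mul_le_mul c1 c2 (by norm_num) (by nlinarith)]
    have e3 : (n - 3) * ((16 - 4 * n) * a) ≤ 0 := by
      have := mul_nonneg (mul_nonneg h3 h4) ha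
      nlinarith
    have e4 : 0 ≤ 4 * (n - 2) * (a * (2 * n^2 + 18 * n - 24) + 6 * a^2) := by
      have : 0 ≤ 2 * n^2 + 18 * n - 24 := by nlinarith
      have : 0 ≤ n - 2 := by linarith
      positivity
    nlinarith
  · subst hg
    push Not at h
    have hA3 : (n - 3) * (12 * a - 96) * (2 * (n * A)) ≤ (n - 3) * (12 * a - 96) * (n^2 * a + a^2) := by
      apply mul_le_mul_of_nonneg_left _ (mul_nonneg h3 (by linarith))
      linarith
    have key : 0 ≤ a * (18 * a^2 - a * (24 * n^2 - 156 * n + 144) + 16 * n^4 - 176 * n^2 + 96 * n)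
        - 32 * n^2 * (n - 1) * (n - 2) := by
      have i0 : 0 ≤ 8 * n^4 - 176 * n^2 + 96 * n + 8 * (156 * n - 144) := by nlinarith [sq_nonneg (n^2 - 11), mul_nonneg h4 h4]
      have i1 : 8 * n^4 - 176 * n^2 + 96 * n + 8 * (156 * n - 144) ≤ 18 * a^2 - a * (24 * n^2 - 156 * n + 144) + 16 * n^4 - 176 * n^2 + 96 * n := by
        nlinarith [sq_nonneg (3 * a - 2 * n^2), mul_nonneg (by linarith : 0 ≤ a - 8) (by linarith : 0 ≤ 156 * n - 144)]
      have i2 : 8 * (8 * n^4 - 176 * n^2 + 96 * n + 8 * (156 * n - 144)) ≤ a * (18 * a^2 - a * (24 * n^2 - 156 * n + 144) + 16 * n^4 - 176 * n^2 + 96 * n) :=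
        mul_le_mul h i1 i0 ha
      have i3 : 0 ≤ 32 * n^4 + 96 * n^3 - 1472 * n^2 + 10752 * n - 9216 := by
        have : 32 * n^4 + 96 * n^3 - 1472 * n^2 + 10752 * n - 9216 = 32 * (n-4)^4 + 608 * (n-4)^3 + 2752 * (n-4)^2 + (10752 + 8192 + 4608 - 11776) * (n - 4) + 24576 := by ring
        rw [this]; positivity
      linarith
    have n0 : 0 < n := by linarith
    refine le_of_mul_le_mul_left ?_ n0
    nlinarith

lemma det_main (hN : 4 ≤ N) : ∑ st ∈ (Finset.univ : Finset (Fin N)).offDiag,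
    vv x st.1 st.2 / (4 * (N - 2) + AA x 1 - bb x st.1 st.2) ≤ N * (N - 1) / (N - 3) := by
  have hN' : (4:ℝ) ≤ N := by exact_mod_cast hN
  set a := AA x 1 with ha
  have a0 : 0 ≤ a := AA_nonneg x 1
  set W : ℝ := 4 * (N - 2) + a with hW
  have W0 : 0 < W := by linarith
  set g : ℝ := if a < 8 then 4 * ((N:ℝ) - 2) else a - 2 with hg
  have g0 : 0 < g := by rw [hg]; split_ifs with h <;> [linarith; (push Not at h; linarith)]
  have gW : ∀ s t : Fin N, s ≠ t → g ≤ W - bb x s t := by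
    intro s t hst
    have h1 := bb_le_A x s t hst
    have h2 := bb_le_N x s t hst
    rw [hg, hW]; split_ifs <;> linarith
  have pt : ∀ st ∈ (Finset.univ : Finset (Fin N)).offDiag, vv x st.1 st.2 / (W - bb x st.1 st.2) ≤
      (W * vv x st.1 st.2 + vv x st.1 st.2 * bb x st.1 st.2 + (vv x st.1 st.2 * bb x st.1 st.2^2) / g) / W^2 := by
    intro st hst
    rw [Finset.mem_offDiag] at hst
    have h1 := gW st.1 st.2 hst.2.2
    have v0 := vv_nonneg x st.1 st.2
    set v := vv x st.1 st.2
    set b := bb x st.1 st.2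
    have Wb : 0 < W - b := by linarith
    have e : v / (W - b) = (W * v + v * b + (v * b^2) / (W - b)) / W^2 := by field_simp; ring
    rw [e]
    gcongr
  refine (Finset.sum_le_sum pt).trans ?_
  rw [← Finset.sum_div, Finset.sum_add_distrib, Finset.sum_add_distrib, ← Finset.mul_sum, ← Finset.sum_div, sum_vv, sum_vb]
  set L := ∑ st ∈ (Finset.univ : Finset (Fin N)).offDiag, vv x st.1 st.2 * bb x st.1 st.2^2 with hLd
  have hL : L ≤ 24 * a * AA x 2 - 120 * AA x 2 + (48 - 4 * N) * a^2 + (16 - 4 * N) * a := by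
    rw [hLd, sum_vbb]
    have := PP_le x
    nlinarith
  have D := det_ineq N a (AA x 2) _ L g hN' a0 (AA_nonneg x 2) (A2_le x) hL rfl hg
  have n3 : (0:ℝ) < N - 3 := by linarith
  rw [div_le_div_iff₀ (by positivity) n3]
  have D2 : (N - 3) * (L / g) ≤ 16 * N * (N - 1) * (N - 2) + a * (2 * N^2 + 18 * N - 24) + 6 * a^2 + 12 * (N - 3) * AA x 2 := by
    rw [← mul_div_assoc, div_le_iff₀ g0]; linarith
  rw [← ha]
  have : W = 4 * (N - 2) + a := hW
  rw [this]
  nlinarith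

end det

lemma sm_perm (p : PMF ℕ) (N : ℕ) (ρ : Equiv.Perm (Fin N)) (f : (Fin N → ℕ) → ℝ) :
    ∫ x, f (x ∘ ρ) ∂(sampleMeasure p N) = ∫ x, f x ∂(sampleMeasure p N) := by
  unfold sampleMeasure
  have h := measurePreserving_piCongrLeft (fun _ : Fin N => p.toMeasure) ρ.symm
  rw [← h.integral_comp' (g := f)]
  congr 1
  funext x
  congr 1
  funext j
  obtain ⟨i, rfl⟩ := ρ.symm.surjective j
  rw [MeasurableEquiv.coe_piCongrLeft, Equiv.piCongrLeft_apply_apply]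
  simp

noncomputable def HH {N : ℕ} (x : Fin N → ℕ) (s t : Fin N) : ℝ :=
  vv x s t / (4 * (N - 2) + AA x 1 - bb x s t)

lemma DD_perm {N : ℕ} (x : Fin N → ℕ) (ρ : Equiv.Perm (Fin N)) (s : Fin N) :
    DD (x ∘ ρ) s = DD x (ρ s) := by
  unfold DD
  rw [← Equiv.sum_comp ρ (fun t => ch x (ρ s) t)]
  rfl

lemma HH_perm {N : ℕ} (x : Fin N → ℕ) (ρ : Equiv.Perm (Fin N)) (s t : Fin N) :
    HH (x ∘ ρ) s t = HH x (ρ s) (ρ t) := by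
  have e : AA (x ∘ ρ) 1 = AA x 1 := by
    unfold AA
    simp only [DD_perm]
    exact Equiv.sum_comp ρ (fun t => DD x t ^ 1)
  have c : ch (x ∘ ρ) s t = ch x (ρ s) (ρ t) := rfl
  unfold HH vv bb
  rw [e, DD_perm, DD_perm, c]

lemma perm_ex {N : ℕ} (a b s t : Fin N) (hab : a ≠ b) (hst : s ≠ t) :
    ∃ ρ : Equiv.Perm (Fin N), ρ a = s ∧ ρ b = t := by
  refine ⟨Equiv.swap (Equiv.swap a s b) t * Equiv.swap a s, ?_, ?_⟩
  · rw [Equiv.Perm.mul_apply, Equiv.swap_apply_left]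
    apply Equiv.swap_apply_of_ne_of_ne _ hst
    intro h
    have h2 : Equiv.swap a s a = Equiv.swap a s b := by rw [Equiv.swap_apply_left]; exact h
    exact hab ((Equiv.swap a s).injective h2)
  · rw [Equiv.Perm.mul_apply, Equiv.swap_apply_left]

lemma HH_bdd {N : ℕ} (hN : 4 ≤ N) (x : Fin N → ℕ) (s t : Fin N) (hst : s ≠ t) :
    0 ≤ HH x s t ∧ HH x s t ≤ 4 + 2 * N := by
  have hN' : (4:ℝ) ≤ N := by exact_mod_cast hN
  have h1 := bb_le_A x s t hst
  have h2 := vv_nonneg x s t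
  have h3 : 1 ≤ 4 * ((N:ℝ) - 2) + AA x 1 - bb x s t := by linarith
  have h4 : vv x s t ≤ 4 + 2 * N := by
    have := DD_le x s; have := DD_le x t; have := ch_nonneg x s t
    have : 0 ≤ N * ch x s t := by positivity
    unfold vv; linarith
  unfold HH
  refine ⟨by positivity, ?_⟩
  rw [div_le_iff₀ (by linarith)]
  nlinarith

lemma int_HH (p : PMF ℕ) (N : ℕ) (hN : 4 ≤ N) (a b : Fin N) (hab : a ≠ b) :
    ∫ x, HH x a b ∂(sampleMeasure p N) ≤ 1 / (N - 3) := by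
  have hN' : (4:ℝ) ≤ N := by exact_mod_cast hN
  have h1 : ∀ st ∈ (Finset.univ : Finset (Fin N)).offDiag,
      ∫ x, HH x st.1 st.2 ∂(sampleMeasure p N) = ∫ x, HH x a b ∂(sampleMeasure p N) := by
    intro st hst
    rw [Finset.mem_offDiag] at hst
    obtain ⟨ρ, e1, e2⟩ := perm_ex a b st.1 st.2 hab hst.2.2
    rw [← sm_perm p N ρ (fun x => HH x a b)]
    congr 1; funext x
    rw [HH_perm, e1, e2]
  have h2 : ∑ st ∈ (Finset.univ : Finset (Fin N)).offDiag, ∫ x, HH x st.1 st.2 ∂(sampleMeasure p N)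
      ≤ N * (N - 1) / (N - 3) := by
    have hi : ∀ st ∈ (Finset.univ : Finset (Fin N)).offDiag, Integrable (fun x => HH x st.1 st.2) (sampleMeasure p N) := by
      intro st hst
      rw [Finset.mem_offDiag] at hst
      refine sm_integrable p N _ (4 + 2 * N) fun x => ?_
      have := HH_bdd hN x st.1 st.2 hst.2.2
      rw [abs_of_nonneg this.1]; exact this.2
    rw [← integral_finsetSum _ hi]
    have : ∫ x, ∑ st ∈ (Finset.univ : Finset (Fin N)).offDiag, HH x st.1 st.2 ∂(sampleMeasure p N)
        ≤ ∫ _, (N:ℝ) * (N - 1) / (N - 3) ∂(sampleMeasure p N) :=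
      integral_mono (integrable_finsetSum _ hi) (integrable_const _) fun x => det_main x hN
    simpa using this
  rw [Finset.sum_congr rfl h1, Finset.sum_const, Finset.offDiag_card, nsmul_eq_mul] at h2
  simp only [Finset.card_univ, Fintype.card_fin] at h2
  rw [Nat.cast_sub (by nlinarith)] at h2
  push_cast at h2
  rw [le_div_iff₀ (by linarith)] at h2 ⊢
  have : (0:ℝ) < N * (N - 1) := by nlinarith
  nlinarith

/-- ghost sample form -/
lemma HH_cons (n : ℕ) (hn : 2 ≤ n) (a b : ℕ) (y : Fin n → ℕ) :
    HH (Fin.cons a (Fin.cons b y : Fin (n+1) → ℕ) : Fin (n+2) → ℕ) 0 1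
      = ((n^2 - AA y 1 - n * cnt y a - n * cnt y b + n^2 * (if a = b then 1 else 0)) / (4 * n + AA y 1) + 1) / n := by
  have hn' : (2:ℝ) ≤ n := by exact_mod_cast hn
  set x : Fin (n+2) → ℕ := Fin.cons a (Fin.cons b y : Fin (n+1) → ℕ) with hx
  have x0 : x 0 = a := rfl
  have x1 : x (Fin.succ 0) = b := rfl
  have xs : ∀ j : Fin n, x j.succ.succ = y j := fun j => rfl
  have x1' : x 1 = b := rfl
  set e : ℝ := if a = b then 1 else 0 with he
  have c01 : ch x 0 1 = 1 - e := by
    rw [he]; unfold ch; rw [x0, x1']; split_ifs <;> norm_num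
  have cn : ∀ i : ℕ, ∑ j, (if i = y j then (0:ℝ) else 1) = n - cnt y i := by
    intro i
    rw [cnt_eq_sum]
    push_cast
    have : ∀ j, (if i = y j then (0:ℝ) else 1) = 1 - (if y j = i then 1 else 0) := by
      intro j; by_cases h : i = y j
      · simp [h]
      · simp [h, Ne.symm h]
    simp only [this, Finset.sum_sub_distrib]; simp
  have cn' : ∀ i : ℕ, ∑ j, (if y j = i then (0:ℝ) else 1) = n - cnt y i := by
    intro i; rw [← cn]; simp only [eq_comm]
  have D0 : DD x 0 = (1 - e) + (n - cnt y a) := by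
    unfold DD
    rw [Fin.sum_univ_succ, Fin.sum_univ_succ, ch_self, ← cn a]
    have : ch x 0 (Fin.succ 0) = 1 - e := c01
    rw [this]
    simp only [ch, x0, xs]; ring
  have D1 : DD x 1 = (1 - e) + (n - cnt y b) := by
    unfold DD
    rw [Fin.sum_univ_succ, Fin.sum_univ_succ, ch_symm, c01, ← cn b]
    have : ch x 1 (Fin.succ 0) = 0 := ch_self x 1
    rw [this]
    simp only [ch, x1', xs]; ring
  have Ds : ∀ j : Fin n, DD x j.succ.succ = DD y j + (if y j = a then 0 else 1) + (if y j = b then 0 else 1) := by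
    intro j
    unfold DD
    rw [Fin.sum_univ_succ, Fin.sum_univ_succ]
    simp only [ch, x0, x1, xs]; ring
  have A : AA x 1 = AA y 1 + 2 * (n - cnt y a) + 2 * (n - cnt y b) + 2 * (1 - e) := by
    unfold AA
    rw [Fin.sum_univ_succ, Fin.sum_univ_succ]
    simp only [pow_one, Ds, Finset.sum_add_distrib]
    rw [cn', cn', D0]
    have : DD x (Fin.succ 0) = DD x 1 := rfl
    rw [this, D1]; ring
  have a0 := AA_nonneg y 1
  have d0 : 4 * (n:ℝ) + AA y 1 ≠ 0 := by linarith
  unfold HH vv bb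
  rw [c01, D0, D1, A]
  have e1 : 4 * (((n+2:ℕ):ℝ) - 2) + (AA y 1 + 2 * (n - cnt y a) + 2 * (n - cnt y b) + 2 * (1 - e)) -
    (2 * (1 - e + (n - cnt y a) + (1 - e + (n - cnt y b))) - 2 * (1 - e)) = 4 * n + AA y 1 := by push_cast; ring
  rw [e1]
  push_cast
  field_simp
  ring

noncomputable def p2 (p : PMF ℕ) : ℝ := ∫ a, (p a).toReal ∂p.toMeasure

noncomputable def XX (p : PMF ℕ) (n : ℕ) (y : Fin n → ℕ) : ℝ :=
  n^2 - AA y 1 - 2 * n * ∑ j, (p (y j)).toReal + n^2 * p2 p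

lemma int_cnt_pm (p : PMF ℕ) (n : ℕ) (y : Fin n → ℕ) :
    ∫ a, (cnt y a : ℝ) ∂p.toMeasure = ∑ j, (p (y j)).toReal := by
  have : ∀ a, (cnt y a : ℝ) = ∑ j, (if a = y j then (1:ℝ) else 0) := by
    intro a; rw [cnt_eq_sum]; push_cast; simp only [eq_comm]
  simp only [this]
  rw [integral_finsetSum]
  · refine Finset.sum_congr rfl fun j _ => ?_
    rw [pm_ite]; ring
  · intro j _
    refine pm_integrable p _ 1 fun a => ?_
    split_ifs <;> simp

lemma int_XX (p : PMF ℕ) (n : ℕ) (hn : 2 ≤ n) :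
    ∫ y, XX p n y / (4 * n + AA y 1) ∂(sampleMeasure p n) ≤ 1 / (n - 1) := by
  have hn' : (2:ℝ) ≤ n := by exact_mod_cast hn
  have h := int_HH p (n+2) (by omega) 0 1 (by simp)
  have bd : ∀ x : Fin (n+2) → ℕ, |HH x 0 1| ≤ 4 + 2 * ((n+2:ℕ):ℝ) := by
    intro x
    have := HH_bdd (by omega) x 0 1 (by simp)
    rw [abs_of_nonneg this.1]; exact this.2
  rw [sm_succ' p (n+1) _ _ bd] at h
  rw [sm_succ' p n _ (4 + 2 * ((n+2:ℕ):ℝ)) (fun y => by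
    have := norm_integral_le_of_norm_le_const (μ := p.toMeasure) (C := 4 + 2 * ((n+2:ℕ):ℝ))
      (f := fun a : ℕ => HH (Fin.cons a y : Fin (n+2) → ℕ) 0 1) (ae_of_all _ fun a : ℕ => bd (Fin.cons a y))
    simpa using this)] at h
  have cb : ∀ (y : Fin n → ℕ) (a : ℕ), |(cnt y a : ℝ)| ≤ n := by
    intro y a
    rw [abs_of_nonneg (by positivity)]
    exact_mod_cast cnt_le y a
  have ic : ∀ y : Fin n → ℕ, Integrable (fun a => (cnt y a : ℝ)) p.toMeasure := fun y => pm_integrable p _ n (cb y)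
  have ip : Integrable (fun a => (p a).toReal) p.toMeasure := pm_integrable p _ 1 fun a => by
    rw [abs_of_nonneg ENNReal.toReal_nonneg]; exact p_le_one p a
  have key : ∀ y : Fin n → ℕ, ∫ b, ∫ a, HH (Fin.cons a (Fin.cons b y : Fin (n+1) → ℕ) : Fin (n+2) → ℕ) 0 1 ∂p.toMeasure ∂p.toMeasure
      = (XX p n y / (4 * n + AA y 1) + 1) / n := by
    intro y
    have inner : ∀ b : ℕ, ∫ a, HH (Fin.cons a (Fin.cons b y : Fin (n+1) → ℕ) : Fin (n+2) → ℕ) 0 1 ∂p.toMeasure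
        = ((n^2 - AA y 1 - n * (∑ j, (p (y j)).toReal) - n * cnt y b + n^2 * (p b).toReal) / (4 * n + AA y 1) + 1) / n := by
      intro b
      simp only [HH_cons n hn]
      have ii : Integrable (fun a : ℕ => if a = b then (1:ℝ) else 0) p.toMeasure :=
        pm_integrable p _ 1 fun a => by split_ifs <;> simp
      rw [integral_div, integral_add, integral_div, integral_add, integral_sub, integral_sub, integral_const_mul, integral_const_mul, integral_const_mul, int_cnt_pm, pm_ite]
      · simp
      · exact integrable_const _
      · exact (ic y).const_mul _
      · exact (integrable_const _).sub ((ic y).const_mul _)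
      · exact integrable_const _
      · exact ((integrable_const _).sub ((ic y).const_mul _)).sub (integrable_const _)
      · exact ii.const_mul _
      · exact ((((integrable_const _).sub ((ic y).const_mul _)).sub (integrable_const _)).add (ii.const_mul _)).div_const _
      · exact integrable_const _
    simp only [inner]
    rw [integral_div, integral_add, integral_div, integral_add, integral_sub, integral_const_mul, integral_const_mul, int_cnt_pm]
    · unfold XX p2
      simp
      ring
    · exact integrable_const _
    · exact (ic y).const_mul _
    · exact (integrable_const _).sub ((ic y).const_mul _)
    · exact ip.const_mul _
    · exact ((((integrable_const _).sub ((ic y).const_mul _))).add (ip.const_mul _)).div_const _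
    · exact integrable_const _
  simp only [key] at h
  by_cases hi : Integrable (fun y => XX p n y / (4 * n + AA y 1)) (sampleMeasure p n)
  · rw [integral_div, integral_add hi (integrable_const _)] at h
    simp at h
    rw [div_le_iff₀ (by linarith)] at h
    have e : ((n:ℝ) + 2 - 3)⁻¹ * n - 1 = 1 / (n - 1) := by
      have : (n:ℝ) - 1 ≠ 0 := by linarith
      rw [show (n:ℝ) + 2 - 3 = n - 1 by ring]; field_simp; ring
    linarith
  · rw [integral_undef hi]
    exact div_nonneg zero_le_one (by linarith)

lemma sum_comp_cnt {n : ℕ} (y : Fin n → ℕ) (S : Finset ℕ) (hS : Finset.univ.image y ⊆ S) (g : ℕ → ℝ) :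
    ∑ i ∈ S, (cnt y i : ℝ) * g i = ∑ j, g (y j) := by
  simp only [cnt_eq_sum]
  push_cast
  simp only [Finset.sum_mul]
  rw [Finset.sum_comm]
  refine Finset.sum_congr rfl fun j _ => ?_
  have : y j ∈ S := hS (Finset.mem_image_of_mem _ (Finset.mem_univ _))
  simp [ite_mul, this]

lemma DD_cnt {n : ℕ} (y : Fin n → ℕ) (j : Fin n) : DD y j = n - cnt y (y j) := by
  unfold DD
  rw [cnt_eq_sum]
  push_cast
  have : ∀ t, ch y j t = 1 - (if y t = y j then (1:ℝ) else 0) := by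
    intro t; unfold ch
    by_cases h : y j = y t
    · simp [h]
    · simp [h, Ne.symm h]
  simp only [this, Finset.sum_sub_distrib]; simp

lemma AA_cnt {n : ℕ} (y : Fin n → ℕ) (S : Finset ℕ) (hS : Finset.univ.image y ⊆ S) :
    AA y 1 = ∑ i ∈ S, (cnt y i : ℝ) * (n - cnt y i) := by
  rw [sum_comp_cnt y S hS (fun i => (n:ℝ) - cnt y i)]
  unfold AA
  simp only [pow_one, DD_cnt]

lemma FF_one (n : ℕ) (y : Fin n → ℕ) : FF 1 n y = AA y 1 / n := by
  rw [FF_eq 1 n y _ subset_rfl, AA_cnt y _ subset_rfl, Finset.sum_div]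
  refine Finset.sum_congr rfl fun i _ => ?_
  simp [hh, yy]

lemma p2_ge (p : PMF ℕ) (S : Finset ℕ) : ∑ i ∈ S, (p i).toReal ^ 2 ≤ p2 p := by
  have ii : ∀ i ∈ S, Integrable (fun a : ℕ => if a = i then (p i).toReal else 0) p.toMeasure := fun i _ =>
    pm_integrable p _ 1 fun a => by
      split_ifs
      · rw [abs_of_nonneg ENNReal.toReal_nonneg]; exact p_le_one p i
      · simp
  have ip : Integrable (fun a => (p a).toReal) p.toMeasure := pm_integrable p _ 1 fun a => by
    rw [abs_of_nonneg ENNReal.toReal_nonneg]; exact p_le_one p a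
  have h : ∫ a, ∑ i ∈ S, (if a = i then (p i).toReal else 0) ∂p.toMeasure ≤ p2 p := by
    refine integral_mono (integrable_finsetSum _ ii) ip fun a => ?_
    simp only [Finset.sum_ite_eq]
    split_ifs
    · exact le_rfl
    · exact ENNReal.toReal_nonneg
  rw [integral_finsetSum _ ii] at h
  simp only [pm_ite] at h
  refine le_trans (le_of_eq ?_) h
  refine Finset.sum_congr rfl fun i _ => ?_
  ring

lemma p2_bd (p : PMF ℕ) : 0 ≤ p2 p ∧ p2 p ≤ 1 := by
  constructor
  · exact integral_nonneg fun a => ENNReal.toReal_nonneg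
  · have ip : Integrable (fun a => (p a).toReal) p.toMeasure := pm_integrable p _ 1 fun a => by
      rw [abs_of_nonneg ENNReal.toReal_nonneg]; exact p_le_one p a
    have : p2 p ≤ ∫ _, (1:ℝ) ∂p.toMeasure := integral_mono ip (integrable_const _) fun a => p_le_one p a
    simpa using this

lemma XX_ge (p : PMF ℕ) (n : ℕ) (y : Fin n → ℕ) (i : ℕ) :
    ((cnt y i : ℝ) - n * (p i).toReal) ^ 2 ≤ XX p n y := by
  set S := insert i (Finset.univ.image y)
  have hS : Finset.univ.image y ⊆ S := Finset.subset_insert _ _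
  have h1 : ((cnt y i : ℝ) - n * (p i).toReal) ^ 2 ≤ ∑ i ∈ S, ((cnt y i : ℝ) - n * (p i).toReal) ^ 2 :=
    Finset.single_le_sum (f := fun i => ((cnt y i : ℝ) - n * (p i).toReal) ^ 2) (fun _ _ => sq_nonneg _) (Finset.mem_insert_self _ _)
  have h2 : ∑ i ∈ S, ((cnt y i : ℝ) - n * (p i).toReal) ^ 2
      = n * ∑ i ∈ S, (cnt y i : ℝ) * 1 - ∑ i ∈ S, (cnt y i : ℝ) * (n - cnt y i)
        - 2 * n * ∑ i ∈ S, (cnt y i : ℝ) * (p i).toReal + n^2 * ∑ i ∈ S, (p i).toReal ^ 2 := by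
    simp only [Finset.mul_sum, ← Finset.sum_sub_distrib, ← Finset.sum_add_distrib]
    exact Finset.sum_congr rfl fun i _ => by ring
  rw [← AA_cnt y S hS, sum_comp_cnt y S hS (fun _ => 1), sum_comp_cnt y S hS (fun i => (p i).toReal)] at h2
  have h3 := p2_ge p S
  have h4 : (n:ℝ)^2 * ∑ i ∈ S, (p i).toReal ^ 2 ≤ n^2 * p2 p := by gcongr
  simp at h2
  unfold XX
  nlinarith

lemma CC_one (n : ℕ) (hn : 2 ≤ n) : 4 ≤ 1.5 * √((n:ℝ) / 2) * CC 1 n := by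
  have hn' : (2:ℝ) ≤ n := by exact_mod_cast hn
  have e : CC 1 n = 1 + 24 / (n:ℝ)^2 := by
    unfold CC
    simp
    field_simp
    ring
  rw [e]
  have key : (128:ℝ) / 9 * n^3 ≤ (n^2 + 24)^2 := by
    by_cases h9 : 9 ≤ n
    · have h9' : (9:ℝ) ≤ n := by exact_mod_cast h9
      have : (128:ℝ) / 9 * n ≤ n^2 + 48 := by nlinarith
      nlinarith [mul_le_mul_of_nonneg_left this (sq_nonneg (n:ℝ))]
    · interval_cases n <;> norm_num
  have k2 : (32:ℝ)/9 * 4 * n^3 / n^4 ≤ (1 + 24/(n:ℝ)^2)^2 * 1 := by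
    rw [div_le_iff₀ (by positivity)]
    have : (1 + 24/(n:ℝ)^2)^2 * 1 * n^4 = (n^2+24)^2 := by field_simp
    rw [this]; linarith
  have k3 : (8/3 : ℝ)^2 ≤ (√((n:ℝ) / 2) * (1 + 24 / (n:ℝ)^2))^2 := by
    rw [mul_pow, sq_sqrt (by positivity)]
    have : (8/3 : ℝ)^2 = n / 2 * ((32:ℝ)/9 * 4 * n^3 / n^4) := by field_simp; norm_num
    rw [this]
    gcongr
    linarith
  have := abs_le_of_sq_le_sq' k3 (by positivity)
  linarith [this.2]

lemma K_one (p : PMF ℕ) (n : ℕ) (hn : 2 ≤ n) (δ₁ δ₂ : ℝ) (h1 : 0 < δ₁) (h2 : 0 < δ₂) (hs : δ₁ + δ₂ < 1) :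
    sampleMeasure p n (bad p 1 n δ₁ δ₂) ≤ ENNReal.ofReal (δ₁ + δ₂) := by
  have hn' : (2:ℝ) ≤ n := by exact_mod_cast hn
  set σ := δ₁ + δ₂ with hσ
  have s0 : 0 < σ := by linarith
  set f : (Fin n → ℕ) → ℝ := fun y => XX p n y / (4 * n + AA y 1) with hf
  have X0 : ∀ y, 0 ≤ XX p n y := fun y => (sq_nonneg _).trans (XX_ge p n y 0)
  have f0 : ∀ y, 0 ≤ f y := fun y => div_nonneg (X0 y) (by have := AA_nonneg y 1; linarith)
  have fi : Integrable f (sampleMeasure p n) := by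
    refine sm_integrable p n f (2 * n^2) fun y => ?_
    rw [abs_of_nonneg (f0 y)]
    have := AA_nonneg y 1
    rw [hf]
    simp only
    rw [div_le_iff₀ (by linarith)]
    have h3 : XX p n y ≤ 2 * n^2 := by
      unfold XX
      have : 0 ≤ 2 * (n:ℝ) * ∑ j, (p (y j)).toReal := by positivity
      have := (p2_bd p).2
      nlinarith
    have : 0 ≤ (n:ℝ)^2 := by positivity
    nlinarith
  have sub : bad p 1 n δ₁ δ₂ ⊆ {y | 1 / ((n - 1) * σ) ≤ f y} := by
    rintro y ⟨i, hi⟩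
    have hX := XX_ge p n y i
    have a0 := AA_nonneg y 1
    rw [mul_one] at hi
    have hlt := hi.trans_le hX
    rw [FF_one] at hlt
    have C4 := CC_one n hn
    have eps := eps_ge δ₁ δ₂ h1 h2 hs
    have C0 : 0 ≤ √((n:ℝ) / 2) * CC 1 n := by
      have : 1.5 * √((n:ℝ) / 2) * CC 1 n = 1.5 * (√((n:ℝ) / 2) * CC 1 n) := by ring
      rw [this] at C4; linarith
    have sq : √((n:ℝ) / 2 * log (1 / δ₂)) = √((n:ℝ) / 2) * √(log (1 / δ₂)) := sqrt_mul (by positivity) _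
    rw [sq] at hlt
    have e1 : (n : ℝ) / (n - 1) / δ₁ * (AA y 1 / n + √((n:ℝ) / 2) * √(log (1 / δ₂)) * CC 1 n)
        = n / (n - 1) * (AA y 1 / n / δ₁ + √(log (1 / δ₂)) / δ₁ * (√((n:ℝ) / 2) * CC 1 n)) := by
      have : (n:ℝ) - 1 ≠ 0 := by linarith
      field_simp
    rw [e1] at hlt
    have e2 : AA y 1 / n / σ ≤ AA y 1 / n / δ₁ := by
      apply div_le_div_of_nonneg_left _ h1 (by linarith)
      positivity
    have e3 : 4 / σ ≤ √(log (1 / δ₂)) / δ₁ * (√((n:ℝ) / 2) * CC 1 n) := by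
      refine le_trans ?_ (mul_le_mul_of_nonneg_right eps C0)
      rw [div_mul_eq_mul_div]
      gcongr
      linarith
    have e4 : (n : ℝ) / (n - 1) * (AA y 1 / n / σ + 4 / σ) ≤ XX p n y := by
      refine le_trans ?_ hlt.le
      have : 0 ≤ (n : ℝ) / (n - 1) := div_nonneg (by linarith) (by linarith)
      gcongr
    have e5 : (n : ℝ) / (n - 1) * (AA y 1 / n / σ + 4 / σ) = 1 / ((n - 1) * σ) * (4 * n + AA y 1) := by
      have : (n:ℝ) - 1 ≠ 0 := by linarith
      field_simp
      ring
    rw [e5] at e4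
    show 1 / ((n - 1) * σ) ≤ XX p n y / (4 * n + AA y 1)
    rwa [le_div_iff₀ (by linarith)]
  have mk := mul_meas_ge_le_integral_of_nonneg (ae_of_all _ f0) fi (1 / ((n - 1) * σ))
  have iX := int_XX p n hn
  have m2 : (sampleMeasure p n).real {y | 1 / ((n - 1) * σ) ≤ f y} ≤ σ := by
    have h3 := mk.trans iX
    have n1 : (0:ℝ) < n - 1 := by linarith
    rw [one_div_mul_eq_div, div_le_div_iff₀ (by positivity) n1] at h3
    nlinarith
  refine (measure_mono sub).trans ?_
  rw [← ofReal_measureReal]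
  exact ENNReal.ofReal_le_ofReal m2

theorem assemble (p : PMF ℕ) (n : ℕ) (hn : 2 ≤ n) (δ₁ δ₂ : ℝ) (hδ₁ : 0 < δ₁) (hδ₂ : 0 < δ₂)
    (hs : δ₁ + δ₂ < 1) (K : ℕ) (hK : 1 ≤ K) :
    sampleMeasure p n (bad p K n δ₁ δ₂) ≤ ENNReal.ofReal (δ₁ + δ₂) := by
  rcases Nat.lt_or_ge K 2 with h | h
  · obtain rfl : K = 1 := by omega
    exact K_one p n hn δ₁ δ₂ hδ₁ hδ₂ hs
  · exact K_ge_two p K n hn h δ₁ δ₂ hδ₁ hδ₂ hs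

/-- Theorem 2, data-dependent bound: with probability at least
`1 - δ₁ - δ₂`, `sup_i |p_i - p̂_i| ≤
(1/n) [ (1/δ₁)(n/(n-1)) ( ∑_i ∑_{k=1}^{m/2} k^{m-k} n^k (p̂_i(1-p̂_i))^k + ε ) ]^{1/m}`,
with `ε = √((n/2) log(1/δ₂)) ∑_{k=1}^{m/2} k^{m-k} n^k (k/(n 4^{k-1}) + 3k³/(n³ 2^{2k-5}))`. -/
theorem stmt_3 (p : PMF ℕ) (n : ℕ) (hn : 2 ≤ n) (δ₁ δ₂ : ℝ) (hδ₁ : 0 < δ₁) (hδ₂ : 0 < δ₂)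
    (m : ℕ) (hm : 0 < m) (hme : Even m) :
    ENNReal.ofReal (1 - δ₁ - δ₂) ≤
      sampleMeasure p n {x |
        (⨆ i : ℕ, |(p i).toReal - mle n x i|) ≤
          (1 / n) *
            ((1 / δ₁) * ((n : ℝ) / ((n : ℝ) - 1)) *
              ((∑' i : ℕ, ∑ k ∈ Finset.Icc 1 (m / 2),
                  (k : ℝ) ^ (m - k) * (n : ℝ) ^ k *
                    (mle n x i * (1 - mle n x i)) ^ k) +
                Real.sqrt ((n / 2) * Real.log (1 / δ₂)) *
                  ∑ k ∈ Finset.Icc 1 (m / 2),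
                    (k : ℝ) ^ (m - k) * (n : ℝ) ^ k *
                      ((k : ℝ) / (n * (4 : ℝ) ^ ((k : ℤ) - 1)) +
                        3 * (k : ℝ) ^ 3 / ((n : ℝ) ^ 3 * (2 : ℝ) ^ (2 * (k : ℤ) - 5))))) ^
              ((1 : ℝ) / m)} := by
  rcases le_or_gt 1 (δ₁ + δ₂) with hs | hs
  · rw [ENNReal.ofReal_of_nonpos (by linarith)]
    exact zero_le
  obtain ⟨K, hK⟩ := hme
  have hK1 : 1 ≤ K := by omega
  obtain rfl : m = 2 * K := by omega
  have e : 2 * K / 2 = K := by omega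
  rw [e]
  exact final p n hn δ₁ δ₂ hδ₁ hδ₂ K hK1 hs (assemble p n hn δ₁ δ₂ hδ₁ hδ₂ hs K hK1)
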